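/- arXiv:2003.03643 — 2 statements merged into one kernel-verified Lean document; each statement's English description precedes it below -/
import Mathlib

section
/- For any fixed R > 1 the following expansion holds in C²(B(P,Rε) \ B(P,ε)) as ε → 0 (i.e. the difference of the two sides, together with its first and second derivatives with respect to the rescaled variable w = (x−P)/ε, tends to 0 uniformly on B(P,Rε) \ B(P,ε)): u_ε(x) = u_0(x) − u_0(P) ε^{N−2}/|x−P|^{N−2} + o(1) if N ≥ 3, and u_ε(x) = u_0(x) − u_0(P) (log|x−P| + 2πH(P,P))/log ε + o(1) if N = 2. -/
open Filter Set Topology Metric MeasureTheory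

noncomputable section

/-- Euclidean space `ℝ^N`. -/
abbrev EN (N : ℕ) := EuclideanSpace ℝ (Fin N)

/-- Partial derivative `∂u/∂x_i`. -/
def pd {N : ℕ} (u : EN N → ℝ) (i : Fin N) (x : EN N) : ℝ :=
  fderiv ℝ u x (EuclideanSpace.single i 1)

/-- Second partial derivative `∂²u/∂x_i∂x_j`. -/
def pd2 {N : ℕ} (u : EN N → ℝ) (i j : Fin N) (x : EN N) : ℝ :=
  fderiv ℝ (fun y => pd u i y) x (EuclideanSpace.single j 1)

/-- The Laplacian `Δu`. -/
def lap {N : ℕ} (u : EN N → ℝ) (x : EN N) : ℝ := ∑ i, pd2 u i i x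

/-- The Hessian matrix of `u` at `x`. -/
def hess {N : ℕ} (u : EN N → ℝ) (x : EN N) : Matrix (Fin N) (Fin N) ℝ :=
  Matrix.of fun i j => pd2 u i j x

/-- `u` is a (classical, positive) solution of `-Δu = f(u)` in `D`, `u > 0` in `D`,
`u = 0` on `∂D`. -/
def IsSol {N : ℕ} (f : ℝ → ℝ) (D : Set (EN N)) (u : EN N → ℝ) : Prop :=
  ContDiffOn ℝ 2 u D ∧ (∀ x ∈ D, lap u x = - f (u x)) ∧ (∀ x ∈ D, 0 < u x) ∧
    ContinuousOn u (closure D) ∧ (∀ x ∈ frontier D, u x = 0)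

/-- `u ε → u₀` in `C²(K)` as `ε → 0⁺`: uniform convergence on `K` of the functions and of
their first and second partial derivatives. -/
def C2ConvOn {N : ℕ} (u : ℝ → EN N → ℝ) (u₀ : EN N → ℝ) (K : Set (EN N)) : Prop :=
  TendstoUniformlyOn (fun ε => u ε) u₀ (𝓝[>] (0:ℝ)) K ∧
    (∀ i, TendstoUniformlyOn (fun ε => pd (u ε) i) (pd u₀ i) (𝓝[>] (0:ℝ)) K) ∧
    (∀ i j, TendstoUniformlyOn (fun ε => pd2 (u ε) i j) (pd2 u₀ i j) (𝓝[>] (0:ℝ)) K)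

/-- The common setting of the paper: `Ω` a bounded domain, `P ∈ Ω`, `f` smooth, and for every
small `ε > 0`, `u ε` solves `-Δu = f(u)`, `u > 0` in `Ω_ε = Ω \ B(P,ε)`, `u = 0` on `∂Ω_ε`,
with a uniform bound `|u ε| ≤ C`, and `u₀` is the weak limit: a solution on `Ω` such that
`u ε → u₀` in `C²(K)` for every compact `K ⊆ Ω \ {P}`. -/
def Setting {N : ℕ} (Ω : Set (EN N)) (P : EN N) (f : ℝ → ℝ) (ε₀ C : ℝ)
    (u : ℝ → EN N → ℝ) (u₀ : EN N → ℝ) : Prop :=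
  IsOpen Ω ∧ Bornology.IsBounded Ω ∧ P ∈ Ω ∧ ContDiff ℝ (⊤ : ℕ∞) f ∧ 0 < ε₀ ∧
    (∀ ε ∈ Ioo (0:ℝ) ε₀, IsSol f (Ω \ closedBall P ε) (u ε)) ∧
    (∀ ε ∈ Ioo (0:ℝ) ε₀, ∀ x ∈ Ω \ closedBall P ε, |u ε x| ≤ C) ∧
    IsSol f Ω u₀ ∧
    (∀ K ⊆ Ω \ {P}, IsCompact K → C2ConvOn u u₀ K)

/-- `ω_N`: the volume of the unit ball of `ℝ^N`. -/
def omegaN (N : ℕ) : ℝ := (volume (ball (0 : EN N) 1)).toReal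

/-- The fundamental solution `S(x,y)` of `-Δ` in `ℝ^N`. -/
def fundS (N : ℕ) (x y : EN N) : ℝ :=
  if N = 2 then -(1 / (2 * Real.pi)) * Real.log ‖x - y‖
  else (1 / ((N:ℝ) * ((N:ℝ) - 2) * omegaN N)) * ‖x - y‖ ^ ((2:ℝ) - (N:ℝ))

/-- `H` is the regular part of the Dirichlet Green function of `-Δ` on `D` (relative to the
fundamental solution `S`): for `y ∈ D`, `H(·,y)` is harmonic in `D`, continuous up to the
boundary, and `G = S + H` vanishes on `∂D`. -/
def IsRegularPart {N : ℕ} (D : Set (EN N)) (S H : EN N → EN N → ℝ) : Prop :=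
  ∀ y ∈ D, ContDiffOn ℝ 2 (fun x => H x y) D ∧
    (∀ x ∈ D, lap (fun x' => H x' y) x = 0) ∧
    ContinuousOn (fun x => H x y) (closure D) ∧
    (∀ x ∈ frontier D, S x y + H x y = 0)

/-- Condition (★) of the paper: with `G = S + H` the Green function of `Ω`, for each `i`,
`∫_{Ω_ε} (f(u_ε) - f(u₀)) ∂G(x,y)/∂x_i dy = o(|x-P|) + o(ε^{N-2}/|x-P|^{N-1})`
(resp. `o(|x-P|) + o(1/(|x-P||log ε|))` for `N = 2`) as `|x-P| → 0`, `|x-P|/ε → ∞`. -/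
def StarCond {N : ℕ} (Ω : Set (EN N)) (P : EN N) (f : ℝ → ℝ)
    (u : ℝ → EN N → ℝ) (u₀ : EN N → ℝ) (H : EN N → EN N → ℝ) : Prop :=
  ∀ i : Fin N, ∀ δ > (0:ℝ), ∃ η > (0:ℝ), ∀ ε ∈ Ioo (0:ℝ) η, ∀ x : EN N,
    ‖x - P‖ ≤ η → ε ≤ η * ‖x - P‖ →
      |∫ y in Ω \ closedBall P ε,
          (f (u ε y) - f (u₀ y)) * pd (fun x' => fundS N x' y + H x' y) i x ∂volume|
        ≤ if N = 2 then δ * (‖x - P‖ + 1 / (‖x - P‖ * |Real.log ε|))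
          else δ * (‖x - P‖ + ε ^ (N - 2) / ‖x - P‖ ^ (N - 1))

section PerforatedExpansion

variable {N : ℕ}

theorem ContDiffAt.differentiableAt_fderiv {E : Type*} [NormedAddCommGroup E] [NormedSpace ℝ E]
    {v : E → ℝ} {x : E} (hv : ContDiffAt ℝ 2 v x) :
    DifferentiableAt ℝ (fderiv ℝ v) x :=
  (hv.fderiv_right (m := 1) (by norm_num)).differentiableAt (by norm_num)

theorem pd2_eq {v : EN N → ℝ} {x : EN N} (hv : ContDiffAt ℝ 2 v x) (i j : Fin N) :
    pd2 v i j x = fderiv ℝ (fderiv ℝ v) x (EuclideanSpace.single j 1)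
      (EuclideanSpace.single i 1) := by
  have h := hv.differentiableAt_fderiv.hasFDerivAt.clm_apply
    (hasFDerivAt_const (EuclideanSpace.single i (1 : ℝ)) x)
  have h' := h.fderiv
  unfold pd2 pd
  rw [h']
  simp

/-- The Laplacian is the trace of the second derivative in any orthonormal basis. -/
theorem lap_eq_sum {ι : Type*} [Fintype ι] {v : EN N → ℝ} {x : EN N} (hv : ContDiffAt ℝ 2 v x)
    (b : OrthonormalBasis ι ℝ (EN N)) :
    lap v x = ∑ i, fderiv ℝ (fderiv ℝ v) x (b i) (b i) := by
  have h1 := congrFun (InnerProductSpace.laplacian_eq_iteratedFDeriv_orthonormalBasis v b) x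
  have h2 := congrFun (InnerProductSpace.laplacian_eq_iteratedFDeriv_orthonormalBasis v
    (EuclideanSpace.basisFun (Fin N) ℝ)) x
  simp only [iteratedFDeriv_two_apply, Matrix.cons_val_zero, Matrix.cons_val_one,
    EuclideanSpace.basisFun_apply] at h1 h2
  rw [← h1, h2]
  exact Finset.sum_congr rfl fun i _ => pd2_eq hv i i

theorem lap_eq_laplacian {v : EN N → ℝ} {x : EN N} (hv : ContDiffAt ℝ 2 v x) :
    lap v x = Laplacian.laplacian v x := by
  rw [lap_eq_sum hv (EuclideanSpace.basisFun (Fin N) ℝ),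
    congrFun (InnerProductSpace.laplacian_eq_iteratedFDeriv_orthonormalBasis v
      (EuclideanSpace.basisFun (Fin N) ℝ)) x]
  simp [iteratedFDeriv_two_apply]

theorem lap_add {v w : EN N → ℝ} {x : EN N} (hv : ContDiffAt ℝ 2 v x)
    (hw : ContDiffAt ℝ 2 w x) : lap (fun y => v y + w y) x = lap v x + lap w x := by
  rw [lap_eq_laplacian (hv.add hw), lap_eq_laplacian hv, lap_eq_laplacian hw,
    ← hv.laplacian_add hw]
  rfl

theorem lap_sub {v w : EN N → ℝ} {x : EN N} (hv : ContDiffAt ℝ 2 v x)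
    (hw : ContDiffAt ℝ 2 w x) : lap (fun y => v y - w y) x = lap v x - lap w x := by
  rw [lap_eq_laplacian (hv.sub hw), lap_eq_laplacian hv, lap_eq_laplacian hw,
    ← hv.laplacian_sub hw]
  rfl

theorem lap_const_mul {v : EN N → ℝ} {x : EN N} (hv : ContDiffAt ℝ 2 v x) (c : ℝ) :
    lap (fun y => c * v y) x = c * lap v x := by
  rw [lap_eq_laplacian (contDiffAt_const.mul hv), lap_eq_laplacian hv]
  exact InnerProductSpace.laplacian_smul c hv

theorem lap_const (c : ℝ) (x : EN N) : lap (fun _ => c) x = 0 := by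
  rw [lap_eq_laplacian contDiffAt_const]
  simp

theorem fderiv_comp_affine {v : EN N → ℝ} (B : EN N →L[ℝ] EN N) (p y : EN N)
    (hv : DifferentiableAt ℝ v (p + B y)) :
    fderiv ℝ (fun z => v (p + B z)) y = (fderiv ℝ v (p + B y)).comp B := by
  have hB : HasFDerivAt (fun z => p + B z) B y := B.hasFDerivAt.const_add p
  exact (hv.hasFDerivAt.comp y hB).fderiv

theorem contDiffAt_comp_affine {v : EN N → ℝ} (B : EN N →L[ℝ] EN N) (p y : EN N)
    (hv : ContDiffAt ℝ 2 v (p + B y)) : ContDiffAt ℝ 2 (fun z => v (p + B z)) y :=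
  ContDiffAt.comp y (f := fun z => p + B z) hv (contDiff_const.add B.contDiff).contDiffAt

theorem fderiv_fderiv_comp_affine {v : EN N → ℝ} (B : EN N →L[ℝ] EN N) (p y : EN N)
    (hv : ContDiffAt ℝ 2 v (p + B y)) (a b : EN N) :
    fderiv ℝ (fderiv ℝ (fun z => v (p + B z))) y a b =
      fderiv ℝ (fderiv ℝ v) (p + B y) (B a) (B b) := by
  have hB : HasFDerivAt (fun z => p + B z) B y := B.hasFDerivAt.const_add p
  have hev : ∀ᶠ z in 𝓝 y, fderiv ℝ (fun z => v (p + B z)) z =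
      (fderiv ℝ v (p + B z)).comp B := by
    have h1 : ∀ᶠ q in 𝓝 (p + B y), ContDiffAt ℝ 2 v q := hv.eventually (by simp)
    filter_upwards [hB.continuousAt.eventually h1] with z hz
    exact fderiv_comp_affine B p z (hz.differentiableAt (by norm_num))
  have h2 : HasFDerivAt (fun z => fderiv ℝ v (p + B z))
      ((fderiv ℝ (fderiv ℝ v) (p + B y)).comp B) y :=
    hv.differentiableAt_fderiv.hasFDerivAt.comp y hB
  have h3 := h2.clm_comp (hasFDerivAt_const B y)
  rw [Filter.EventuallyEq.fderiv_eq hev, h3.fderiv]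
  simp

theorem lap_comp_isometry {v : EN N → ℝ} (L : EN N ≃ₗᵢ[ℝ] EN N) (c : ℝ) (p y : EN N)
    (hv : ContDiffAt ℝ 2 v (p + c • L y)) :
    lap (fun z => v (p + c • L z)) y = c ^ 2 * lap v (p + c • L y) := by
  let B : EN N →L[ℝ] EN N := c • (L : EN N →L[ℝ] EN N)
  have hB : ∀ z, B z = c • L z := fun z => rfl
  have hv' : ContDiffAt ℝ 2 v (p + B y) := hv
  have h1 := contDiffAt_comp_affine B p y hv'
  have e1 := lap_eq_sum h1 (EuclideanSpace.basisFun (Fin N) ℝ)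
  have e2 := lap_eq_sum hv ((EuclideanSpace.basisFun (Fin N) ℝ).map L)
  change lap (fun z => v (p + B z)) y = _
  rw [e1, e2, Finset.mul_sum]
  refine Finset.sum_congr rfl fun i _ => ?_
  rw [fderiv_fderiv_comp_affine B p y hv']
  simp only [hB, OrthonormalBasis.map_apply, map_smul, _root_.smul_apply,
    smul_eq_mul]
  ring

/-- Second derivative of a composition with a function of one real variable. -/
theorem fderiv_fderiv_comp_real {h h' : ℝ → ℝ} {h'' : ℝ} {q : EN N → ℝ} {x : EN N}
    (hh : ∀ᶠ s in 𝓝 (q x), HasDerivAt h (h' s) s) (hh' : HasDerivAt h' h'' (q x))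
    (hq : ContDiffAt ℝ 2 q x) (a b : EN N) :
    fderiv ℝ (fderiv ℝ (fun y => h (q y))) x a b =
      h'' * fderiv ℝ q x a * fderiv ℝ q x b + h' (q x) * fderiv ℝ (fderiv ℝ q) x a b := by
  have hqd : DifferentiableAt ℝ q x := hq.differentiableAt (by norm_num)
  have hev : ∀ᶠ y in 𝓝 x, fderiv ℝ (fun y => h (q y)) y = h' (q y) • fderiv ℝ q y := by
    filter_upwards [hqd.continuousAt.eventually hh, hq.eventually (by simp)] with y hy hy'
    exact (hy.comp_hasFDerivAt y (hy'.differentiableAt (by norm_num)).hasFDerivAt).fderiv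
  have h1 : HasFDerivAt (fun y => h' (q y)) (h'' • fderiv ℝ q x) x :=
    hh'.comp_hasFDerivAt x hqd.hasFDerivAt
  have h2 : HasFDerivAt (fun y => h' (q y) • fderiv ℝ q y) _ x :=
    h1.smul hq.differentiableAt_fderiv.hasFDerivAt
  rw [Filter.EventuallyEq.fderiv_eq hev, h2.fderiv]
  simp
  ring

theorem fderiv_norm_sq_sub (P x a : EN N) :
    fderiv ℝ (fun y : EN N => ‖y - P‖ ^ 2) x a = 2 * inner ℝ (x - P) a := by
  have h : HasFDerivAt (fun y : EN N => y - P) (ContinuousLinearMap.id ℝ (EN N)) x :=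
    (hasFDerivAt_id x).sub_const P
  rw [(h.norm_sq).fderiv]
  simp [inner_sub_left]

theorem fderiv_fderiv_norm_sq_sub (P x a b : EN N) :
    fderiv ℝ (fderiv ℝ (fun y : EN N => ‖y - P‖ ^ 2)) x a b = 2 * inner ℝ a b := by
  have h0 : fderiv ℝ (fun y : EN N => ‖y - P‖ ^ 2) =
      fun y => (2 : ℝ) • innerSL ℝ (y - P) := by
    ext y c
    rw [fderiv_norm_sq_sub]
    simp [inner_sub_left]
  have h : HasFDerivAt (fun y : EN N => y - P) (ContinuousLinearMap.id ℝ (EN N)) x :=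
    (hasFDerivAt_id x).sub_const P
  have h1 := (((innerSL ℝ (E := EN N)).hasFDerivAt (x := x - P)).comp x h).const_smul (2 : ℝ)
  have h2 : HasFDerivAt (fun y : EN N => (2 : ℝ) • innerSL ℝ (y - P)) _ x := h1
  rw [h0, h2.fderiv]
  simp
  rfl

theorem contDiff_norm_sq_sub (P : EN N) : ContDiff ℝ 2 (fun y : EN N => ‖y - P‖ ^ 2) :=
  (contDiff_id.sub contDiff_const).norm_sq ℝ

theorem contDiffAt_comp_real {h : ℝ → ℝ} {q : EN N → ℝ} {x : EN N}
    (hh : ContDiffAt ℝ 2 h (q x)) (hq : ContDiffAt ℝ 2 q x) :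
    ContDiffAt ℝ 2 (fun y => h (q y)) x := ContDiffAt.comp x hh hq

/-- The Laplacian of a radial function, written as a function of the squared distance. -/
theorem lap_radial {h h' : ℝ → ℝ} {h'' : ℝ} {P x : EN N}
    (hc : ContDiffAt ℝ 2 h (‖x - P‖ ^ 2))
    (hh : ∀ᶠ s in 𝓝 (‖x - P‖ ^ 2), HasDerivAt h (h' s) s)
    (hh' : HasDerivAt h' h'' (‖x - P‖ ^ 2)) :
    lap (fun y => h (‖y - P‖ ^ 2)) x =
      4 * ‖x - P‖ ^ 2 * h'' + 2 * N * h' (‖x - P‖ ^ 2) := by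
  have hq := (contDiff_norm_sq_sub P).contDiffAt (x := x)
  rw [lap_eq_sum (contDiffAt_comp_real (q := fun y => ‖y - P‖ ^ 2) hc hq)
    (EuclideanSpace.basisFun (Fin N) ℝ)]
  have e : ∀ i, fderiv ℝ (fderiv ℝ (fun y => h (‖y - P‖ ^ 2))) x
      (EuclideanSpace.basisFun (Fin N) ℝ i) (EuclideanSpace.basisFun (Fin N) ℝ i) =
      4 * h'' * (x i - P i) ^ 2 + 2 * h' (‖x - P‖ ^ 2) := by
    intro i
    rw [fderiv_fderiv_comp_real (q := fun y => ‖y - P‖ ^ 2) hh hh' hq, fderiv_norm_sq_sub,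
      fderiv_fderiv_norm_sq_sub]
    simp [EuclideanSpace.inner_single_right]
    ring
  rw [Finset.sum_congr rfl fun i _ => e i, Finset.sum_add_distrib, ← Finset.mul_sum,
    EuclideanSpace.real_norm_sq_eq]
  simp
  ring

/-- The Laplacian of a function of one linear coordinate. -/
theorem lap_ridge {h h' : ℝ → ℝ} {h'' : ℝ} {e x : EN N}
    (hc : ContDiffAt ℝ 2 h (inner ℝ e x))
    (hh : ∀ᶠ s in 𝓝 (inner ℝ e x), HasDerivAt h (h' s) s)
    (hh' : HasDerivAt h' h'' (inner ℝ e x)) :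
    lap (fun y => h (inner ℝ e y)) x = h'' * ‖e‖ ^ 2 := by
  have hfd : fderiv ℝ (fun y : EN N => inner ℝ e y) = fun _ => innerSL ℝ e := by
    ext1 y
    exact (innerSL ℝ e).hasFDerivAt.fderiv
  have hq : ContDiffAt ℝ 2 (fun y : EN N => (inner ℝ e y : ℝ)) x :=
    (innerSL ℝ e).contDiff.contDiffAt
  rw [lap_eq_sum (contDiffAt_comp_real (q := fun y => inner ℝ e y) hc hq)
    (EuclideanSpace.basisFun (Fin N) ℝ)]
  have e : ∀ i, fderiv ℝ (fderiv ℝ (fun y => h (inner ℝ e y))) x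
      (EuclideanSpace.basisFun (Fin N) ℝ i) (EuclideanSpace.basisFun (Fin N) ℝ i) =
      h'' * (e i) ^ 2 := by
    intro i
    rw [fderiv_fderiv_comp_real (q := fun y => inner ℝ e y) hh hh' hq, hfd]
    simp [EuclideanSpace.inner_single_right]
    ring
  rw [Finset.sum_congr rfl fun i _ => e i, ← Finset.mul_sum, EuclideanSpace.real_norm_sq_eq]

theorem hasDerivAt_line {E F : Type*} [NormedAddCommGroup E] [NormedSpace ℝ E]
    [NormedAddCommGroup F] [NormedSpace ℝ F] {v : E → F} (x e : E) (t : ℝ)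
    (hv : DifferentiableAt ℝ v (x + t • e)) :
    HasDerivAt (fun s : ℝ => v (x + s • e)) (fderiv ℝ v (x + t • e) e) t := by
  have h : HasDerivAt (fun s : ℝ => x + s • e) e t := by
    simpa using ((hasDerivAt_id t).smul_const e).const_add x
  exact hv.hasFDerivAt.comp_hasDerivAt t h

theorem abs_le_of_hasDerivAt {g : ℝ → ℝ} {g' B d : ℝ} (hd : 0 < d) (hg : HasDerivAt g g' 0)
    (hb : ∀ t ∈ Ioo (0 : ℝ) d, |g t - g 0| ≤ t * B) : |g'| ≤ B := by
  have hlim : Tendsto (fun t : ℝ => |t⁻¹ • (g (0 + t) - g 0)|) (𝓝[>] 0) (𝓝 |g'|) :=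
    (hasDerivAt_iff_tendsto_slope_zero.1 hg).abs.mono_left
      (nhdsWithin_mono _ fun t ht => ne_of_gt ht)
  refine le_of_tendsto hlim ?_
  filter_upwards [Ioo_mem_nhdsGT hd] with t ht
  rw [zero_add, smul_eq_mul, abs_mul, abs_inv, abs_of_pos ht.1, inv_mul_le_iff₀ ht.1]
  exact hb t ht

/-- At a local maximum, second derivatives along lines are nonpositive. -/
theorem pd2_nonpos_of_isLocalMax {w : EN N → ℝ} {x : EN N} (hw : ContDiffAt ℝ 2 w x)
    (hm : IsLocalMax w x) (i : Fin N) : pd2 w i i x ≤ 0 := by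
  by_contra! hpos
  set e : EN N := EuclideanSpace.single i 1
  rw [pd2_eq hw] at hpos
  have hc : Tendsto (fun s : ℝ => x + s • e) (𝓝 0) (𝓝 x) := by
    have : Continuous fun s : ℝ => x + s • e := by fun_prop
    simpa using this.tendsto 0
  set g : ℝ → ℝ := fun s => w (x + s • e)
  have hev : ∀ᶠ s in 𝓝 (0 : ℝ), HasDerivAt g (fderiv ℝ w (x + s • e) e) s := by
    filter_upwards [hc.eventually (hw.eventually (by simp))] with s hs
    exact hasDerivAt_line x e s (hs.differentiableAt (by norm_num))
  have hd : deriv g =ᶠ[𝓝 0] fun s => fderiv ℝ w (x + s • e) e :=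
    hev.mono fun s hs => hs.deriv
  have h2 : HasDerivAt (fun s : ℝ => fderiv ℝ w (x + s • e) e)
      (fderiv ℝ (fderiv ℝ w) x e e) 0 := by
    have h := hasDerivAt_line (v := fderiv ℝ w) x e 0
      (by simpa using hw.differentiableAt_fderiv)
    have h' := h.clm_apply (hasDerivAt_const (0 : ℝ) e)
    simpa using h'
  have hdd : deriv (deriv g) 0 = fderiv ℝ (fderiv ℝ w) x e e := by
    rw [Filter.EventuallyEq.deriv_eq hd, h2.deriv]
  have hmax : IsLocalMax g 0 := by
    have : ∀ᶠ s in 𝓝 (0 : ℝ), w (x + s • e) ≤ w x := hc.eventually hm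
    filter_upwards [this] with s hs
    simpa [g] using hs
  have hmin : IsLocalMin g 0 := isLocalMin_of_deriv_deriv_pos (by rw [hdd]; exact hpos)
    hmax.deriv_eq_zero hev.self_of_nhds.continuousAt
  have hconst : g =ᶠ[𝓝 0] fun _ => g 0 := by
    filter_upwards [hmax, hmin] with s h1 h2 using le_antisymm h1 h2
  have h0 : deriv (deriv g) 0 = 0 := by
    rw [hconst.deriv.deriv_eq]
    simp
  linarith [hdd ▸ h0]

theorem max_principle_strict {K D : Set (EN N)} (hK : IsCompact K) (hD : IsOpen D) (hDK : D ⊆ K)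
    {w : EN N → ℝ} (hc : ContinuousOn w K) (h2 : ∀ x ∈ D, ContDiffAt ℝ 2 w x)
    (hl : ∀ x ∈ D, 0 < lap w x) (hb : ∀ x ∈ K \ D, w x ≤ 0) : ∀ x ∈ K, w x ≤ 0 := by
  intro x hx
  obtain ⟨x₀, hx₀, hmax⟩ := hK.exists_isMaxOn ⟨x, hx⟩ hc
  by_cases hD' : x₀ ∈ D
  · exfalso
    have hm : IsLocalMax w x₀ := hmax.isLocalMax (mem_of_superset (hD.mem_nhds hD') hDK)
    have : lap w x₀ ≤ 0 :=
      Finset.sum_nonpos fun i _ => pd2_nonpos_of_isLocalMax (h2 x₀ hD') hm i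
    linarith [hl x₀ hD']
  · exact (hmax hx).trans (hb x₀ ⟨hx₀, hD'⟩)

theorem lap_norm_sq (P x : EN N) : lap (fun y => ‖y - P‖ ^ 2) x = 2 * N := by
  have := lap_radial (h := fun s => s) (h' := fun _ => 1) (h'' := 0) (P := P) (x := x)
    contDiffAt_id (Eventually.of_forall fun s => hasDerivAt_id s) (hasDerivAt_const _ _)
  simpa using this

/-- The weak maximum principle for subharmonic functions. -/
theorem max_principle (hN : 0 < N) {K D : Set (EN N)} (hK : IsCompact K) (hD : IsOpen D)
    (hDK : D ⊆ K) {w : EN N → ℝ} (hc : ContinuousOn w K) (h2 : ∀ x ∈ D, ContDiffAt ℝ 2 w x)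
    (hl : ∀ x ∈ D, 0 ≤ lap w x) (hb : ∀ x ∈ K \ D, w x ≤ 0) : ∀ x ∈ K, w x ≤ 0 := by
  obtain ⟨B, hB⟩ : ∃ B, ∀ x ∈ K, ‖x - 0‖ ^ 2 ≤ B := by
    obtain ⟨B, hB⟩ := (hK.image (f := fun x : EN N => ‖x - 0‖ ^ 2) (by fun_prop)).bddAbove
    exact ⟨B, fun x hx => hB ⟨x, hx, rfl⟩⟩
  have hN' : (0 : ℝ) < N := by exact_mod_cast hN
  have key : ∀ δ > (0 : ℝ), ∀ x ∈ K, w x + δ * (‖x - 0‖ ^ 2 - B) ≤ 0 := by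
    intro δ hδ
    have hq : ∀ x : EN N, ContDiffAt ℝ 2 (fun y : EN N => ‖y - 0‖ ^ 2 - B) x := fun x =>
      ((contDiff_norm_sq_sub 0).sub contDiff_const).contDiffAt
    refine max_principle_strict hK hD hDK (hc.add (by fun_prop))
      (fun x hx => (h2 x hx).add (contDiffAt_const.mul (hq x))) ?_ ?_
    · intro x hx
      rw [lap_add (h2 x hx) (contDiffAt_const.mul (hq x)), lap_const_mul (hq x),
        lap_sub (contDiff_norm_sq_sub 0).contDiffAt contDiffAt_const, lap_norm_sq, lap_const]
      have := hl x hx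
      have : 0 < δ * (2 * N - 0) := by
        rw [sub_zero]
        positivity
      linarith
    · intro x hx
      nlinarith [hb x hx, hB x hx.1]
  intro x hx
  by_contra! hpos
  have hBx := hB x hx
  have hs : 0 ≤ ‖x - 0‖ ^ 2 := by positivity
  have h3 : 0 < w x / (2 * (B + 1)) := div_pos hpos (by linarith)
  have := key (w x / (2 * (B + 1))) h3 x hx
  have h1 : w x / (2 * (B + 1)) * (‖x - 0‖ ^ 2 - B) ≥ -(w x / 2) := by
    have : w x / (2 * (B + 1)) * (B + 1) = w x / 2 := by
      have : B + 1 ≠ 0 := by linarith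
      field_simp
    nlinarith
  linarith

/-- Comparison of a function with a barrier. -/
theorem abs_le_of_barrier (hN : 0 < N) {K D : Set (EN N)} (hK : IsCompact K) (hD : IsOpen D)
    (hDK : D ⊆ K) {z b : EN N → ℝ} (hz : ContinuousOn z K) (hb : ContinuousOn b K)
    (hz2 : ∀ x ∈ D, ContDiffAt ℝ 2 z x) (hb2 : ∀ x ∈ D, ContDiffAt ℝ 2 b x)
    (hl : ∀ x ∈ D, |lap z x| ≤ -lap b x) (hbd : ∀ x ∈ K \ D, |z x| ≤ b x) :
    ∀ x ∈ K, |z x| ≤ b x := by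
  intro x hx
  have h1 := max_principle hN hK hD hDK (hz.sub hb) (fun y hy => (hz2 y hy).sub (hb2 y hy))
    (fun y hy => by
      change 0 ≤ lap (fun y => z y - b y) y
      rw [lap_sub (hz2 y hy) (hb2 y hy)]
      linarith [hl y hy, (abs_le.1 (hl y hy)).1])
    (fun y hy => by simpa using (abs_le.1 (hbd y hy)).2) x hx
  have h2 := max_principle hN hK hD hDK ((hz.add hb).neg)
    (fun y hy => ((hz2 y hy).add (hb2 y hy)).neg)
    (fun y hy => by
      have : (-(z + b)) = fun y => (-1 : ℝ) * (z y + b y) := by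
        ext y
        simp
      rw [this, lap_const_mul ((hz2 y hy).add (hb2 y hy)), lap_add (hz2 y hy) (hb2 y hy)]
      linarith [(abs_le.1 (hl y hy)).2])
    (fun y hy => by
      have := (abs_le.1 (hbd y hy)).1
      simp
      linarith) x hx
  simp only [Pi.sub_apply, Pi.neg_apply, Pi.add_apply] at h1 h2
  rw [abs_le]
  constructor <;> linarith

theorem lap_coord_parabola (e x : EN N) (he : ‖e‖ = 1) (d : ℝ) :
    lap (fun y => inner ℝ e y * (d - inner ℝ e y)) x = -2 := by
  have h := lap_ridge (h := fun s : ℝ => s * (d - s)) (h' := fun s => d - 2 * s) (h'' := -2)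
    (e := e) (x := x) (by fun_prop)
    (Eventually.of_forall fun s => by
      have := (hasDerivAt_id s).mul ((hasDerivAt_id s).const_sub d)
      refine this.congr_deriv ?_
      simp
      ring)
    (by
      have := ((hasDerivAt_id (inner ℝ e x : ℝ)).const_mul 2).const_sub d
      refine this.congr_deriv ?_
      simp)
  rw [h, he]
  ring

/-- Interior gradient estimate for Poisson's equation. -/
theorem abs_fderiv_le_of_ball (hN : 0 < N) {v : EN N → ℝ} {x : EN N} {d M A : ℝ} (hd : 0 < d)
    (hv : ∀ y ∈ closedBall x d, ContDiffAt ℝ 2 v y) (hM : ∀ y ∈ closedBall x d, |v y| ≤ M)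
    (hA : ∀ y ∈ closedBall x d, |lap v y| ≤ A) {e : EN N} (he : ‖e‖ = 1) :
    |fderiv ℝ v x e| ≤ N * M / d + d * A / 2 := by
  have hM0 : 0 ≤ M := (abs_nonneg _).trans (hM x (mem_closedBall_self hd.le))
  have hA0 : 0 ≤ A := (abs_nonneg _).trans (hA x (mem_closedBall_self hd.le))
  have hN1 : (1 : ℝ) ≤ N := by exact_mod_cast hN
  set σ : EN N ≃ₗᵢ[ℝ] EN N := (ℝ ∙ e)ᗮ.reflection with hσ
  have hσe : σ e = -e := Submodule.reflection_orthogonalComplement_singleton_eq_neg e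
  have hmem : ∀ y : EN N, ‖y‖ ≤ d → x + y ∈ closedBall x d := by
    intro y hy
    simpa [mem_closedBall, dist_eq_norm] using hy
  have hmem' : ∀ y : EN N, ‖y‖ ≤ d → x + σ y ∈ closedBall x d := by
    intro y hy
    exact hmem _ (by simpa using hy)
  have hc1 : ∀ y : EN N, ‖y‖ ≤ d → ContDiffAt ℝ 2 (fun y => v (x + y)) y := fun y hy =>
    contDiffAt_comp_affine (ContinuousLinearMap.id ℝ _) x y (hv _ (hmem y hy))
  have hc2 : ∀ y : EN N, ‖y‖ ≤ d → ContDiffAt ℝ 2 (fun y => v (x + σ y)) y := fun y hy =>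
    contDiffAt_comp_affine (σ : EN N →L[ℝ] EN N) x y (hv _ (hmem' y hy))
  have hl1 : ∀ y : EN N, ‖y‖ ≤ d → lap (fun y => v (x + y)) y = lap v (x + y) := by
    intro y hy
    have := lap_comp_isometry (v := v) (LinearIsometryEquiv.refl ℝ _) 1 x y
      (by simpa using hv _ (hmem y hy))
    simpa using this
  have hl2 : ∀ y : EN N, ‖y‖ ≤ d → lap (fun y => v (x + σ y)) y = lap v (x + σ y) := by
    intro y hy
    have := lap_comp_isometry (v := v) σ 1 x y
      (by simpa using hv _ (hmem' y hy))
    simpa using this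
  set z : EN N → ℝ := fun y => v (x + y) - v (x + σ y) with hz
  have hz2 : ∀ y : EN N, ‖y‖ ≤ d → ContDiffAt ℝ 2 z y := fun y hy => (hc1 y hy).sub (hc2 y hy)
  have hi : Continuous fun y : EN N => (inner ℝ e y : ℝ) := by fun_prop
  set K : Set (EN N) := closedBall 0 d ∩ {y | 0 ≤ inner ℝ e y}
  set D : Set (EN N) := ball 0 d ∩ {y | 0 < inner ℝ e y}
  have hK : IsCompact K := (isCompact_closedBall 0 d).inter_right (isClosed_le continuous_const hi)
  have hD : IsOpen D := isOpen_ball.inter (isOpen_lt continuous_const hi)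
  have hDK : D ⊆ K := fun y hy => ⟨ball_subset_closedBall hy.1, le_of_lt (α := ℝ) hy.2⟩
  have hKd : ∀ y ∈ K, ‖y‖ ≤ d := fun y hy => by simpa using hy.1
  set b : EN N → ℝ := fun y => 2 * M / d ^ 2 * ‖y - 0‖ ^ 2 +
    (2 * M * N / d ^ 2 + A) * (inner ℝ e y * (d - inner ℝ e y)) with hb
  have hq1 : ∀ y : EN N, ContDiffAt ℝ 2 (fun y : EN N => ‖y - 0‖ ^ 2) y := fun y =>
    (contDiff_norm_sq_sub 0).contDiffAt
  have hq2 : ∀ y : EN N, ContDiffAt ℝ 2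
      (fun y : EN N => (inner ℝ e y : ℝ) * (d - inner ℝ e y)) y := fun y => by
    have : ContDiff ℝ 2 (fun y : EN N => (inner ℝ e y : ℝ)) := (innerSL ℝ e).contDiff
    exact (this.mul (contDiff_const.sub this)).contDiffAt
  have hb2 : ∀ y : EN N, ContDiffAt ℝ 2 b y := fun y =>
    (contDiffAt_const.mul (hq1 y)).add (contDiffAt_const.mul (hq2 y))
  have hlb : ∀ y, lap b y = -(2 * A) := by
    intro y
    rw [hb, lap_add (contDiffAt_const.mul (hq1 y)) (contDiffAt_const.mul (hq2 y)),
      lap_const_mul (hq1 y), lap_const_mul (hq2 y), lap_norm_sq, lap_coord_parabola e y he]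
    ring
  have key := abs_le_of_barrier hN hK hD hDK
    (fun y hy => (hz2 y (hKd y hy)).continuousAt.continuousWithinAt)
    (fun y hy => (hb2 y).continuousAt.continuousWithinAt)
    (fun y hy => hz2 y (hKd y (hDK hy))) (fun y _ => hb2 y)
    (fun y hy => by
      have hy' := hKd y (hDK hy)
      rw [hz, lap_sub (hc1 y hy') (hc2 y hy'), hl1 y hy', hl2 y hy', hlb]
      have h1 := hA _ (hmem y hy')
      have h2 := hA _ (hmem' y hy')
      have := abs_sub (lap v (x + y)) (lap v (x + σ y))
      linarith)
    (fun y hy => by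
      have hyd := hKd y hy.1
      have hnn : 0 ≤ (inner ℝ e y : ℝ) := hy.1.2
      have hle : (inner ℝ e y : ℝ) ≤ d := by
        have := real_inner_le_norm e y
        rw [he, one_mul] at this
        linarith
      have hp : 0 ≤ (2 * M * N / d ^ 2 + A) * ((inner ℝ e y : ℝ) * (d - inner ℝ e y)) :=
        mul_nonneg (by positivity) (mul_nonneg hnn (by linarith))
      by_cases h0 : (inner ℝ e y : ℝ) = 0
      · have : σ y = y := by
          apply Submodule.reflection_mem_subspace_eq_self
          rwa [Submodule.mem_orthogonal_singleton_iff_inner_right]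
        have hz0 : z y = 0 := by simp [hz, this]
        rw [hz0, abs_zero]
        have : 0 ≤ 2 * M / d ^ 2 * ‖y - 0‖ ^ 2 := by positivity
        exact add_nonneg this hp
      · have hyd' : ‖y‖ = d := by
          by_contra hne
          exact hy.2 ⟨by simpa using lt_of_le_of_ne hyd hne, lt_of_le_of_ne hnn (Ne.symm h0)⟩
        have h1 := hM _ (hmem y hyd)
        have h2 := hM _ (hmem' y hyd)
        have h3 := abs_sub (v (x + y)) (v (x + σ y))
        have h4 : 2 * M / d ^ 2 * ‖y - 0‖ ^ 2 = 2 * M := by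
          rw [sub_zero, hyd']
          field_simp
        change |v (x + y) - v (x + σ y)| ≤ _ + _
        linarith)
  have hline : ∀ t ∈ Ioo (0 : ℝ) d, |v (x + t • e) - v (x + (-t) • e)| ≤
      t * (2 * (N * M / d + d * A / 2)) := by
    intro t ht
    have hte : ‖t • e‖ = t := by rw [norm_smul, he, mul_one, Real.norm_of_nonneg ht.1.le]
    have hie : (inner ℝ e (t • e) : ℝ) = t := by
      rw [inner_smul_right, real_inner_self_eq_norm_sq, he]
      ring
    have h := key (t • e) ⟨by simpa [hte] using ht.2.le, by
      change (0 : ℝ) ≤ inner ℝ e (t • e)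
      rw [hie]
      exact ht.1.le⟩
    have hzt : z (t • e) = v (x + t • e) - v (x + (-t) • e) := by
      simp [hz, hσe]
    have hbt : b (t • e) = t * (2 * (N * M / d + d * A / 2)) -
        t ^ 2 * (2 * M / d ^ 2 * (N - 1) + A) := by
      simp only [hb, sub_zero, hte, hie]
      field_simp
      ring
    rw [hzt, hbt] at h
    have : 0 ≤ t ^ 2 * (2 * M / d ^ 2 * (N - 1) + A) := by
      have : (0 : ℝ) ≤ N - 1 := by linarith
      positivity
    linarith
  have hvd : DifferentiableAt ℝ v x :=
    (hv x (mem_closedBall_self hd.le)).differentiableAt (by norm_num)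
  have hder : HasDerivAt (fun t : ℝ => v (x + t • e) - v (x + (-t) • e))
      (2 * fderiv ℝ v x e) 0 := by
    have h1 := hasDerivAt_line (v := v) x e 0 (by simpa using hvd)
    have h2 := hasDerivAt_line (v := v) x (-e) 0 (by simpa using hvd)
    have := h1.sub h2
    simp only [zero_smul, add_zero, map_neg, sub_neg_eq_add, ← two_mul] at this
    refine this.congr_of_eventuallyEq (Eventually.of_forall fun t => ?_)
    simp
  have hfin : |2 * fderiv ℝ v x e| ≤ 2 * (N * M / d + d * A / 2) :=
    abs_le_of_hasDerivAt hd hder fun t ht => by simpa using hline t ht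
  rw [abs_mul, abs_two] at hfin
  linarith

/-- `z` vanishes on the unit sphere and, in the annulus `1 < ‖x‖ < T`, both `z` and `Δz` are
bounded by `M`. -/
structure AnnulusBound (z : EN N → ℝ) (T M : ℝ) : Prop where
  continuousOn : ContinuousOn z {x | 1 ≤ ‖x‖ ∧ ‖x‖ < T}
  contDiffAt : ∀ x, 1 < ‖x‖ → ‖x‖ < T → ContDiffAt ℝ 2 z x
  abs_le : ∀ x, 1 < ‖x‖ → ‖x‖ < T → |z x| ≤ M
  abs_lap_le : ∀ x, 1 < ‖x‖ → ‖x‖ < T → |lap z x| ≤ M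
  eq_zero : ∀ x, ‖x‖ = 1 → z x = 0

theorem hasDerivAt_inv_pow (n : ℕ) {s : ℝ} (hs : 0 < s) :
    HasDerivAt (fun s : ℝ => (s ^ n)⁻¹) (-(n * (s ^ (n + 1))⁻¹)) s := by
  have h := (hasDerivAt_pow n s).inv (pow_ne_zero n hs.ne')
  refine h.congr_deriv ?_
  cases n with
  | zero => simp
  | succ k =>
    simp only [Nat.add_sub_cancel]
    field_simp
    ring

theorem contDiffAt_inv_pow (n : ℕ) {s : ℝ} (hs : 0 < s) :
    ContDiffAt ℝ 2 (fun s : ℝ => (s ^ n)⁻¹) s :=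
  (contDiffAt_id.pow n).inv (pow_ne_zero n hs.ne')

theorem lap_barrier (A : ℝ) {x : EN N} (hx : 1 ≤ ‖x‖) :
    lap (fun y : EN N => A * (1 - ((‖y - 0‖ ^ 2) ^ N)⁻¹)) x =
      -(A * (2 * N ^ 2 + 4 * N) * ((‖x - 0‖ ^ 2) ^ (N + 1))⁻¹) := by
  have hs : 0 < ‖x - 0‖ ^ 2 := by
    rw [sub_zero]
    positivity
  have h1 : ∀ᶠ s in 𝓝 (‖x - 0‖ ^ 2), HasDerivAt (fun s : ℝ => A * (1 - (s ^ N)⁻¹))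
      (A * (N * (s ^ (N + 1))⁻¹)) s := by
    filter_upwards [lt_mem_nhds hs] with s hs
    refine (((hasDerivAt_inv_pow N hs).const_sub 1).const_mul A).congr_deriv ?_
    ring
  have h2 := ((hasDerivAt_inv_pow (N + 1) hs).const_mul (N : ℝ)).const_mul A
  rw [lap_radial (h := fun s => A * (1 - (s ^ N)⁻¹))
    (contDiffAt_const.mul (contDiffAt_const.sub (contDiffAt_inv_pow N hs))) h1 h2]
  push_cast
  field_simp
  ring

theorem AnnulusBound.abs_le_mul_dist (hN : 0 < N) {T : ℝ} (hT : 1 < T) :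
    ∃ C > 0, ∀ (z : EN N → ℝ) (T' M : ℝ), T < T' → AnnulusBound z T' M →
      ∀ x, 1 ≤ ‖x‖ → ‖x‖ ≤ T → |z x| ≤ C * M * (‖x‖ - 1) := by
  have hN1 : (1 : ℝ) ≤ N := by exact_mod_cast hN
  have hT1 : (1 : ℝ) < (T ^ 2) ^ N := one_lt_pow₀ (one_lt_pow₀ hT (by norm_num)) hN.ne'
  have hinv : ((T ^ 2) ^ N)⁻¹ < 1 := inv_lt_one_of_one_lt₀ hT1
  have hpos : 0 < 1 - ((T ^ 2) ^ N)⁻¹ := by linarith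
  set A : ℝ := (T ^ 2) ^ (N + 1) + (1 - ((T ^ 2) ^ N)⁻¹)⁻¹ with hA
  have hA1 : (T ^ 2) ^ (N + 1) ≤ A := by
    have := inv_pos.2 hpos
    linarith
  have hA2 : 1 ≤ A * (1 - ((T ^ 2) ^ N)⁻¹) := by
    have h1 : (1 - ((T ^ 2) ^ N)⁻¹)⁻¹ ≤ A := by
      have : 0 < (T ^ 2) ^ (N + 1) := by positivity
      linarith
    calc (1 : ℝ) = (1 - ((T ^ 2) ^ N)⁻¹)⁻¹ * (1 - ((T ^ 2) ^ N)⁻¹) :=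
          (inv_mul_cancel₀ hpos.ne').symm
      _ ≤ _ := mul_le_mul_of_nonneg_right h1 hpos.le
  have hA0 : 0 < A := by
    have : 0 < (T ^ 2) ^ (N + 1) := by positivity
    linarith
  refine ⟨A * (N * (T + 1)), by positivity, fun z T' M hTT' hz x hx1 hxT => ?_⟩
  obtain ⟨x₁, hx₁⟩ : ∃ y : EN N, ‖y‖ = T :=
    ⟨EuclideanSpace.single ⟨0, hN⟩ T, by simp [abs_of_pos (by linarith : 0 < T)]⟩
  have hM : 0 ≤ M := (abs_nonneg _).trans
    (hz.abs_le x₁ (by rw [hx₁]; exact hT) (by rw [hx₁]; exact hTT'))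
  have hni : Continuous fun y : EN N => ‖y‖ := continuous_norm
  set K : Set (EN N) := closedBall 0 T ∩ {y | 1 ≤ ‖y‖}
  set D : Set (EN N) := ball 0 T ∩ {y | 1 < ‖y‖}
  have hK : IsCompact K := (isCompact_closedBall 0 T).inter_right (isClosed_le continuous_const hni)
  have hD : IsOpen D := isOpen_ball.inter (isOpen_lt continuous_const hni)
  have hDK : D ⊆ K := fun y hy => ⟨ball_subset_closedBall hy.1, le_of_lt (α := ℝ) hy.2⟩
  have hKT : ∀ y ∈ K, ‖y‖ ≤ T := fun y hy => by simpa using hy.1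
  have hDT : ∀ y ∈ D, ‖y‖ < T := fun y hy => by simpa using hy.1
  set b : EN N → ℝ := fun y => (M * A) * (1 - ((‖y - 0‖ ^ 2) ^ N)⁻¹) with hb
  have hb2 : ∀ y ∈ K, ContDiffAt ℝ 2 b y := by
    intro y hy
    have hs : 0 < ‖y - 0‖ ^ 2 := by
      have : 1 ≤ ‖y‖ := hy.2
      rw [sub_zero]
      positivity
    exact contDiffAt_comp_real (h := fun s => (M * A) * (1 - (s ^ N)⁻¹))
      (contDiffAt_const.mul (contDiffAt_const.sub (contDiffAt_inv_pow N hs)))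
      (contDiff_norm_sq_sub 0).contDiffAt
  have key := abs_le_of_barrier hN hK hD hDK
    (hz.continuousOn.mono fun y hy => ⟨hy.2, (hKT y hy).trans_lt hTT'⟩)
    (fun y hy => (hb2 y hy).continuousAt.continuousWithinAt)
    (fun y hy => hz.contDiffAt y hy.2 ((hDT y hy).trans hTT'))
    (fun y hy => hb2 y (hDK hy))
    (fun y hy => by
      have hy1 : 1 < ‖y‖ := hy.2
      have hs : 0 < ‖y‖ ^ 2 := by positivity
      refine (hz.abs_lap_le y hy.2 ((hDT y hy).trans hTT')).trans ?_
      rw [hb, lap_barrier _ hy1.le, neg_neg, sub_zero, le_mul_inv_iff₀ (by positivity),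
        mul_assoc M A]
      refine mul_le_mul_of_nonneg_left ?_ hM
      calc (‖y‖ ^ 2) ^ (N + 1) ≤ (T ^ 2) ^ (N + 1) := by
            have := (hDT y hy).le
            gcongr
        _ ≤ A := hA1
        _ ≤ A * (2 * N ^ 2 + 4 * N) := le_mul_of_one_le_right hA0.le (by nlinarith))
    (fun y hy => by
      have hy1 : 1 ≤ ‖y‖ := hy.1.2
      rcases hy1.eq_or_lt with h | h
      · rw [hz.eq_zero y h.symm]
        simp [hb, ← h]
      · have hyT : ‖y‖ = T := by
          by_contra hne
          exact hy.2 ⟨by simpa using lt_of_le_of_ne (hKT y hy.1) hne, h⟩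
        refine (hz.abs_le y h (hyT ▸ hTT')).trans ?_
        simp only [hb, sub_zero, hyT]
        rw [mul_assoc]
        exact le_mul_of_one_le_right hM hA2)
    x ⟨by simpa using hxT, hx1⟩
  refine key.trans ?_
  simp only [hb, sub_zero]
  have hs : 1 ≤ ‖x‖ ^ 2 := one_le_pow₀ hx1
  have hs0 : 0 < ‖x‖ ^ 2 := by linarith
  have hbern := one_add_mul_le_pow (a := (‖x‖ ^ 2)⁻¹ - 1) (by
    have := inv_pos.2 hs0
    linarith) N
  have h1 : 1 - (‖x‖ ^ 2)⁻¹ ≤ ‖x‖ ^ 2 - 1 := by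
    have : 2 ≤ ‖x‖ ^ 2 + (‖x‖ ^ 2)⁻¹ := by
      have h := mul_inv_cancel₀ hs0.ne'
      have := inv_pos.2 hs0
      nlinarith [sq_nonneg (‖x‖ ^ 2 - (‖x‖ ^ 2)⁻¹)]
    linarith
  have h2 : 1 - ((‖x‖ ^ 2) ^ N)⁻¹ ≤ N * (T + 1) * (‖x‖ - 1) := by
    rw [add_sub_cancel, inv_pow] at hbern
    have h3 : (N : ℝ) * (1 - (‖x‖ ^ 2)⁻¹) ≤ N * ((T + 1) * (‖x‖ - 1)) :=
      mul_le_mul_of_nonneg_left (by nlinarith) (by positivity)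
    linarith
  calc M * A * (1 - ((‖x‖ ^ 2) ^ N)⁻¹) ≤ M * A * (N * (T + 1) * (‖x‖ - 1)) :=
        mul_le_mul_of_nonneg_left h2 (by positivity)
    _ = _ := by ring

/-- Gradient estimate up to the inner sphere. -/
theorem AnnulusBound.abs_fderiv_le (hN : 0 < N) {T : ℝ} (hT : 1 < T) :
    ∃ C > 0, ∀ (z : EN N → ℝ) (M : ℝ), AnnulusBound z (3 * T) M →
      ∀ x, 1 < ‖x‖ → ‖x‖ ≤ T → ∀ e, |fderiv ℝ z x e| ≤ C * M * ‖e‖ := by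
  obtain ⟨C, hC, hbd⟩ := AnnulusBound.abs_le_mul_dist hN (T := 2 * T) (by linarith)
  refine ⟨3 * N * C + T, by positivity, fun z M hz x hx1 hxT e => ?_⟩
  have hM : 0 ≤ M := (abs_nonneg _).trans (hz.abs_le x hx1 (by linarith))
  set d : ℝ := (‖x‖ - 1) / 2 with hd
  have hd0 : 0 < d := by
    rw [hd]
    linarith
  have hmem : ∀ y ∈ closedBall x d, 1 < ‖y‖ ∧ ‖y‖ < 2 * T ∧ ‖y‖ - 1 ≤ 3 * d := by
    intro y hy
    rw [mem_closedBall, dist_eq_norm] at hy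
    have h1 := norm_sub_norm_le y x
    have h2 := norm_sub_norm_le x y
    rw [norm_sub_rev] at h2
    refine ⟨?_, ?_, ?_⟩ <;> linarith
  have hunit : ∀ e : EN N, ‖e‖ = 1 → |fderiv ℝ z x e| ≤ (3 * N * C + T) * M := by
    intro e he
    have h := abs_fderiv_le_of_ball hN hd0
      (fun y hy => hz.contDiffAt y (hmem y hy).1 (by linarith [(hmem y hy).2.1]))
      (M := C * M * (3 * d))
      (fun y hy => (hbd z (3 * T) M (by linarith) hz y (hmem y hy).1.le (hmem y hy).2.1.le).trans
        (mul_le_mul_of_nonneg_left (hmem y hy).2.2 (by positivity)))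
      (fun y hy => hz.abs_lap_le y (hmem y hy).1 (by linarith [(hmem y hy).2.1])) he
    have h2 : N * (C * M * (3 * d)) / d = 3 * N * C * M := by
      field_simp
    rw [h2] at h
    have h3 : d * M ≤ T * M := mul_le_mul_of_nonneg_right (by linarith) hM
    have : 0 ≤ T * M := by positivity
    linarith
  rcases eq_or_ne e 0 with rfl | he
  · simp
  · have hne : 0 < ‖e‖ := norm_pos_iff.2 he
    have h := hunit (‖e‖⁻¹ • e) (by rw [norm_smul, norm_inv, norm_norm, inv_mul_cancel₀ hne.ne'])
    rw [map_smul, smul_eq_mul, abs_mul, abs_inv, abs_norm, inv_mul_le_iff₀ hne] at h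
    linarith

/-- Rotation by the angle `t` in the plane of the orthonormal vectors `a` and `b`. -/
def planeRotation (a b : EN N) (t : ℝ) : EN N →L[ℝ] EN N :=
  ContinuousLinearMap.id ℝ (EN N) +
    (Real.cos t - 1) • ((innerSL ℝ a).smulRight a + (innerSL ℝ b).smulRight b) +
    Real.sin t • ((innerSL ℝ a).smulRight b - (innerSL ℝ b).smulRight a)

theorem planeRotation_apply (a b : EN N) (t : ℝ) (x : EN N) :
    planeRotation a b t x = x +
      (Real.cos t - 1) • ((inner ℝ a x : ℝ) • a + (inner ℝ b x : ℝ) • b) +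
      Real.sin t • ((inner ℝ a x : ℝ) • b - (inner ℝ b x : ℝ) • a) := rfl

theorem planeRotation_zero (a b x : EN N) : planeRotation a b 0 x = x := by
  simp [planeRotation_apply]

theorem norm_planeRotation {a b : EN N} (ha : ‖a‖ = 1) (hb : ‖b‖ = 1)
    (hab : (inner ℝ a b : ℝ) = 0) (t : ℝ) (x : EN N) : ‖planeRotation a b t x‖ = ‖x‖ := by
  have h : planeRotation a b t x = x +
      ((Real.cos t - 1) * inner ℝ a x - Real.sin t * inner ℝ b x) • a +
      ((Real.cos t - 1) * inner ℝ b x + Real.sin t * inner ℝ a x) • b := by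
    rw [planeRotation_apply]
    module
  have hba : (inner ℝ b a : ℝ) = 0 := by rw [real_inner_comm, hab]
  have haa : (inner ℝ a a : ℝ) = 1 := by rw [real_inner_self_eq_norm_sq, ha, one_pow]
  have hbb : (inner ℝ b b : ℝ) = 1 := by rw [real_inner_self_eq_norm_sq, hb, one_pow]
  have hsq : ‖planeRotation a b t x‖ ^ 2 = ‖x‖ ^ 2 := by
    rw [h, ← real_inner_self_eq_norm_sq, ← real_inner_self_eq_norm_sq]
    simp only [inner_add_left, inner_add_right, inner_smul_left, inner_smul_right, haa, hbb, hab,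
      hba, real_inner_comm a x, real_inner_comm b x, RCLike.conj_to_real]
    linear_combination ((inner ℝ a x : ℝ) ^ 2 + (inner ℝ b x : ℝ) ^ 2) * Real.sin_sq_add_cos_sq t
  exact (sq_eq_sq₀ (norm_nonneg _) (norm_nonneg _)).1 hsq

theorem exists_isometry_eq_planeRotation {a b : EN N} (ha : ‖a‖ = 1) (hb : ‖b‖ = 1)
    (hab : (inner ℝ a b : ℝ) = 0) (t : ℝ) :
    ∃ L : EN N ≃ₗᵢ[ℝ] EN N, ∀ x, L x = planeRotation a b t x :=
  ⟨LinearIsometry.toLinearIsometryEquiv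
    ⟨(planeRotation a b t).toLinearMap, norm_planeRotation ha hb hab t⟩ rfl, fun _ => rfl⟩

theorem hasDerivAt_planeRotation (a b x : EN N) (t : ℝ) :
    HasDerivAt (fun t => planeRotation a b t x)
      (-Real.sin t • ((inner ℝ a x : ℝ) • a + (inner ℝ b x : ℝ) • b) +
      Real.cos t • ((inner ℝ a x : ℝ) • b - (inner ℝ b x : ℝ) • a)) t := by
  have h1 := ((Real.hasDerivAt_cos t).sub_const 1).smul_const
    ((inner ℝ a x : ℝ) • a + (inner ℝ b x : ℝ) • b)
  have h2 := (Real.hasDerivAt_sin t).smul_const ((inner ℝ a x : ℝ) • b - (inner ℝ b x : ℝ) • a)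
  exact (h1.const_add x).add h2

theorem norm_deriv_planeRotation_le {a b : EN N} (ha : ‖a‖ = 1) (hb : ‖b‖ = 1) (x : EN N) (t : ℝ) :
    ‖-Real.sin t • ((inner ℝ a x : ℝ) • a + (inner ℝ b x : ℝ) • b) +
      Real.cos t • ((inner ℝ a x : ℝ) • b - (inner ℝ b x : ℝ) • a)‖ ≤ 4 * ‖x‖ := by
  have hax : ‖(inner ℝ a x : ℝ)‖ ≤ ‖x‖ := by simpa [ha] using norm_inner_le_norm (𝕜 := ℝ) a x
  have hbx : ‖(inner ℝ b x : ℝ)‖ ≤ ‖x‖ := by simpa [hb] using norm_inner_le_norm (𝕜 := ℝ) b x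
  have h1 : ‖(inner ℝ a x : ℝ) • a + (inner ℝ b x : ℝ) • b‖ ≤ 2 * ‖x‖ := by
    refine (norm_add_le _ _).trans ?_
    rw [norm_smul, norm_smul, ha, hb]
    linarith
  have h2 : ‖(inner ℝ a x : ℝ) • b - (inner ℝ b x : ℝ) • a‖ ≤ 2 * ‖x‖ := by
    refine (norm_sub_le _ _).trans ?_
    rw [norm_smul, norm_smul, ha, hb]
    linarith
  refine (norm_add_le _ _).trans ?_
  rw [norm_smul, norm_smul, norm_neg, Real.norm_eq_abs, Real.norm_eq_abs]
  have h3 := mul_le_mul (Real.abs_sin_le_one t) h1 (norm_nonneg _) zero_le_one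
  have h4 := mul_le_mul (Real.abs_cos_le_one t) h2 (norm_nonneg _) zero_le_one
  linarith

theorem hasDerivAt_fderiv_planeRotation {v : EN N → ℝ} {x : EN N} (a b e : EN N)
    (hv : ContDiffAt ℝ 2 v x) :
    HasDerivAt (fun t => fderiv ℝ v (planeRotation a b t x) (planeRotation a b t e))
      (fderiv ℝ (fderiv ℝ v) x ((inner ℝ a x : ℝ) • b - (inner ℝ b x : ℝ) • a) e +
        fderiv ℝ v x ((inner ℝ a e : ℝ) • b - (inner ℝ b e : ℝ) • a)) 0 := by
  have h0 : ∀ y, HasDerivAt (fun t => planeRotation a b t y)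
      ((inner ℝ a y : ℝ) • b - (inner ℝ b y : ℝ) • a) 0 := by
    intro y
    refine (hasDerivAt_planeRotation a b y 0).congr_deriv ?_
    rw [Real.sin_zero, Real.cos_zero, neg_zero, zero_smul, one_smul, zero_add]
  have h1 : HasFDerivAt (fderiv ℝ v) (fderiv ℝ (fderiv ℝ v) x) (planeRotation a b 0 x) := by
    rw [planeRotation_zero]
    exact hv.differentiableAt_fderiv.hasFDerivAt
  have h2 : HasDerivAt (fun t => fderiv ℝ v (planeRotation a b t x))
      (fderiv ℝ (fderiv ℝ v) x ((inner ℝ a x : ℝ) • b - (inner ℝ b x : ℝ) • a)) 0 :=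
    h1.comp_hasDerivAt 0 (h0 x)
  have h3 := h2.clm_apply (h0 e)
  rwa [planeRotation_zero, planeRotation_zero] at h3

/-- The tangential second derivatives are controlled up to the inner sphere, as the angular
derivatives commute with the Laplacian and vanish on the sphere. -/
theorem AnnulusBound.abs_angular_fderiv_le (hN : 0 < N) {T : ℝ} (hT : 1 < T) :
    ∃ C > 0, ∀ (v : EN N → ℝ) (M : ℝ), AnnulusBound v (9 * T) M →
      (∀ x y, ‖x‖ = ‖y‖ → 1 < ‖x‖ → ‖x‖ < 9 * T → |lap v x - lap v y| ≤ |v x - v y|) →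
      ∀ a b : EN N, ‖a‖ = 1 → ‖b‖ = 1 → (inner ℝ a b : ℝ) = 0 →
      ∀ x, 1 < ‖x‖ → ‖x‖ ≤ T → ∀ e, ‖e‖ = 1 →
        |fderiv ℝ (fderiv ℝ v) x ((inner ℝ a x : ℝ) • b - (inner ℝ b x : ℝ) • a) e| ≤ C * M := by
  obtain ⟨C₁, hC₁, hg₁⟩ := AnnulusBound.abs_fderiv_le hN (T := 3 * T) (by linarith)
  obtain ⟨C₂, hC₂, hg₂⟩ := AnnulusBound.abs_fderiv_le hN hT
  refine ⟨C₂ * (C₁ * (12 * T)) + C₁ * 2, by positivity,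
    fun v M hv hsym a b ha hb hab x hx1 hxT e he => ?_⟩
  have hM : 0 ≤ M := (abs_nonneg _).trans (hv.abs_le x hx1 (by linarith))
  have hv' : AnnulusBound v (3 * (3 * T)) M := by
    rw [show 3 * (3 * T) = 9 * T by ring]
    exact hv
  have hgrad := hg₁ v M hv'
  have hrn := norm_planeRotation ha hb hab
  have hinc : ∀ t ∈ Ioo (0 : ℝ) 1, ∀ y, 1 < ‖y‖ → ‖y‖ < 3 * T →
      |v (planeRotation a b t y) - v y| ≤ t * (C₁ * (12 * T) * M) := by
    intro t ht y hy1 hyT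
    have hder : ∀ s, HasDerivAt (fun s => v (planeRotation a b s y)) (fderiv ℝ v
        (planeRotation a b s y) (-Real.sin s • ((inner ℝ a y : ℝ) • a + (inner ℝ b y : ℝ) • b) +
        Real.cos s • ((inner ℝ a y : ℝ) • b - (inner ℝ b y : ℝ) • a))) s := fun s =>
      ((hv.contDiffAt _ (by rwa [hrn]) (by rw [hrn]; linarith)).differentiableAt
        (by norm_num)).hasFDerivAt.comp_hasDerivAt s (hasDerivAt_planeRotation a b y s)
    have h := norm_image_sub_le_of_norm_deriv_le_segment' (a := 0) (b := t)
      (f := fun s => v (planeRotation a b s y)) (C := C₁ * (12 * T) * M)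
      (fun s _ => (hder s).hasDerivWithinAt)
      (fun s _ => by
        refine (hgrad _ (by rwa [hrn]) (by rw [hrn]; exact hyT.le) _).trans ?_
        have h1 := norm_deriv_planeRotation_le ha hb y s
        have h2 : 4 * ‖y‖ ≤ 12 * T := by linarith
        have := mul_le_mul_of_nonneg_left (h1.trans h2) (by positivity : 0 ≤ C₁ * M)
        linarith) t ⟨ht.1.le, le_rfl⟩
    rw [planeRotation_zero, Real.norm_eq_abs, sub_zero] at h
    linarith
  have hdiff : ∀ t ∈ Ioo (0 : ℝ) 1,
      |fderiv ℝ v (planeRotation a b t x) (planeRotation a b t e) - fderiv ℝ v x e| ≤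
        t * (C₂ * (C₁ * (12 * T)) * M) := by
    intro t ht
    obtain ⟨L, hL⟩ := exists_isometry_eq_planeRotation ha hb hab t
    have hc1 : ∀ y, 1 < ‖y‖ → ‖y‖ < 9 * T →
        ContDiffAt ℝ 2 (fun y => v (planeRotation a b t y)) y := by
      intro y hy1 hyT
      have := contDiffAt_comp_affine (v := v) (planeRotation a b t) 0 y
        (by rw [zero_add]; exact hv.contDiffAt _ (by rwa [hrn]) (by rwa [hrn]))
      simpa using this
    have hl1 : ∀ y, 1 < ‖y‖ → ‖y‖ < 9 * T →
        lap (fun y => v (planeRotation a b t y)) y = lap v (planeRotation a b t y) := by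
      intro y hy1 hyT
      have := lap_comp_isometry (v := v) L 1 0 y
        (by rw [zero_add, one_smul, hL]; exact hv.contDiffAt _ (by rwa [hrn]) (by rwa [hrn]))
      simpa [hL] using this
    have hz : AnnulusBound (fun y => v (planeRotation a b t y) - v y) (3 * T)
        (t * (C₁ * (12 * T) * M)) := by
      refine ⟨?_, ?_, ?_, ?_, ?_⟩
      · have hc : ContinuousOn v {x | 1 ≤ ‖x‖ ∧ ‖x‖ < 3 * T} :=
          hv.continuousOn.mono fun y hy => ⟨hy.1, by have : ‖y‖ < 3 * T := hy.2; linarith⟩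
        refine ContinuousOn.sub (hc.comp (planeRotation a b t).continuous.continuousOn ?_) hc
        intro y hy
        change 1 ≤ ‖planeRotation a b t y‖ ∧ ‖planeRotation a b t y‖ < 3 * T
        rw [hrn]
        exact hy
      · exact fun y hy1 hyT => (hc1 y hy1 (by linarith)).sub (hv.contDiffAt y hy1 (by linarith))
      · exact fun y hy1 hyT => hinc t ht y hy1 hyT
      · intro y hy1 hyT
        rw [lap_sub (hc1 y hy1 (by linarith)) (hv.contDiffAt y hy1 (by linarith)),
          hl1 y hy1 (by linarith)]
        exact (hsym _ _ (hrn t y) (by rwa [hrn]) (by rw [hrn]; linarith)).trans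
          (hinc t ht y hy1 hyT)
      · intro y hy
        rw [hv.eq_zero y hy, hv.eq_zero _ (by rwa [hrn]), sub_zero]
    have h := hg₂ _ _ hz x hx1 hxT e
    have hd1 : DifferentiableAt ℝ v (planeRotation a b t x) :=
      (hv.contDiffAt _ (by rwa [hrn]) (by rw [hrn]; linarith)).differentiableAt (by norm_num)
    have hd2 : DifferentiableAt ℝ v x :=
      (hv.contDiffAt x hx1 (by linarith)).differentiableAt (by norm_num)
    have hf : HasFDerivAt (fun y => v (planeRotation a b t y) - v y)
        ((fderiv ℝ v (planeRotation a b t x)).comp (planeRotation a b t) - fderiv ℝ v x) x :=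
      (hd1.hasFDerivAt.comp x (planeRotation a b t).hasFDerivAt).sub hd2.hasFDerivAt
    rw [hf.fderiv, he] at h
    simp only [_root_.sub_apply, ContinuousLinearMap.comp_apply] at h
    linarith
  have hvx := hv.contDiffAt x hx1 (by linarith)
  have hder := hasDerivAt_fderiv_planeRotation a b e hvx
  have hsum := abs_le_of_hasDerivAt one_pos hder (B := C₂ * (C₁ * (12 * T)) * M)
    (fun t ht => by simpa only [planeRotation_zero] using hdiff t ht)
  have hJe : ‖(inner ℝ a e : ℝ) • b - (inner ℝ b e : ℝ) • a‖ ≤ 2 := by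
    have hae : ‖(inner ℝ a e : ℝ)‖ ≤ 1 := by
      simpa [ha, he] using norm_inner_le_norm (𝕜 := ℝ) a e
    have hbe : ‖(inner ℝ b e : ℝ)‖ ≤ 1 := by
      simpa [hb, he] using norm_inner_le_norm (𝕜 := ℝ) b e
    refine (norm_sub_le _ _).trans ?_
    rw [norm_smul, norm_smul, ha, hb]
    linarith
  have hJg := (hgrad x hx1 (by linarith) ((inner ℝ a e : ℝ) • b - (inner ℝ b e : ℝ) • a)).trans
    (mul_le_mul_of_nonneg_left hJe (by positivity : 0 ≤ C₁ * M))
  have htri := abs_sub (fderiv ℝ (fderiv ℝ v) x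
    ((inner ℝ a x : ℝ) • b - (inner ℝ b x : ℝ) • a) e +
    fderiv ℝ v x ((inner ℝ a e : ℝ) • b - (inner ℝ b e : ℝ) • a))
    (fderiv ℝ v x ((inner ℝ a e : ℝ) • b - (inner ℝ b e : ℝ) • a))
  rw [add_sub_cancel_right] at htri
  linarith

/-- A symmetric matrix is controlled by its trace and its "angular" entries. -/
theorem abs_entry_le_of_angular {ι : Type*} [Fintype ι] {V : ι → ι → ℝ} {x : ι → ℝ} {T B : ℝ}
    (hV : ∀ i j, V i j = V j i) (hx : ∀ i, |x i| ≤ T) (hx1 : 1 ≤ ∑ i, x i ^ 2)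
    (hang : ∀ i j k, |x i * V j k - x j * V i k| ≤ B) (htr : |∑ k, V k k| ≤ B) (j k : ι) :
    |V j k| ≤ (2 * Fintype.card ι * T + T ^ 2) * B := by
  have hT : 0 ≤ T := (abs_nonneg _).trans (hx j)
  have hsum : ∀ g : ι → ℝ, ∀ c, (∀ i, |g i| ≤ c) → |∑ i, g i| ≤ Fintype.card ι * c := by
    intro g c hg
    refine (Finset.abs_sum_le_sum_abs _ _).trans ((Finset.sum_le_sum fun i _ => hg i).trans ?_)
    simp
  have hW : |∑ i, x i * V k i| ≤ T * B + Fintype.card ι * B := by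
    have e : ∑ i, x i * V k i = x k * ∑ i, V i i - ∑ i, (x k * V i i - x i * V k i) := by
      rw [Finset.sum_sub_distrib, Finset.mul_sum]
      ring
    rw [e]
    refine (abs_sub _ _).trans (add_le_add ?_ (hsum _ _ fun i => hang k i i))
    rw [abs_mul]
    exact mul_le_mul (hx k) htr (abs_nonneg _) hT
  have e : (∑ i, x i ^ 2) * V j k =
      ∑ i, x i * (x i * V j k - x j * V i k) + x j * ∑ i, x i * V k i := by
    rw [Finset.sum_mul, Finset.mul_sum, ← Finset.sum_add_distrib]
    refine Finset.sum_congr rfl fun i _ => ?_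
    rw [hV k i]
    ring
  calc |V j k| ≤ (∑ i, x i ^ 2) * |V j k| := le_mul_of_one_le_left (abs_nonneg _) hx1
    _ = |(∑ i, x i ^ 2) * V j k| := by
      rw [abs_mul, abs_of_nonneg (zero_le_one.trans hx1)]
    _ ≤ Fintype.card ι * (T * B) + T * (T * B + Fintype.card ι * B) := by
      rw [e]
      refine (abs_add_le _ _).trans (add_le_add (hsum _ _ fun i => ?_) ?_)
      · rw [abs_mul]
        exact mul_le_mul (hx i) (hang i j k) (abs_nonneg _) hT
      · rw [abs_mul]
        exact mul_le_mul (hx j) hW (abs_nonneg _) hT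
    _ = _ := by ring

/-- `C²` estimate up to the inner sphere. -/
theorem AnnulusBound.abs_pd_le (hN : 0 < N) {T : ℝ} (hT : 1 < T) :
    ∃ C > 0, ∀ (v : EN N → ℝ) (M : ℝ), AnnulusBound v (9 * T) M →
      (∀ x y, ‖x‖ = ‖y‖ → 1 < ‖x‖ → ‖x‖ < 9 * T → |lap v x - lap v y| ≤ |v x - v y|) →
      ∀ x, 1 < ‖x‖ → ‖x‖ ≤ T →
        (∀ i, |pd v i x| ≤ C * M) ∧ ∀ i j, |pd2 v i j x| ≤ C * M := by
  obtain ⟨C₁, hC₁, hg₁⟩ := AnnulusBound.abs_fderiv_le hN (T := 3 * T) (by linarith)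
  obtain ⟨C₂, hC₂, hg₂⟩ := AnnulusBound.abs_angular_fderiv_le hN hT
  refine ⟨C₁ + (2 * N * T + T ^ 2) * (C₂ + 1), by positivity,
    fun v M hv hsym x hx1 hxT => ?_⟩
  have hM : 0 ≤ M := (abs_nonneg _).trans (hv.abs_le x hx1 (by linarith))
  have hv' : AnnulusBound v (3 * (3 * T)) M := by
    rw [show 3 * (3 * T) = 9 * T by ring]
    exact hv
  have hvx := hv.contDiffAt x hx1 (by linarith)
  refine ⟨fun i => ?_, fun i j => ?_⟩
  · have h := hg₁ v M hv' x hx1 (by linarith) (EuclideanSpace.single i 1)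
    rw [PiLp.norm_single, norm_one, mul_one] at h
    refine h.trans (mul_le_mul_of_nonneg_right (le_add_of_nonneg_right (by positivity)) hM)
  · have h := abs_entry_le_of_angular (V := fun i j => fderiv ℝ (fderiv ℝ v) x
      (EuclideanSpace.single i 1) (EuclideanSpace.single j 1)) (x := x) (T := T)
      (B := (C₂ + 1) * M)
      (fun i j => (hvx.isSymmSndFDerivAt (by simp)).eq _ _)
      (fun i => (PiLp.norm_apply_le x i).trans hxT)
      (by
        rw [← EuclideanSpace.real_norm_sq_eq]
        exact one_le_pow₀ hx1.le)
      (fun i j k => by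
        rcases eq_or_ne i j with rfl | hij
        · simp
          positivity
        · have h := hg₂ v M hv hsym (EuclideanSpace.single i 1) (EuclideanSpace.single j 1)
            (by simp) (by simp) (by simp [EuclideanSpace.inner_single_left, hij]) x hx1 hxT
            (EuclideanSpace.single k 1) (by simp)
          simp only [EuclideanSpace.inner_single_left, map_one, one_mul, map_sub, map_smul,
            _root_.sub_apply, _root_.smul_apply, smul_eq_mul] at h
          linarith)
      (by
        have h := hv.abs_lap_le x hx1 (by linarith)
        rw [lap_eq_sum hvx (EuclideanSpace.basisFun (Fin N) ℝ)] at h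
        simp only [EuclideanSpace.basisFun_apply] at h
        nlinarith) j i
    rw [pd2_eq hvx]
    simp only [Fintype.card_fin] at h
    refine h.trans ?_
    have : 0 ≤ C₁ * M := by positivity
    linarith

theorem pd_comp_scale {v : EN N → ℝ} {P w : EN N} {ε : ℝ} (hv : ContDiffAt ℝ 2 v (P + ε • w))
    (i : Fin N) : pd (fun z => v (P + ε • z)) i w = ε * pd v i (P + ε • w) := by
  have h := fderiv_comp_affine (ε • ContinuousLinearMap.id ℝ (EN N)) P w
    (v := v) (hv.differentiableAt (by norm_num))
  unfold pd
  simp only [_root_.smul_apply, ContinuousLinearMap.id_apply] at h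
  rw [h]
  simp

theorem pd2_comp_scale {v : EN N → ℝ} {P w : EN N} {ε : ℝ} (hv : ContDiffAt ℝ 2 v (P + ε • w))
    (i j : Fin N) : pd2 (fun z => v (P + ε • z)) i j w = ε ^ 2 * pd2 v i j (P + ε • w) := by
  have h := fderiv_fderiv_comp_affine (ε • ContinuousLinearMap.id ℝ (EN N)) P w
    (v := v) hv (EuclideanSpace.single j 1) (EuclideanSpace.single i 1)
  have hc := contDiffAt_comp_affine (ε • ContinuousLinearMap.id ℝ (EN N)) P w hv
  simp only [_root_.smul_apply, ContinuousLinearMap.id_apply] at h hc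
  rw [pd2_eq hc, pd2_eq hv, h]
  simp
  ring

theorem pd_sub {v w : EN N → ℝ} {x : EN N} (hv : ContDiffAt ℝ 2 v x) (hw : ContDiffAt ℝ 2 w x)
    (i : Fin N) : pd (fun y => v y - w y) i x = pd v i x - pd w i x := by
  unfold pd
  rw [fderiv_fun_sub (hv.differentiableAt (by norm_num)) (hw.differentiableAt (by norm_num))]
  rfl

theorem pd_add_const (v : EN N → ℝ) (c : ℝ) (i : Fin N) (x : EN N) :
    pd (fun y => v y + c) i x = pd v i x := by
  unfold pd
  rw [fderiv_add_const]

theorem pd2_add_const (v : EN N → ℝ) (c : ℝ) (i j : Fin N) (x : EN N) :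
    pd2 (fun y => v y + c) i j x = pd2 v i j x := by
  unfold pd2
  simp only [pd_add_const]

theorem pd2_sub {v w : EN N → ℝ} {x : EN N} (hv : ContDiffAt ℝ 2 v x) (hw : ContDiffAt ℝ 2 w x)
    (i j : Fin N) : pd2 (fun y => v y - w y) i j x = pd2 v i j x - pd2 w i j x := by
  have hev : fderiv ℝ (fun y => v y - w y) =ᶠ[𝓝 x] fun y => fderiv ℝ v y - fderiv ℝ w y := by
    filter_upwards [hv.eventually (by simp), hw.eventually (by simp)] with y hy hy'
    exact fderiv_fun_sub (hy.differentiableAt (by norm_num)) (hy'.differentiableAt (by norm_num))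
  rw [pd2_eq (hv.sub hw), pd2_eq hv, pd2_eq hw, hev.fderiv_eq,
    fderiv_fun_sub hv.differentiableAt_fderiv hw.differentiableAt_fderiv]
  rfl

theorem exists_bound_pd {v : EN N → ℝ} {P : EN N} (hv : ContDiffAt ℝ 2 v P) :
    ∃ B > 0, ∀ᶠ x in 𝓝 P, (∀ i, |pd v i x| ≤ B) ∧ ∀ i j, |pd2 v i j x| ≤ B := by
  have h1 : ContDiffAt ℝ 1 (fderiv ℝ v) P := hv.fderiv_right (by norm_num)
  have h2 : ContDiffAt ℝ 0 (fderiv ℝ (fderiv ℝ v)) P := h1.fderiv_right (by norm_num)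
  have hle : ∀ {F : Type} [NormedAddCommGroup F] {g : EN N → F}, ContinuousAt g P →
      ∀ᶠ x in 𝓝 P, ‖g x‖ ≤ ‖g P‖ + 1 := fun hg =>
    hg.norm.eventually_le_const (lt_add_one _)
  refine ⟨max (‖fderiv ℝ v P‖ + 1) (‖fderiv ℝ (fderiv ℝ v) P‖ + 1), by positivity, ?_⟩
  filter_upwards [hle h1.continuousAt, hle h2.continuousAt, hv.eventually (by simp)]
    with x hx1 hx2 hx3
  refine ⟨fun i => le_max_of_le_left (le_trans ?_ hx1),
    fun i j => le_max_of_le_right (le_trans ?_ hx2)⟩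
  · unfold pd
    simpa using (fderiv ℝ v x).le_opNorm (EuclideanSpace.single i 1)
  · rw [pd2_eq hx3]
    simpa using (fderiv ℝ (fderiv ℝ v) x).le_opNorm₂ (EuclideanSpace.single j 1)
      (EuclideanSpace.single i 1)

theorem eventually_forall_norm_sub_le {P : EN N} {p : EN N → Prop} (h : ∀ᶠ x in 𝓝 P, p x)
    {T : ℝ} (hT : 0 < T) : ∀ᶠ ε in 𝓝[>] (0 : ℝ), ∀ x, ‖x - P‖ ≤ T * ε → p x := by
  obtain ⟨r, hr, hball⟩ := Metric.eventually_nhds_iff.1 h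
  filter_upwards [Ioo_mem_nhdsGT (div_pos hr hT)] with ε hε x hx
  refine hball ?_
  rw [dist_eq_norm]
  have := (lt_div_iff₀ hT).1 hε.2
  linarith

theorem mem_frontier_diff_closedBall {Ω : Set (EN N)} (hΩ : IsOpen Ω) {P x : EN N} {ε : ℝ}
    (hε : 0 < ε) (hxΩ : x ∈ Ω) (hx : ‖x - P‖ = ε) : x ∈ frontier (Ω \ closedBall P ε) := by
  rw [(hΩ.sdiff isClosed_closedBall).frontier_eq]
  refine ⟨?_, fun h => h.2 (by rw [mem_closedBall, dist_eq_norm, hx])⟩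
  have ht : Tendsto (fun t : ℝ => x + t • (x - P)) (𝓝[>] 0) (𝓝 x) := by
    have : Continuous fun t : ℝ => x + t • (x - P) := by fun_prop
    simpa using (this.tendsto 0).mono_left nhdsWithin_le_nhds
  refine mem_closure_of_tendsto ht ?_
  filter_upwards [ht.eventually (hΩ.mem_nhds hxΩ), self_mem_nhdsWithin] with t h1 h2
  refine ⟨h1, ?_⟩
  have h2' : (0 : ℝ) < t := h2
  have e : x + t • (x - P) - P = (1 + t) • (x - P) := by module
  rw [mem_closedBall, dist_eq_norm, e, norm_smul, hx, Real.norm_of_nonneg (by linarith)]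
  nlinarith

/-- What a solution in the perforated domain provides in an annulus around the hole. -/
structure AnnulusSol (f : ℝ → ℝ) (P : EN N) (ε r C : ℝ) (v : EN N → ℝ) : Prop where
  continuousOn : ContinuousOn v {x | ε ≤ ‖x - P‖ ∧ ‖x - P‖ ≤ r}
  contDiffAt : ∀ x, ε < ‖x - P‖ → ‖x - P‖ ≤ r → ContDiffAt ℝ 2 v x
  lap_eq : ∀ x, ε < ‖x - P‖ → ‖x - P‖ ≤ r → lap v x = -f (v x)
  abs_le : ∀ x, ε < ‖x - P‖ → ‖x - P‖ ≤ r → |v x| ≤ C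
  eq_zero : ∀ x, ‖x - P‖ = ε → v x = 0

theorem IsSol.annulusSol {f : ℝ → ℝ} {Ω : Set (EN N)} {P : EN N} {ε r C : ℝ} {v : EN N → ℝ}
    (hΩ : IsOpen Ω) (hr : closedBall P r ⊆ Ω) (hε : 0 < ε) (hεr : ε ≤ r)
    (hv : IsSol f (Ω \ closedBall P ε) v) (hC : ∀ x ∈ Ω \ closedBall P ε, |v x| ≤ C) :
    AnnulusSol f P ε r C v := by
  have hop : IsOpen (Ω \ closedBall P ε) := hΩ.sdiff isClosed_closedBall
  have hΩr : ∀ x, ‖x - P‖ ≤ r → x ∈ Ω := fun x hx =>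
    hr (by rwa [mem_closedBall, dist_eq_norm])
  have hmem : ∀ x, ε < ‖x - P‖ → ‖x - P‖ ≤ r → x ∈ Ω \ closedBall P ε := fun x h1 h2 =>
    ⟨hΩr x h2, by rwa [mem_closedBall, dist_eq_norm, not_le]⟩
  obtain ⟨h1, h2, -, h4, h5⟩ := hv
  refine ⟨h4.mono ?_, fun x hx hx' => h1.contDiffAt (hop.mem_nhds (hmem x hx hx')),
    fun x hx hx' => h2 x (hmem x hx hx'), fun x hx hx' => hC x (hmem x hx hx'),
    fun x hx => h5 x (mem_frontier_diff_closedBall hΩ hε (hΩr x (by rwa [hx])) hx)⟩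
  rintro x ⟨hx, hx'⟩
  rcases hx.eq_or_lt with h | h
  · exact frontier_subset_closure (mem_frontier_diff_closedBall hΩ hε (hΩr x hx') h.symm)
  · exact subset_closure (hmem x h hx')

/-- A family of radial harmonic functions on `ℝ^N \ {P}` that are `1` on the sphere of radius `ε`
around `P` and that vanish as `ε → 0` on any fixed sphere. -/
structure RadialProfile (P : EN N) (Φ : ℝ → EN N → ℝ) : Prop where
  contDiffAt : ∀ ε x, x ≠ P → ContDiffAt ℝ 2 (Φ ε) x
  lap_eq_zero : ∀ ε x, x ≠ P → lap (Φ ε) x = 0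
  radial : ∀ ε x y, ‖x - P‖ = ‖y - P‖ → Φ ε x = Φ ε y
  eq_one : ∀ᶠ ε in 𝓝[>] (0 : ℝ), ∀ x, ‖x - P‖ = ε → Φ ε x = 1
  vanish : ∀ r > 0, ∀ δ > 0, ∀ᶠ ε in 𝓝[>] (0 : ℝ), ∀ x, ‖x - P‖ = r → |Φ ε x| ≤ δ

variable {Ω : Set (EN N)} {P : EN N} {f : ℝ → ℝ} {ε₀ C : ℝ} {u : ℝ → EN N → ℝ} {u₀ : EN N → ℝ}
  {Φ : ℝ → EN N → ℝ}

theorem Setting.contDiffAt_limit (h : Setting Ω P f ε₀ C u u₀) {x : EN N} (hx : x ∈ Ω) :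
    ContDiffAt ℝ 2 u₀ x := by
  obtain ⟨hΩ, -, -, -, -, -, -, h0, -⟩ := h
  exact h0.1.contDiffAt (hΩ.mem_nhds hx)

theorem Setting.eventually_annulusSol (h : Setting Ω P f ε₀ C u u₀) {r : ℝ} (hr0 : 0 < r)
    (hr : closedBall P r ⊆ Ω) : ∀ᶠ ε in 𝓝[>] (0 : ℝ), AnnulusSol f P ε r C (u ε) := by
  obtain ⟨hΩ, -, -, -, hε₀, hsol, hC, -, -⟩ := h
  filter_upwards [Ioo_mem_nhdsGT hε₀, Ioo_mem_nhdsGT hr0] with ε h1 h2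
  exact (hsol ε h1).annulusSol hΩ hr h1.1 h2.2.le (hC ε h1)

theorem ne_of_lt_norm_sub {x P : EN N} {ε : ℝ} (hε : 0 < ε) (h : ε ≤ ‖x - P‖) : x ≠ P := by
  rintro rfl
  rw [sub_self, norm_zero] at h
  linarith

/-- The expansion holds uniformly near `P`. -/
theorem Setting.expansion_near (hN : 0 < N) (h : Setting Ω P f ε₀ C u u₀)
    (hΦ : RadialProfile P Φ) {δ : ℝ} (hδ : 0 < δ) :
    ∃ r > 0, closedBall P r ⊆ Ω ∧ ∀ᶠ ε in 𝓝[>] (0 : ℝ), ∀ x, ε ≤ ‖x - P‖ → ‖x - P‖ ≤ r →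
      |u ε x - u₀ x + u₀ P * Φ ε x| ≤ δ := by
  have hset := h
  obtain ⟨hΩ, -, hP, hf, -, -, -, h0, hconv⟩ := h
  have hN1 : (1 : ℝ) ≤ N := by exact_mod_cast hN
  obtain ⟨F, hF⟩ : ∃ F, ∀ s ∈ Icc (-(max C (|u₀ P| + 1))) (max C (|u₀ P| + 1)), |f s| ≤ F :=
    isCompact_Icc.exists_bound_of_continuousOn hf.continuous.continuousOn
  have hF0 : 0 ≤ F := (abs_nonneg _).trans (hF 0 ⟨by
    have : 0 ≤ max C (|u₀ P| + 1) := le_max_of_le_right (by positivity)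
    linarith, le_max_of_le_right (by positivity)⟩)
  have hcont : ∀ᶠ x in 𝓝 P, |u₀ x - u₀ P| < min (δ / 2) 1 := by
    have := (hset.contDiffAt_limit hP).continuousAt
    filter_upwards [this (Metric.ball_mem_nhds _ (by positivity : 0 < min (δ / 2) 1))] with x hx
    exact hx
  obtain ⟨r₁, hr₁, hball⟩ := Metric.eventually_nhds_iff.1 (hcont.and (hΩ.mem_nhds hP))
  obtain ⟨r, hr0, hrr₁, hr1, hrF⟩ : ∃ r, 0 < r ∧ r < r₁ ∧ r ≤ 1 ∧ F * r ≤ δ / 2 := by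
    refine ⟨min (r₁ / 2) (min 1 (δ / (2 * (F + 1)))), by positivity, ?_, ?_, ?_⟩
    · exact (min_le_left _ _).trans_lt (by linarith)
    · exact (min_le_right _ _).trans (min_le_left _ _)
    · have h1 : min (r₁ / 2) (min 1 (δ / (2 * (F + 1)))) ≤ δ / (2 * (F + 1)) :=
        (min_le_right _ _).trans (min_le_right _ _)
      have h2 : F * (δ / (2 * (F + 1))) ≤ δ / 2 := by
        rw [mul_div_assoc', div_le_div_iff₀ (by positivity) two_pos]
        nlinarith
      exact (mul_le_mul_of_nonneg_left h1 hF0).trans h2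
  have hnear : ∀ x, ‖x - P‖ ≤ r → |u₀ x - u₀ P| < min (δ / 2) 1 ∧ x ∈ Ω := fun x hx =>
    hball (by rw [dist_eq_norm]; linarith)
  have hrΩ : closedBall P r ⊆ Ω := fun x hx =>
    (hnear x (by rwa [mem_closedBall, dist_eq_norm] at hx)).2
  refine ⟨r, hr0, hrΩ, ?_⟩
  have hsphere := (hconv (sphere P r)
    (fun x hx => ⟨hrΩ (sphere_subset_closedBall hx), by
      rintro rfl
      simp [hr0.ne] at hx⟩) (isCompact_sphere P r)).1
  rw [Metric.tendstoUniformlyOn_iff] at hsphere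
  have hη : 0 < δ / (4 * (|u₀ P| + 1)) := by positivity
  filter_upwards [hset.eventually_annulusSol hr0 hrΩ, Ioo_mem_nhdsGT hr0,
    hsphere (δ / 4) (by positivity), hΦ.eq_one, hΦ.vanish r hr0 _ hη] with ε hu hε hus hone hvan
  have hni : Continuous fun y : EN N => ‖y - P‖ := by fun_prop
  set K : Set (EN N) := closedBall P r ∩ {y | ε ≤ ‖y - P‖}
  set D : Set (EN N) := ball P r ∩ {y | ε < ‖y - P‖}
  have hK : IsCompact K := (isCompact_closedBall P r).inter_right (isClosed_le continuous_const hni)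
  have hD : IsOpen D := isOpen_ball.inter (isOpen_lt continuous_const hni)
  have hDK : D ⊆ K := fun y hy => ⟨ball_subset_closedBall hy.1, le_of_lt (α := ℝ) hy.2⟩
  have hKr : ∀ y ∈ K, ‖y - P‖ ≤ r := fun y hy => by
    simpa [mem_closedBall, dist_eq_norm] using hy.1
  have hKP : ∀ y ∈ K, y ≠ P := fun y hy => ne_of_lt_norm_sub hε.1 hy.2
  have hq : ∀ y : EN N, ContDiffAt ℝ 2 (fun y => ‖y - P‖ ^ 2) y := fun y =>
    (contDiff_norm_sq_sub P).contDiffAt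
  have hu₀ : ∀ y ∈ K, ContDiffAt ℝ 2 u₀ y := fun y hy =>
    hset.contDiffAt_limit (hnear y (hKr y hy)).2
  have key := abs_le_of_barrier hN hK hD hDK (z := fun y => (u ε y - u₀ y) + u₀ P * Φ ε y)
    (b := fun y => (δ / 2 + F * r ^ 2) - F * ‖y - P‖ ^ 2)
    (((hu.continuousOn.mono fun y hy => ⟨hy.2, hKr y hy⟩).sub
      fun y hy => (hu₀ y hy).continuousAt.continuousWithinAt).add
      (continuousOn_const.mul fun y hy =>
        (hΦ.contDiffAt ε y (hKP y hy)).continuousAt.continuousWithinAt))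
    (by fun_prop)
    (fun y hy => ((hu.contDiffAt y hy.2 (hKr y (hDK hy))).sub (hu₀ y (hDK hy))).add
      (contDiffAt_const.mul (hΦ.contDiffAt ε y (hKP y (hDK hy)))))
    (fun y _ => contDiffAt_const.sub (contDiffAt_const.mul (hq y)))
    (fun y hy => by
      have h1 := hu.contDiffAt y hy.2 (hKr y (hDK hy))
      have h2 := hu₀ y (hDK hy)
      have h3 := hΦ.contDiffAt ε y (hKP y (hDK hy))
      have hy' := hnear y (hKr y (hDK hy))
      rw [lap_add (h1.sub h2) (contDiffAt_const.mul h3), lap_sub h1 h2, lap_const_mul h3,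
        hΦ.lap_eq_zero ε y (hKP y (hDK hy)), hu.lap_eq y hy.2 (hKr y (hDK hy)), h0.2.1 y hy'.2,
        lap_sub contDiffAt_const (contDiffAt_const.mul (hq y)), lap_const, lap_const_mul (hq y),
        lap_norm_sq]
      have e1 := hF _ (abs_le.1 ((hu.abs_le y hy.2 (hKr y (hDK hy))).trans (le_max_left _ _)))
      have e2 := hF (u₀ y) (abs_le.1 (le_trans (by
        have := abs_sub_abs_le_abs_sub (u₀ y) (u₀ P)
        have := hy'.1.trans_le (min_le_right _ _)
        linarith) (le_max_right _ _)))
      have e3 := abs_sub (f (u₀ y)) (f (u ε y))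
      have e4 : -f (u ε y) - -f (u₀ y) + u₀ P * 0 = f (u₀ y) - f (u ε y) := by ring
      rw [e4]
      nlinarith)
    (fun y hy => by
      have hy1 : ε ≤ ‖y - P‖ := hy.1.2
      have hyr := hKr y hy.1
      have hy' := (hnear y hyr).1.trans_le (min_le_left _ _)
      have hsq : F * ‖y - P‖ ^ 2 ≤ F * r ^ 2 := by gcongr
      have hle : |(u ε y - u₀ y) + u₀ P * Φ ε y| ≤ δ / 2 := by
        rcases hy1.eq_or_lt with h | h
        · rw [hu.eq_zero y h.symm, hone y h.symm, abs_sub_comm] at *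
          have : 0 - u₀ y + u₀ P * 1 = u₀ P - u₀ y := by ring
          rw [this]
          exact hy'.le
        · have hyr' : ‖y - P‖ = r := by
            by_contra hne
            exact hy.2 ⟨by simpa [mem_ball, dist_eq_norm] using lt_of_le_of_ne hyr hne, h⟩
          have e1 := hus y (by simpa [dist_eq_norm] using hyr')
          rw [Real.dist_eq, abs_sub_comm] at e1
          have e2 : |u₀ P * Φ ε y| ≤ δ / 4 := by
            rw [abs_mul]
            calc |u₀ P| * |Φ ε y| ≤ (|u₀ P| + 1) * (δ / (4 * (|u₀ P| + 1))) :=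
                  mul_le_mul (by linarith) (hvan y hyr') (abs_nonneg _) (by positivity)
              _ = δ / 4 := by field_simp
          have := abs_add_le (u ε y - u₀ y) (u₀ P * Φ ε y)
          linarith
      linarith)
  intro x hx1 hxr
  refine (key x ⟨by simpa [mem_closedBall, dist_eq_norm] using hxr, hx1⟩).trans ?_
  have h1 : 0 ≤ F * ‖x - P‖ ^ 2 := by positivity
  have h2 : F * r ^ 2 ≤ F * r := mul_le_mul_of_nonneg_left (by nlinarith) hF0
  linarith

/-- Bounds on the rescaled derivatives of `v - u₀` in terms of those of `v (P + ε w)`. -/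
theorem abs_pd_sub_le_of_scale {v u₀ : EN N → ℝ} {P w : EN N} {ε a B b : ℝ} (hε : 0 < ε)
    (hε2 : ε ^ 2 ≤ ε) (hv : ContDiffAt ℝ 2 v (P + ε • w)) (hu₀ : ContDiffAt ℝ 2 u₀ (P + ε • w))
    (h1 : ∀ i, |pd (fun z => v (P + ε • z)) i w| ≤ a)
    (h2 : ∀ i j, |pd2 (fun z => v (P + ε • z)) i j w| ≤ a)
    (hB1 : ∀ i, |pd u₀ i (P + ε • w)| ≤ B) (hB2 : ∀ i j, |pd2 u₀ i j (P + ε • w)| ≤ B)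
    (hb : ε * B ≤ b) (c : ℝ) :
    (∀ i, ε * |pd (fun y => v y - u₀ y + c) i (P + ε • w)| ≤ a + b) ∧
      ∀ i j, ε ^ 2 * |pd2 (fun y => v y - u₀ y + c) i j (P + ε • w)| ≤ a + b := by
  refine ⟨fun i => ?_, fun i j => ?_⟩
  · rw [pd_add_const (fun y => v y - u₀ y), pd_sub hv hu₀]
    have h1 := h1 i
    rw [pd_comp_scale hv, abs_mul, abs_of_pos hε] at h1
    have h2 := mul_le_mul_of_nonneg_left (hB1 i) hε.le
    have h3 := mul_le_mul_of_nonneg_left (abs_sub (pd v i (P + ε • w)) (pd u₀ i (P + ε • w)))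
      hε.le
    linarith
  · rw [pd2_add_const (fun y => v y - u₀ y), pd2_sub hv hu₀]
    have h1 := h2 i j
    rw [pd2_comp_scale hv, abs_mul, abs_of_nonneg (sq_nonneg ε)] at h1
    have h2 := mul_le_mul hε2 (hB2 i j) (abs_nonneg _) hε.le
    have h3 := mul_le_mul_of_nonneg_left
      (abs_sub (pd2 v i j (P + ε • w)) (pd2 u₀ i j (P + ε • w))) (sq_nonneg ε)
    linarith

/-- The expansion of `u ε` in the annulus of radii `ε` and `R ε`, in `C²` with respect to the
rescaled variable. -/
theorem Setting.expansion_C2 (hN : 0 < N) (h : Setting Ω P f ε₀ C u u₀)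
    (hΦ : RadialProfile P Φ) {R : ℝ} (hR : 1 < R) {δ : ℝ} (hδ : 0 < δ) :
    ∀ᶠ ε in 𝓝[>] (0 : ℝ), ∀ x ∈ closedBall P (R * ε) \ closedBall P ε,
      |u ε x - u₀ x + u₀ P * Φ ε x| ≤ δ ∧
      ∀ c : ℝ, (∀ i, ε * |pd (fun y => u ε y - u₀ y + u₀ P * Φ ε y + c) i x| ≤ δ) ∧
        ∀ i j, ε ^ 2 * |pd2 (fun y => u ε y - u₀ y + u₀ P * Φ ε y + c) i j x| ≤ δ := by
  have hset := h
  obtain ⟨hΩ, -, hP, hf, -, -, -, -, -⟩ := h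
  obtain ⟨C₁, hC₁, hest⟩ := AnnulusBound.abs_pd_le hN hR
  obtain ⟨M, hM0, hMδ, hCM⟩ : ∃ M, 0 < M ∧ M ≤ δ ∧ C₁ * M ≤ δ / 2 :=
    ⟨min δ (δ / (2 * C₁)), by positivity, min_le_left _ _,
      (mul_le_mul_of_nonneg_left (min_le_right _ _) hC₁.le).trans_eq (by field_simp)⟩
  obtain ⟨r, hr0, hrΩ, hexp⟩ := hset.expansion_near hN hΦ (half_pos hM0)
  obtain ⟨F, hF⟩ : ∃ F, ∀ s ∈ Icc (-C) C, |f s| ≤ F :=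
    isCompact_Icc.exists_bound_of_continuousOn hf.continuous.continuousOn
  obtain ⟨L, hL⟩ : ∃ L, ∀ s ∈ Icc (-C) C, ‖deriv f s‖ ≤ L :=
    isCompact_Icc.exists_bound_of_continuousOn
      (hf.continuous_deriv (by simp)).continuousOn
  obtain ⟨B, hB0, hB⟩ := exists_bound_pd (hset.contDiffAt_limit hP)
  have hcont : ∀ᶠ x in 𝓝 P, |u₀ x - u₀ P| ≤ M / 2 := by
    filter_upwards [(hset.contDiffAt_limit hP).continuousAt
      (Metric.closedBall_mem_nhds _ (half_pos hM0))] with x hx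
    exact hx
  have hball : ∀ᶠ x in 𝓝 P, ‖x - P‖ ≤ r := by
    filter_upwards [Metric.closedBall_mem_nhds P hr0] with x hx
    rwa [mem_closedBall, dist_eq_norm] at hx
  have hsmall : ∀ c : ℝ, ∀ a > 0, ∀ᶠ ε in 𝓝[>] (0 : ℝ), ε * c ≤ a := by
    intro c a ha
    have : Tendsto (fun ε : ℝ => ε * c) (𝓝[>] 0) (𝓝 0) := by
      have : Continuous fun ε : ℝ => ε * c := by fun_prop
      simpa using (this.tendsto 0).mono_left nhdsWithin_le_nhds
    exact this.eventually_le_const ha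
  filter_upwards [hexp, hset.eventually_annulusSol hr0 hrΩ, hΦ.eq_one, hsmall F M hM0,
    hsmall L 1 one_pos, hsmall B (δ / 2) (half_pos hδ), Ioo_mem_nhdsGT one_pos,
    eventually_forall_norm_sub_le (hcont.and (hball.and hB)) (T := 9 * R) (by linarith)]
    with ε hexp hu hone hεF hεL hεB hε hnear
  have hε0 : 0 < ε := hε.1
  have hε2 : ε ^ 2 ≤ ε := by nlinarith [hε.2]
  set v : EN N → ℝ := fun y => u ε y + u₀ P * (Φ ε y - 1) with hv
  have hnorm : ∀ w : EN N, ‖P + ε • w - P‖ = ε * ‖w‖ := fun w => by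
    rw [add_sub_cancel_left, norm_smul, Real.norm_of_nonneg hε0.le]
  have hlt : ∀ w : EN N, 1 < ‖w‖ → ε < ‖P + ε • w - P‖ := fun w hw => by
    rw [hnorm]
    nlinarith
  have hle9 : ∀ w : EN N, ‖w‖ < 9 * R → ‖P + ε • w - P‖ ≤ 9 * R * ε := fun w hw => by
    rw [hnorm]
    nlinarith
  have hvd : ∀ y, ε < ‖y - P‖ → ‖y - P‖ ≤ r → ContDiffAt ℝ 2 v y ∧ lap v y = -f (u ε y) := by
    intro y hy1 hyr
    have hyP := ne_of_lt_norm_sub hε0 hy1.le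
    have h1 := hu.contDiffAt y hy1 hyr
    have h2 := hΦ.contDiffAt ε y hyP
    have h3 : ContDiffAt ℝ 2 (fun y => Φ ε y - 1) y := h2.sub contDiffAt_const
    refine ⟨h1.add (contDiffAt_const.mul h3), ?_⟩
    rw [hv, lap_add h1 (contDiffAt_const.mul h3), lap_const_mul h3, lap_sub h2 contDiffAt_const,
      lap_const, hΦ.lap_eq_zero ε y hyP, hu.lap_eq y hy1 hyr]
    ring
  have hVlap : ∀ w : EN N, 1 < ‖w‖ → ‖w‖ < 9 * R →
      lap (fun w => v (P + ε • w)) w = -(ε ^ 2 * f (u ε (P + ε • w))) := by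
    intro w hw1 hw9
    have hd := hvd _ (hlt w hw1) (hnear _ (hle9 w hw9)).2.1
    have := lap_comp_isometry (LinearIsometryEquiv.refl ℝ (EN N)) ε P w hd.1
    simp only [LinearIsometryEquiv.coe_refl, id_eq] at this
    rw [this, hd.2]
    ring
  have huC : ∀ w : EN N, 1 < ‖w‖ → ‖w‖ < 9 * R → u ε (P + ε • w) ∈ Icc (-C) C :=
    fun w hw1 hw9 => abs_le.1 (hu.abs_le _ (hlt w hw1) (hnear _ (hle9 w hw9)).2.1)
  have hVb : AnnulusBound (fun w => v (P + ε • w)) (9 * R) M := by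
    refine ⟨?_, ?_, ?_, ?_, ?_⟩
    · have hvc : ContinuousOn v {y | ε ≤ ‖y - P‖ ∧ ‖y - P‖ ≤ r} :=
        hu.continuousOn.add (continuousOn_const.mul (ContinuousOn.sub (fun y hy =>
          (hΦ.contDiffAt ε y (ne_of_lt_norm_sub hε0 hy.1)).continuousAt.continuousWithinAt)
          continuousOn_const))
      refine hvc.comp (by fun_prop) fun w hw => ⟨?_, (hnear _ (hle9 w hw.2)).2.1⟩
      have : 1 ≤ ‖w‖ := hw.1
      rw [hnorm]
      nlinarith
    · intro w hw1 hw9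
      exact contDiffAt_comp_affine (ε • ContinuousLinearMap.id ℝ (EN N)) P w
        (hvd _ (hlt w hw1) (hnear _ (hle9 w hw9)).2.1).1
    · intro w hw1 hw9
      have hn := hnear _ (hle9 w hw9)
      have h1 := hexp _ (hlt w hw1).le hn.2.1
      have h2 := abs_add_le (u ε (P + ε • w) - u₀ (P + ε • w) + u₀ P * Φ ε (P + ε • w))
        (u₀ (P + ε • w) - u₀ P)
      have e : v (P + ε • w) = u ε (P + ε • w) - u₀ (P + ε • w) + u₀ P * Φ ε (P + ε • w) +
        (u₀ (P + ε • w) - u₀ P) := by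
        simp only [hv]
        ring
      rw [e]
      linarith [hn.1]
    · intro w hw1 hw9
      rw [hVlap w hw1 hw9, abs_neg, abs_mul, abs_of_nonneg (sq_nonneg ε)]
      have hFw := hF _ (huC w hw1 hw9)
      have hF0 : 0 ≤ F := (abs_nonneg _).trans hFw
      calc ε ^ 2 * |f (u ε (P + ε • w))| ≤ ε * F :=
            mul_le_mul hε2 hFw (abs_nonneg _) hε0.le
        _ ≤ M := hεF
    · intro w hw
      have hw' : ‖P + ε • w - P‖ = ε := by rw [hnorm, hw, mul_one]
      simp [hv, hu.eq_zero _ hw', hone _ hw']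
  have hVsym : ∀ w w' : EN N, ‖w‖ = ‖w'‖ → 1 < ‖w‖ → ‖w‖ < 9 * R →
      |lap (fun w => v (P + ε • w)) w - lap (fun w => v (P + ε • w)) w'| ≤
        |v (P + ε • w) - v (P + ε • w')| := by
    intro w w' hww hw1 hw9
    have hΦe : Φ ε (P + ε • w) = Φ ε (P + ε • w') :=
      hΦ.radial ε _ _ (by rw [hnorm, hnorm, hww])
    have hI := huC w hw1 hw9
    have hI' := huC w' (hww ▸ hw1) (hww ▸ hw9)
    have hlip := (convex_Icc (-C) C).norm_image_sub_le_of_norm_deriv_le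
      (fun s _ => hf.differentiable (by simp) s) hL hI' hI
    rw [Real.norm_eq_abs, Real.norm_eq_abs] at hlip
    have e1 : v (P + ε • w) - v (P + ε • w') = u ε (P + ε • w) - u ε (P + ε • w') := by
      simp only [hv, hΦe]
      ring
    rw [hVlap w hw1 hw9, hVlap w' (hww ▸ hw1) (hww ▸ hw9), e1]
    have e2 : -(ε ^ 2 * f (u ε (P + ε • w))) - -(ε ^ 2 * f (u ε (P + ε • w'))) =
        -(ε ^ 2 * (f (u ε (P + ε • w)) - f (u ε (P + ε • w')))) := by ring
    rw [e2, abs_neg, abs_mul, abs_of_nonneg (sq_nonneg ε)]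
    calc ε ^ 2 * |f (u ε (P + ε • w)) - f (u ε (P + ε • w'))|
        ≤ ε * (L * |u ε (P + ε • w) - u ε (P + ε • w')|) :=
          mul_le_mul hε2 hlip (abs_nonneg _) hε0.le
      _ = ε * L * |u ε (P + ε • w) - u ε (P + ε • w')| := by ring
      _ ≤ 1 * |u ε (P + ε • w) - u ε (P + ε • w')| :=
          mul_le_mul_of_nonneg_right hεL (abs_nonneg _)
      _ = _ := one_mul _
  have hmain := hest _ M hVb hVsym
  rintro x ⟨hxR, hxε⟩
  rw [mem_closedBall, dist_eq_norm] at hxR hxε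
  rw [not_le] at hxε
  obtain ⟨-, hxr, hxB1, hxB2⟩ := hnear x (by nlinarith)
  have hxb : x ∈ closedBall P r := by rwa [mem_closedBall, dist_eq_norm]
  have hu₀x := hset.contDiffAt_limit (hrΩ hxb)
  obtain ⟨w, rfl⟩ : ∃ w, x = P + ε • w :=
    ⟨ε⁻¹ • (x - P), by rw [smul_inv_smul₀ hε0.ne', add_sub_cancel]⟩
  have hw1 : 1 < ‖w‖ := by
    rw [hnorm] at hxε
    nlinarith
  have hwR : ‖w‖ ≤ R := by
    rw [hnorm, mul_comm R] at hxR
    exact le_of_mul_le_mul_left hxR hε0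
  obtain ⟨hd1, hd2⟩ := hmain w hw1 hwR
  have hvx := (hvd _ hxε hxr).1
  refine ⟨(hexp _ hxε.le hxr).trans (by linarith), fun c => ?_⟩
  have e : (fun y => u ε y - u₀ y + u₀ P * Φ ε y + c) = fun y => v y - u₀ y + (u₀ P + c) := by
    ext y
    simp only [hv]
    ring
  rw [e]
  have := abs_pd_sub_le_of_scale hε0 hε2 hvx hu₀x hd1 hd2 hxB1 hxB2 hεB (u₀ P + c)
  have hδ2 : C₁ * M + δ / 2 ≤ δ := by linarith
  exact ⟨fun i => (this.1 i).trans hδ2, fun i j => (this.2 i j).trans hδ2⟩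

theorem norm_sq_sub_pos {x P : EN N} (hx : x ≠ P) : 0 < ‖x - P‖ ^ 2 := by
  have := norm_pos_iff.2 (sub_ne_zero.2 hx)
  positivity

theorem const_div_norm_pow_eq (c : ℝ) (k : ℕ) (P : EN N) :
    (fun y : EN N => c / ‖y - P‖ ^ k) = fun y => c * (‖y - P‖ ^ 2) ^ (-(k : ℝ) / 2) := by
  ext y
  have h0 : 0 ≤ ‖y - P‖ := norm_nonneg _
  rw [neg_div, Real.rpow_neg (by positivity), ← Real.rpow_natCast ‖y - P‖ 2, ← Real.rpow_mul h0,
    div_eq_mul_inv, ← Real.rpow_natCast]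
  congr 3
  push_cast
  ring

theorem lap_const_div_norm_pow (hN : 2 ≤ N) (c : ℝ) {x P : EN N} (hx : x ≠ P) :
    lap (fun y => c / ‖y - P‖ ^ (N - 2)) x = 0 := by
  have hs := norm_sq_sub_pos hx
  rw [const_div_norm_pow_eq]
  set p : ℝ := -((N - 2 : ℕ) : ℝ) / 2 with hp
  have hd : ∀ q s : ℝ, 0 < s → HasDerivAt (fun t : ℝ => t ^ q) (q * s ^ (q - 1)) s :=
    fun q s hs => Real.hasDerivAt_rpow_const (Or.inl hs.ne')
  rw [lap_radial (h := fun s => c * s ^ p) (h' := fun s => c * (p * s ^ (p - 1)))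
    (h'' := c * (p * ((p - 1) * (‖x - P‖ ^ 2) ^ (p - 1 - 1))))
    (contDiffAt_const.mul (Real.contDiffAt_rpow_const_of_ne hs.ne'))
    ((eventually_gt_nhds hs).mono fun s hs => (hd p s hs).const_mul c)
    (((hd (p - 1) _ hs).const_mul p).const_mul c)]
  have e : (‖x - P‖ ^ 2) ^ (p - 1) = ‖x - P‖ ^ 2 * (‖x - P‖ ^ 2) ^ (p - 1 - 1) := by
    rw [Real.rpow_sub_one hs.ne' (p - 1), mul_div_assoc',
      mul_div_cancel_left₀ _ hs.ne']
  have hp2 : (N : ℝ) = 2 - 2 * p := by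
    rw [hp, Nat.cast_sub hN]
    push_cast
    ring
  rw [e, hp2]
  ring

theorem radialProfile_pow (hN : 3 ≤ N) (P : EN N) :
    RadialProfile P fun ε y => ε ^ (N - 2) / ‖y - P‖ ^ (N - 2) := by
  refine ⟨fun ε x hx => ?_, fun ε x hx => lap_const_div_norm_pow (by lia) _ hx,
    fun ε x y h => by simp only [h], ?_, fun r hr δ hδ => ?_⟩
  · exact contDiffAt_const.div (((contDiffAt_id.sub contDiffAt_const).norm ℝ
      (sub_ne_zero.2 hx)).pow _) (pow_ne_zero _ (norm_ne_zero_iff.2 (sub_ne_zero.2 hx)))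
  · filter_upwards [self_mem_nhdsWithin] with ε hε x hx
    rw [hx]
    exact div_self (pow_ne_zero _ (ne_of_gt hε))
  · have ht : Tendsto (fun ε : ℝ => ε ^ (N - 2) / r ^ (N - 2)) (𝓝[>] 0) (𝓝 0) := by
      have hc : Continuous fun ε : ℝ => ε ^ (N - 2) / r ^ (N - 2) := by fun_prop
      have h0 := (hc.tendsto 0).mono_left (nhdsWithin_le_nhds (s := Ioi 0))
      rwa [zero_pow (by lia), zero_div] at h0
    filter_upwards [ht.abs.eventually_le_const (by simpa using hδ)] with ε hε x hx
    rwa [hx]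

theorem lap_log_norm_div (c : ℝ) {x P : EN 2} (hx : x ≠ P) :
    lap (fun y => Real.log ‖y - P‖ / c) x = 0 := by
  have hs := norm_sq_sub_pos hx
  have e : (fun y : EN 2 => Real.log ‖y - P‖ / c) =
      fun y => (2 * c)⁻¹ * Real.log (‖y - P‖ ^ 2) := by
    ext y
    rw [Real.log_pow]
    push_cast
    ring
  rw [e, lap_radial (h := fun s => (2 * c)⁻¹ * Real.log s) (h' := fun s => (2 * c)⁻¹ * s⁻¹)
    (contDiffAt_const.mul (Real.contDiffAt_log.2 hs.ne'))
    ((eventually_gt_nhds hs).mono fun s hs => (Real.hasDerivAt_log hs.ne').const_mul _)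
    ((hasDerivAt_inv hs.ne').const_mul _)]
  have := hs.ne'
  have hinv : ‖x - P‖ ^ 2 * (((‖x - P‖ ^ 2) ^ 2)⁻¹) = (‖x - P‖ ^ 2)⁻¹ := by field_simp
  push_cast
  linear_combination -4 * (2 * c)⁻¹ * hinv

theorem eventually_abs_div_log_le (a : ℝ) {δ : ℝ} (hδ : 0 < δ) :
    ∀ᶠ ε in 𝓝[>] (0 : ℝ), |a / Real.log ε| ≤ δ := by
  have ht : Tendsto (fun ε => a / Real.log ε) (𝓝[>] 0) (𝓝 0) :=
    Real.tendsto_log_nhdsGT_zero.const_div_atBot a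
  exact ht.abs.eventually_le_const (by simpa using hδ)

theorem radialProfile_log (P : EN 2) :
    RadialProfile P fun ε y => Real.log ‖y - P‖ / Real.log ε := by
  refine ⟨fun ε x hx => ?_, fun ε x hx => lap_log_norm_div _ hx,
    fun ε x y h => by simp only [h], ?_, fun r hr δ hδ => ?_⟩
  · exact ((((contDiffAt_id.sub contDiffAt_const).norm ℝ (sub_ne_zero.2 hx))).log
      (norm_ne_zero_iff.2 (sub_ne_zero.2 hx))).div_const _
  · filter_upwards [Ioo_mem_nhdsGT one_pos] with ε hε x hx
    rw [hx]
    exact div_self (Real.log_neg hε.1 hε.2).ne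
  · filter_upwards [eventually_abs_div_log_le (Real.log r) hδ] with ε hε x hx
    rwa [hx]

end PerforatedExpansion

/-- Proposition 4.2 of the paper.  For any fixed `R > 1`, on the annulus
`B(P,Rε) \ B(P,ε)` one has, in `C²` with respect to the rescaled variable `w = (x-P)/ε`
(so the first derivatives carry a factor `ε` and the second ones a factor `ε²`):
`u_ε = u₀ - u₀(P) ε^{N-2}/|x-P|^{N-2} + o(1)` if `N ≥ 3`, and
`u_ε = u₀ - u₀(P)(log|x-P| + 2πH(P,P))/log ε + o(1)` if `N = 2`. -/
theorem stmt14
    {N : ℕ} (hN : 2 ≤ N)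
    (Ω : Set (EN N)) (P : EN N) (f : ℝ → ℝ) (ε₀ C : ℝ)
    (u : ℝ → EN N → ℝ) (u₀ : EN N → ℝ)
    (hset : Setting Ω P f ε₀ C u u₀)
    (H : EN N → EN N → ℝ) (hH : IsRegularPart Ω (fundS N) H)
    (R : ℝ) (hR : 1 < R) :
    ∀ δ > (0:ℝ), ∀ᶠ ε in 𝓝[>] (0:ℝ), ∀ x ∈ closedBall P (R * ε) \ closedBall P ε,
      (3 ≤ N →
        |u ε x - (u₀ x - u₀ P * ε ^ (N - 2) / ‖x - P‖ ^ (N - 2))| ≤ δ ∧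
        (∀ i, ε * |pd (fun y => u ε y
            - (u₀ y - u₀ P * ε ^ (N - 2) / ‖y - P‖ ^ (N - 2))) i x| ≤ δ) ∧
        (∀ i j, ε ^ 2 * |pd2 (fun y => u ε y
            - (u₀ y - u₀ P * ε ^ (N - 2) / ‖y - P‖ ^ (N - 2))) i j x| ≤ δ)) ∧
      (N = 2 →
        |u ε x - (u₀ x - u₀ P * (Real.log ‖x - P‖ + 2 * Real.pi * H P P) / Real.log ε)|
          ≤ δ ∧
        (∀ i, ε * |pd (fun y => u ε y - (u₀ y
            - u₀ P * (Real.log ‖y - P‖ + 2 * Real.pi * H P P) / Real.log ε)) i x| ≤ δ) ∧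
        (∀ i j, ε ^ 2 * |pd2 (fun y => u ε y - (u₀ y
            - u₀ P * (Real.log ‖y - P‖ + 2 * Real.pi * H P P) / Real.log ε)) i j x| ≤ δ)) := by
  intro δ hδ
  rcases hN.eq_or_lt with rfl | hN3
  · set a := u₀ P * (2 * Real.pi * H P P) with ha
    filter_upwards [hset.expansion_C2 two_pos (radialProfile_log P) hR (half_pos hδ),
      eventually_abs_div_log_le a (half_pos hδ)] with ε hexp hε x hx
    obtain ⟨h0, hder⟩ := hexp x hx
    obtain ⟨h1, h2⟩ := hder (a / Real.log ε)
    have e : ∀ y, u ε y - (u₀ y - u₀ P * (Real.log ‖y - P‖ + 2 * Real.pi * H P P) /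
        Real.log ε) = u ε y - u₀ y + u₀ P * (Real.log ‖y - P‖ / Real.log ε) + a / Real.log ε :=
      fun y => by rw [ha]; ring
    have hhalf : δ / 2 ≤ δ := by linarith
    refine ⟨fun h => absurd h (by norm_num), fun _ => ?_⟩
    simp only [e]
    exact ⟨(abs_add_le _ _).trans (by linarith), fun i => (h1 i).trans hhalf,
      fun i j => (h2 i j).trans hhalf⟩
  · filter_upwards [hset.expansion_C2 (by lia) (radialProfile_pow hN3 P) hR hδ] with ε hexp x hx
    obtain ⟨h0, hder⟩ := hexp x hx
    obtain ⟨h1, h2⟩ := hder 0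
    have e : ∀ y, u ε y - (u₀ y - u₀ P * ε ^ (N - 2) / ‖y - P‖ ^ (N - 2)) =
        u ε y - u₀ y + u₀ P * (ε ^ (N - 2) / ‖y - P‖ ^ (N - 2)) := fun y => by ring
    simp only [add_zero] at h1 h2
    refine ⟨fun _ => ?_, fun h => by lia⟩
    simp only [e]
    exact ⟨h0, h1, h2⟩
end
end

section
/- For every family of points x = x_ε ∈ Ω_ε with |x−P|/ε → +∞ and |x−P| → 0 as ε → 0, the gradient of u_ε satisfies, for each i: if N ≥ 3, ∂u_ε(x)/∂x_i = ∂u_0(x)/∂x_i + (N−2)(u_0(P) + o(1)) (x_i − P_i) ε^{N−2}/|x−P|^N + o(1); if N = 2, ∂u_ε(x)/∂x_i = ∂u_0(x)/∂x_i − (u_0(P) + o(1)) (x_i − P_i)/(log ε · |x−P|²) + o(1). -/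
open Filter Set Topology Metric MeasureTheory

noncomputable section

open scoped InnerProductSpace

/-- The trace of the second derivative in the standard basis. -/
def trHess {N : ℕ} (Z : EN N → ℝ) (p : EN N) : ℝ :=
  ∑ j : Fin N, fderiv ℝ (fderiv ℝ Z) p (EuclideanSpace.single j 1) (EuclideanSpace.single j 1)

/-- `Z` is `C²` at `p` with gradient `g` and Laplacian `l`. -/
def HasJet {N : ℕ} (Z : EN N → ℝ) (p g : EN N) (l : ℝ) : Prop :=
  ContDiffAt ℝ 2 Z p ∧ HasFDerivAt Z (innerSL ℝ g) p ∧ trHess Z p = l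

theorem sum_inner_single {N : ℕ} (a b : EN N) :
    ∑ j : Fin N, ⟪a, EuclideanSpace.single j (1 : ℝ)⟫_ℝ * ⟪b, EuclideanSpace.single j (1 : ℝ)⟫_ℝ
      = ⟪a, b⟫_ℝ := by
  simp [PiLp.inner_apply, mul_comm]

theorem ContDiffAt.hasJet {N : ℕ} {Z : EN N → ℝ} {p : EN N} (h : ContDiffAt ℝ 2 Z p) :
    HasJet Z p ((InnerProductSpace.toDual ℝ (EN N)).symm (fderiv ℝ Z p)) (trHess Z p) := by
  refine ⟨h, ?_, rfl⟩
  have := (h.differentiableAt (by norm_num)).hasFDerivAt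
  refine this.congr_fderiv ?_
  ext v
  simp

theorem ContDiffAt.hasFDerivAt_fderiv {N : ℕ} {Z : EN N → ℝ} {p : EN N}
    (h : ContDiffAt ℝ 2 Z p) : HasFDerivAt (fderiv ℝ Z) (fderiv ℝ (fderiv ℝ Z) p) p :=
  ((h.fderiv_right (m := 1) (by norm_num)).differentiableAt (by norm_num)).hasFDerivAt

theorem ContDiffAt.eventually_hasFDerivAt {N : ℕ} {Z : EN N → ℝ} {p : EN N}
    (h : ContDiffAt ℝ 2 Z p) : ∀ᶠ y in 𝓝 p, HasFDerivAt Z (fderiv ℝ Z y) y := by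
  filter_upwards [h.eventually (by simp)] with y hy
  exact (hy.differentiableAt (by norm_num)).hasFDerivAt

theorem hasJet_const {N : ℕ} (c : ℝ) (p : EN N) : HasJet (fun _ => c) p 0 0 := by
  refine ⟨contDiffAt_const, ?_, ?_⟩
  · simpa using hasFDerivAt_const c p
  · have : fderiv ℝ (fun _ : EN N => c) = fun _ => 0 := by ext; simp
    simp [trHess, this]

theorem hasJet_inner {N : ℕ} (e c p : EN N) : HasJet (fun y => ⟪e, y - c⟫_ℝ) p e 0 := by
  have h : ∀ y, HasFDerivAt (fun y => ⟪e, y - c⟫_ℝ) (innerSL ℝ e) y := by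
    intro y
    exact (innerSL ℝ e).hasFDerivAt.comp y ((hasFDerivAt_id y).sub_const c)
  refine ⟨(innerSL ℝ e).contDiff.contDiffAt.comp p (contDiffAt_id.sub contDiffAt_const), h p, ?_⟩
  have : fderiv ℝ (fun y => ⟪e, y - c⟫_ℝ) = fun _ => innerSL ℝ e := by
    ext1 y; exact (h y).fderiv
  simp [trHess, this]

theorem HasJet.mul {N : ℕ} {Z W : EN N → ℝ} {p g₁ g₂ : EN N} {l₁ l₂ : ℝ}
    (hZ : HasJet Z p g₁ l₁) (hW : HasJet W p g₂ l₂) :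
    HasJet (fun y => Z y * W y) p (Z p • g₂ + W p • g₁)
      (Z p * l₂ + W p * l₁ + 2 * ⟪g₁, g₂⟫_ℝ) := by
  obtain ⟨hZ1, hZ2, hZ3⟩ := hZ
  obtain ⟨hW1, hW2, hW3⟩ := hW
  refine ⟨hZ1.mul hW1, ?_, ?_⟩
  · refine (hZ2.mul hW2).congr_fderiv ?_
    ext v
    simp
  · have h1 : fderiv ℝ (fun y => Z y * W y) =ᶠ[𝓝 p]
        fun y => Z y • fderiv ℝ W y + W y • fderiv ℝ Z y := by
      filter_upwards [hZ1.eventually_hasFDerivAt, hW1.eventually_hasFDerivAt] with y h1 h2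
      exact (h1.mul h2).fderiv
    have h2 := ((hZ2.smul hW1.hasFDerivAt_fderiv).add (hW2.smul hZ1.hasFDerivAt_fderiv)).congr_of_eventuallyEq h1
    unfold trHess
    rw [h2.fderiv, ← hZ3, ← hW3, ← sum_inner_single g₁ g₂, hW2.fderiv, hZ2.fderiv]
    unfold trHess
    simp only [Finset.mul_sum, ← Finset.sum_add_distrib]
    refine Finset.sum_congr rfl fun j _ => ?_
    simp
    ring

theorem HasJet.add {N : ℕ} {Z W : EN N → ℝ} {p g₁ g₂ : EN N} {l₁ l₂ : ℝ}
    (hZ : HasJet Z p g₁ l₁) (hW : HasJet W p g₂ l₂) :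
    HasJet (fun y => Z y + W y) p (g₁ + g₂) (l₁ + l₂) := by
  obtain ⟨hZ1, hZ2, hZ3⟩ := hZ
  obtain ⟨hW1, hW2, hW3⟩ := hW
  refine ⟨hZ1.add hW1, ?_, ?_⟩
  · refine (hZ2.add hW2).congr_fderiv ?_
    ext v
    simp
  · have h1 : fderiv ℝ (fun y => Z y + W y) =ᶠ[𝓝 p]
        fun y => fderiv ℝ Z y + fderiv ℝ W y := by
      filter_upwards [hZ1.eventually_hasFDerivAt, hW1.eventually_hasFDerivAt] with y h1 h2
      exact (h1.add h2).fderiv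
    have h2 := (hZ1.hasFDerivAt_fderiv.add hW1.hasFDerivAt_fderiv).congr_of_eventuallyEq h1
    unfold trHess
    rw [h2.fderiv, ← hZ3, ← hW3]
    unfold trHess
    simp [← Finset.sum_add_distrib]

theorem HasJet.congr_val {N : ℕ} {Z W : EN N → ℝ} {p g g' : EN N} {l l' : ℝ}
    (h : HasJet Z p g l) (hZ : Z = W) (hg : g = g') (hl : l = l') : HasJet W p g' l' := by
  subst hZ hg hl; exact h

theorem HasJet.const_mul {N : ℕ} {Z : EN N → ℝ} {p g : EN N} {l : ℝ}
    (h : HasJet Z p g l) (a : ℝ) : HasJet (fun y => a * Z y) p (a • g) (a * l) :=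
  ((hasJet_const a p).mul h).congr_val rfl (by simp) (by simp)

theorem HasJet.neg {N : ℕ} {Z : EN N → ℝ} {p g : EN N} {l : ℝ}
    (h : HasJet Z p g l) : HasJet (fun y => - Z y) p (-g) (-l) :=
  (h.const_mul (-1)).congr_val (by simp) (by simp) (by simp)

theorem HasJet.sub {N : ℕ} {Z W : EN N → ℝ} {p g₁ g₂ : EN N} {l₁ l₂ : ℝ}
    (hZ : HasJet Z p g₁ l₁) (hW : HasJet W p g₂ l₂) :
    HasJet (fun y => Z y - W y) p (g₁ - g₂) (l₁ - l₂) :=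
  (hZ.add hW.neg).congr_val (by simp [sub_eq_add_neg]) (by simp [sub_eq_add_neg])
    (by simp [sub_eq_add_neg])

theorem HasJet.comp {N : ℕ} {Z : EN N → ℝ} {p g : EN N} {l a b : ℝ} {φ φ' : ℝ → ℝ}
    (h : HasJet Z p g l) (hφ : ContDiffAt ℝ 2 φ (Z p))
    (h1 : ∀ᶠ t in 𝓝 (Z p), HasDerivAt φ (φ' t) t) (ha : φ' (Z p) = a)
    (h2 : HasDerivAt φ' b (Z p)) :
    HasJet (fun y => φ (Z y)) p (a • g) (a * l + b * ‖g‖ ^ 2) := by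
  obtain ⟨hZ1, hZ2, hZ3⟩ := h
  refine ⟨hφ.comp p hZ1, ?_, ?_⟩
  · refine (h1.self_of_nhds.comp_hasFDerivAt p hZ2).congr_fderiv ?_
    ext v
    simp [ha]
  · have h3 : fderiv ℝ (fun y => φ (Z y)) =ᶠ[𝓝 p] fun y => φ' (Z y) • fderiv ℝ Z y := by
      filter_upwards [hZ1.eventually_hasFDerivAt, hZ1.continuousAt.eventually h1] with y h4 h5
      exact (h5.comp_hasFDerivAt y h4).fderiv
    have h4 := ((h2.comp_hasFDerivAt p hZ2).smul hZ1.hasFDerivAt_fderiv).congr_of_eventuallyEq h3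
    unfold trHess
    rw [h4.fderiv, ← hZ3, ← real_inner_self_eq_norm_sq, ← sum_inner_single g g, hZ2.fderiv]
    unfold trHess
    simp only [Finset.mul_sum, ← Finset.sum_add_distrib]
    refine Finset.sum_congr rfl fun j _ => ?_
    simp [ha]
    ring

theorem hasJet_sum {N : ℕ} {ι : Type*} (s : Finset ι) {Z : ι → EN N → ℝ} {p : EN N}
    {g : ι → EN N} {l : ι → ℝ} (h : ∀ i ∈ s, HasJet (Z i) p (g i) (l i)) :
    HasJet (fun y => ∑ i ∈ s, Z i y) p (∑ i ∈ s, g i) (∑ i ∈ s, l i) := by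
  classical
  induction s using Finset.induction_on with
  | empty => simpa using hasJet_const 0 p
  | insert a s ha ih =>
    simp only [Finset.sum_insert ha]
    exact (h a (by simp)).add (ih fun i hi => h i (by simp [hi]))

theorem hasJet_norm_sq {N : ℕ} (c p : EN N) :
    HasJet (fun y => ‖y - c‖ ^ 2) p ((2 : ℝ) • (p - c)) (2 * N) := by
  have h := hasJet_sum Finset.univ (fun (i : Fin N) _ =>
    (hasJet_inner (EuclideanSpace.single i (1 : ℝ)) c p).mul
      (hasJet_inner (EuclideanSpace.single i (1 : ℝ)) c p))
  refine h.congr_val ?_ ?_ ?_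
  · ext y
    rw [← real_inner_self_eq_norm_sq, ← sum_inner_single]
    simp [real_inner_comm]
  · rw [Finset.sum_add_distrib, ← two_smul ℝ]
    congr 1
    ext i
    simp [PiLp.inner_apply, Finset.sum_apply, Pi.single_apply]
  · simp [mul_comm]

theorem trHess_basis {N : ℕ} {Z : EN N → ℝ} {p : EN N} (b : OrthonormalBasis (Fin N) ℝ (EN N)) :
    trHess Z p = ∑ j, fderiv ℝ (fderiv ℝ Z) p (b j) (b j) := by
  have h1 := congrFun (InnerProductSpace.laplacian_eq_iteratedFDeriv_orthonormalBasis Z b) p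
  have h2 := congrFun (InnerProductSpace.laplacian_eq_iteratedFDeriv_orthonormalBasis Z
    (EuclideanSpace.basisFun (Fin N) ℝ)) p
  rw [h1] at h2
  simpa [iteratedFDeriv_two_apply, trHess] using h2.symm

theorem HasJet.comp_isometry {N : ℕ} {Z : EN N → ℝ} {p g c : EN N} {l : ℝ}
    (L : EN N ≃ₗᵢ[ℝ] EN N) (h : HasJet Z (c + L (p - c)) g l) :
    HasJet (fun y => Z (c + L (y - c))) p (L.symm g) l := by
  obtain ⟨hZ1, hZ2, hZ3⟩ := h
  have hσ : ∀ y, HasFDerivAt (fun y => c + L (y - c)) (L : EN N →L[ℝ] EN N) y := fun y =>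
    ((L : EN N →L[ℝ] EN N).hasFDerivAt.comp y ((hasFDerivAt_id y).sub_const c)).const_add c
  refine ⟨?_, ?_, ?_⟩
  · exact ContDiffAt.comp p (f := fun y => c + L (y - c)) hZ1 (by fun_prop)
  · have := HasFDerivAt.comp p (f := fun y => c + L (y - c)) hZ2 (hσ p)
    refine this.congr_fderiv ?_
    ext v
    simp [LinearIsometryEquiv.inner_map_eq_flip]
  · have h3 : fderiv ℝ (fun y => Z (c + L (y - c))) =ᶠ[𝓝 p]
        fun y => (fderiv ℝ Z (c + L (y - c))).comp (L : EN N →L[ℝ] EN N) := by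
      filter_upwards [(hσ p).continuousAt.eventually hZ1.eventually_hasFDerivAt] with y h4
      exact (HasFDerivAt.comp y (f := fun y => c + L (y - c)) h4 (hσ y)).fderiv
    have h4 := HasFDerivAt.comp p (f := fun y => c + L (y - c)) hZ1.hasFDerivAt_fderiv (hσ p)
    have h5 := (h4.clm_comp (hasFDerivAt_const (L : EN N →L[ℝ] EN N) p)).congr_of_eventuallyEq h3
    rw [← hZ3, trHess_basis ((EuclideanSpace.basisFun (Fin N) ℝ).map L.symm)]
    unfold trHess
    rw [h5.fderiv]
    simp

theorem second_deriv_nonpos_of_isLocalMax {φ φ' : ℝ → ℝ} {b : ℝ} (hmax : IsLocalMax φ 0)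
    (h1 : ∀ᶠ t in 𝓝 (0 : ℝ), HasDerivAt φ (φ' t) t) (h2 : HasDerivAt φ' b 0) : b ≤ 0 := by
  by_contra! hpos
  have h3 : deriv φ =ᶠ[𝓝 0] φ' := by
    filter_upwards [h1] with t ht using ht.deriv
  have h4 : deriv (deriv φ) 0 = b := by rw [h3.deriv_eq, h2.deriv]
  have hmin : IsLocalMin φ 0 :=
    isLocalMin_of_deriv_deriv_pos (by rw [h4]; exact hpos) hmax.deriv_eq_zero
      h1.self_of_nhds.continuousAt
  have hc : φ =ᶠ[𝓝 0] fun _ => φ 0 := by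
    filter_upwards [hmax, hmin] with t h5 h6 using le_antisymm h5 h6
  have h5 : deriv φ =ᶠ[𝓝 0] fun _ => 0 := by simpa using hc.deriv
  rw [h5.deriv_eq] at h4
  simp at h4
  linarith

theorem IsLocalMax.hess_nonpos {N : ℕ} {Z : EN N → ℝ} {p : EN N} (h : IsLocalMax Z p)
    (hZ : ContDiffAt ℝ 2 Z p) (v : EN N) : fderiv ℝ (fderiv ℝ Z) p v v ≤ 0 := by
  have hl : ∀ t : ℝ, HasDerivAt (fun t : ℝ => p + t • v) v t := fun t => by
    simpa using ((hasDerivAt_id t).smul_const v).const_add p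
  have h0 : p + (0 : ℝ) • v = p := by simp
  have hl0 : Tendsto (fun t : ℝ => p + t • v) (𝓝 0) (𝓝 p) := by
    simpa using (hl 0).continuousAt.tendsto
  refine second_deriv_nonpos_of_isLocalMax (φ := fun t => Z (p + t • v))
    (φ' := fun t => fderiv ℝ Z (p + t • v) v) ?_ ?_ ?_
  · filter_upwards [hl0.eventually h] with t ht
    rw [h0]; exact ht
  · filter_upwards [hl0.eventually hZ.eventually_hasFDerivAt] with t ht
    exact ht.comp_hasDerivAt t (hl t)
  · have h3 : HasFDerivAt (fderiv ℝ Z) (fderiv ℝ (fderiv ℝ Z) p) (p + (0:ℝ) • v) := by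
      rw [h0]; exact hZ.hasFDerivAt_fderiv
    exact ((ContinuousLinearMap.apply ℝ ℝ v).hasFDerivAt.comp_hasDerivAt (0 : ℝ)
      (h3.comp_hasDerivAt (0 : ℝ) (hl 0)))

/-- Weak maximum principle for strict subsolutions. -/
theorem max_principle_s15 {N : ℕ} {D : Set (EN N)} (hD : IsOpen D) (hb : Bornology.IsBounded D)
    {Z : EN N → ℝ} (hc : ContinuousOn Z (closure D))
    (hZ : ∀ p ∈ D, ContDiffAt ℝ 2 Z p ∧ 0 < trHess Z p)
    (hf : ∀ p ∈ frontier D, Z p ≤ 0) : ∀ p ∈ D, Z p ≤ 0 := by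
  intro p hp
  obtain ⟨q, hq, hmax⟩ := hb.isCompact_closure.exists_isMaxOn ⟨p, subset_closure hp⟩ hc
  refine (hmax (subset_closure hp)).trans ?_
  by_cases hqD : q ∈ D
  · exfalso
    have hloc : IsLocalMax Z q := by
      filter_upwards [hD.mem_nhds hqD] with y hy using hmax (subset_closure hy)
    have := Finset.sum_nonpos (s := Finset.univ) fun (j : Fin N) _ =>
      hloc.hess_nonpos (hZ q hqD).1 (EuclideanSpace.single j 1)
    exact absurd (hZ q hqD).2 (not_lt.2 this)
  · exact hf q ⟨hq, by rwa [hD.interior_eq]⟩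

/-- Reflection across the hyperplane through the origin orthogonal to `e`. -/
def hyperRefl {N : ℕ} (e : EN N) : EN N ≃ₗᵢ[ℝ] EN N := (ℝ ∙ e)ᗮ.reflection

theorem hyperRefl_apply {N : ℕ} {e : EN N} (he : ‖e‖ = 1) (v : EN N) :
    hyperRefl e v = v - (2 * ⟪e, v⟫_ℝ) • e := by
  unfold hyperRefl
  rw [Submodule.reflection_orthogonal_apply, Submodule.reflection_singleton_apply]
  simp [he, two_smul, two_mul, add_smul]

/-- Comparison of a function with its reflection across a hyperplane. -/
theorem reflection_comparison {N : ℕ} {S T : Set (EN N)} (hS : IsOpen S)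
    (hb : Bornology.IsBounded S) (hT : IsClosed T) (hST : S ⊆ T) {V B : EN N → ℝ} {c e : EN N}
    (he : ‖e‖ = 1) {M : ℝ}
    (hσS : ∀ y ∈ S, c + hyperRefl e (y - c) ∈ S) (hσT : ∀ y ∈ T, c + hyperRefl e (y - c) ∈ T)
    (hVc : ContinuousOn V T) (hV : ∀ y ∈ S, ContDiffAt ℝ 2 V y ∧ |trHess V y| < M)
    (hBc : ContinuousOn B T)
    (hB : ∀ y ∈ S, 0 < ⟪e, y - c⟫_ℝ → ∃ g l, HasJet B y g l ∧ l ≤ -(2 * M))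
    (hf : ∀ y ∈ T, y ∉ S → 0 ≤ ⟪e, y - c⟫_ℝ → V y - V (c + hyperRefl e (y - c)) ≤ B y)
    (hB0 : ∀ y ∈ T, ⟪e, y - c⟫_ℝ = 0 → 0 ≤ B y) :
    ∀ y ∈ S, 0 < ⟪e, y - c⟫_ℝ → V y - V (c + hyperRefl e (y - c)) ≤ B y := by
  intro y hy hs
  have hcs : Continuous fun y : EN N => ⟪e, y - c⟫_ℝ := by fun_prop
  have hcσ : Continuous fun y : EN N => c + hyperRefl e (y - c) := by fun_prop
  set D : Set (EN N) := S ∩ {y | 0 < ⟪e, y - c⟫_ℝ} with hD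
  have hDo : IsOpen D := hS.inter (isOpen_lt continuous_const hcs)
  have hcl : closure D ⊆ T ∩ {y | 0 ≤ ⟪e, y - c⟫_ℝ} :=
    closure_minimal (fun z hz => ⟨hST hz.1, (show 0 < ⟪e, z - c⟫_ℝ from hz.2).le⟩)
      (hT.inter (isClosed_le continuous_const hcs))
  have key := max_principle_s15 hDo (hb.subset inter_subset_left)
    (Z := fun y => V y - V (c + hyperRefl e (y - c)) - B y) ?_ ?_ ?_ y ⟨hy, hs⟩
  · linarith
  · refine ContinuousOn.mono ?_ (hcl.trans inter_subset_left)
    exact (hVc.sub (hVc.comp hcσ.continuousOn hσT)).sub hBc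
  · rintro p ⟨hpS, hps⟩
    obtain ⟨g, l, hj, hl⟩ := hB p hpS hps
    have h1 := (hV p hpS).1.hasJet
    have h2 := HasJet.comp_isometry (hyperRefl e) (hV _ (hσS p hpS)).1.hasJet
    have h3 := (h1.sub h2).sub hj
    refine ⟨h3.1, ?_⟩
    rw [h3.2.2]
    have h4 := abs_lt.1 (hV p hpS).2
    have h5 := abs_lt.1 (hV _ (hσS p hpS)).2
    linarith
  · rintro p hp
    obtain ⟨hpT, hps⟩ := hcl hp.1
    have hpD : p ∉ D := by rw [← hDo.interior_eq]; exact hp.2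
    by_cases hs0 : ⟪e, p - c⟫_ℝ = 0
    · have h1 := hB0 p hpT hs0
      have h2 : hyperRefl e (p - c) = p - c := by rw [hyperRefl_apply he, hs0]; simp
      simp only [h2, add_sub_cancel, sub_self, zero_sub]
      linarith
    · have h1 := hf p hpT (fun h => hpD ⟨h, lt_of_le_of_ne hps (Ne.symm hs0)⟩) hps
      linarith

theorem inner_le_norm_of_unit {N : ℕ} {e : EN N} (he : ‖e‖ = 1) (v : EN N) :
    ⟪e, v⟫_ℝ ≤ ‖v‖ := by
  simpa [he] using real_inner_le_norm e v

/-- Interior gradient estimate for Poisson's equation, in direction `e`. -/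
theorem gradient_estimate {N : ℕ} {V : EN N → ℝ} {x e : EN N} {ρ S₀ M : ℝ} (hρ : 0 < ρ)
    (he : ‖e‖ = 1) (hVc : ContinuousOn V (closedBall x ρ))
    (hV : ∀ y ∈ ball x ρ, ContDiffAt ℝ 2 V y ∧ |trHess V y| < M)
    (hS : ∀ y ∈ closedBall x ρ, |V y| ≤ S₀) :
    fderiv ℝ V x e ≤ N * S₀ / ρ + M * ρ / 2 := by
  have hS0 : 0 ≤ S₀ := (abs_nonneg _).trans (hS x (by simp [hρ.le]))
  have hM : 0 ≤ M := (abs_nonneg _).trans (hV x (by simp [hρ])).2.le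
  have hσn : ∀ y, ‖x + hyperRefl e (y - x) - x‖ = ‖y - x‖ := fun y => by
    rw [add_sub_cancel_left, LinearIsometryEquiv.norm_map]
  set a : ℝ := 2 * S₀ / ρ ^ 2 with ha
  have ha0 : 0 ≤ a := by positivity
  set b : ℝ := a * N + M with hb
  have hb0 : 0 ≤ b := by positivity
  set B : EN N → ℝ := fun y => a * ‖y - x‖ ^ 2 +
    b * (ρ * ⟪e, y - x⟫_ℝ - ⟪e, y - x⟫_ℝ * ⟪e, y - x⟫_ℝ) with hB
  have key := reflection_comparison (S := ball x ρ) (T := closedBall x ρ) isOpen_ball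
    isBounded_ball isClosed_closedBall ball_subset_closedBall (V := V) (B := B) (c := x) he (M := M)
    (by intro y hy; rw [mem_ball, dist_eq_norm] at *; rwa [hσn])
    (by intro y hy; rw [mem_closedBall, dist_eq_norm] at *; rwa [hσn]) hVc hV
    (by apply Continuous.continuousOn; fun_prop) ?_ ?_ ?_
  · have hline : ∀ t ∈ Ioo (0 : ℝ) ρ, V (x + t • e) - V (x - t • e) ≤
        t * (a * t + b * ρ) := by
      rintro t ⟨ht0, ht1⟩
      have hin : ⟪e, t • e⟫_ℝ = t := by
        rw [inner_smul_right, real_inner_self_eq_norm_sq, he]; simp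
      have h1 := key (x + t • e) (by simp [norm_smul, he, abs_of_pos ht0, ht1])
        (by simpa [hin] using ht0)
      simp only [add_sub_cancel_left, hyperRefl_apply he, hin, hB, norm_smul, he,
        Real.norm_eq_abs, abs_of_pos ht0, mul_one] at h1
      have h2 : x + (t • e - (2 * t) • e) = x - t • e := by
        rw [two_mul, add_smul]; abel
      rw [h2] at h1
      nlinarith [mul_nonneg hb0 (sq_nonneg t)]
    have hd : HasDerivAt (fun t : ℝ => V (x + t • e) - V (x - t • e)) (2 * fderiv ℝ V x e) 0 := by
      have hVx := ((hV x (by simp [hρ])).1.differentiableAt (by norm_num)).hasFDerivAt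
      have h1 : HasDerivAt (fun t : ℝ => x + t • e) e 0 := by
        simpa using ((hasDerivAt_id (0 : ℝ)).smul_const e).const_add x
      have h2 : HasDerivAt (fun t : ℝ => x - t • e) (-e) 0 := by
        simpa using ((hasDerivAt_id (0 : ℝ)).smul_const e).const_sub x
      have h3 := HasFDerivAt.comp_hasDerivAt (0 : ℝ) (l := V) (l' := fderiv ℝ V x)
        (by simpa using hVx) h1
      have h4 := HasFDerivAt.comp_hasDerivAt (0 : ℝ) (l := V) (l' := fderiv ℝ V x)
        (by simpa using hVx) h2
      refine (h3.sub h4).congr_deriv ?_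
      simp; ring
    have hlim := (hasDerivAt_iff_tendsto_slope_zero.1 hd).mono_left
      (nhdsWithin_mono 0 (fun t (ht : 0 < t) => ht.ne') : 𝓝[>] (0:ℝ) ≤ 𝓝[≠] 0)
    have hlim2 : Tendsto (fun t : ℝ => a * t + b * ρ) (𝓝[>] 0) (𝓝 (a * 0 + b * ρ)) :=
      ((by fun_prop : Continuous fun t : ℝ => a * t + b * ρ).tendsto 0).mono_left
        nhdsWithin_le_nhds
    have hle := le_of_tendsto_of_tendsto hlim hlim2 (by
      filter_upwards [Ioo_mem_nhdsGT hρ] with t ht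
      have h1 := hline t ht
      simp only [zero_add, zero_smul, add_zero, sub_zero, sub_self, smul_eq_mul]
      rw [inv_mul_le_iff₀ ht.1]
      exact h1)
    have h5 : b * ρ = 2 * (N * S₀ / ρ + M * ρ / 2) := by
      rw [hb, ha]; field_simp
    linarith
  · intro y hy hs
    have h1 := (hasJet_norm_sq x y).const_mul a
    have h2 := hasJet_inner e x y
    refine ⟨_, _, h1.add (((h2.const_mul ρ).sub (h2.mul h2)).const_mul b), ?_⟩
    rw [real_inner_self_eq_norm_sq, he, hb]
    simp
    nlinarith
  · intro y hy hyS hs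
    rw [mem_closedBall, dist_eq_norm] at hy
    rw [mem_ball, dist_eq_norm, not_lt] at hyS
    have hρy : ‖y - x‖ = ρ := le_antisymm hy hyS
    have h1 := abs_le.1 (hS y (by rwa [mem_closedBall, dist_eq_norm]))
    have h2 := abs_le.1 (hS (x + hyperRefl e (y - x))
      (by rw [mem_closedBall, dist_eq_norm, hσn]; exact hy))
    have h3 : a * ρ ^ 2 = 2 * S₀ := by rw [ha]; field_simp
    have h4 := inner_le_norm_of_unit he (y - x)
    simp only [hB]
    rw [hρy] at h4 ⊢
    have : 0 ≤ b * (⟪e, y - x⟫_ℝ * (ρ - ⟪e, y - x⟫_ℝ)) :=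
      mul_nonneg hb0 (mul_nonneg hs (by linarith))
    nlinarith
  · intro y hy hs
    simp only [hB, hs]
    simp
    positivity

theorem hasJet_inv_norm_sq {N : ℕ} {c p : EN N} (hp : p ≠ c) :
    HasJet (fun y => (‖y - c‖ ^ 2)⁻¹) p ((-((‖p - c‖ ^ 2) ^ 2)⁻¹) • ((2 : ℝ) • (p - c)))
      (((‖p - c‖ ^ 2) ^ 2)⁻¹ * (8 - 2 * N)) := by
  have hq : 0 < ‖p - c‖ ^ 2 := by
    have := norm_pos_iff.2 (sub_ne_zero.2 hp); positivity
  have h := (hasJet_norm_sq c p).comp (φ := fun t => t⁻¹) (φ' := fun t => -(t ^ 2)⁻¹)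
    (a := -((‖p - c‖ ^ 2) ^ 2)⁻¹) (b := 2 * ((‖p - c‖ ^ 2) ^ 3)⁻¹)
    (contDiffAt_inv ℝ hq.ne')
    (by filter_upwards [eventually_ne_nhds hq.ne'] with t ht using hasDerivAt_inv ht) rfl
    (by
      have := ((hasDerivAt_pow 2 (‖p - c‖ ^ 2)).inv (by positivity)).neg
      refine this.congr_deriv ?_
      generalize ‖p - c‖ ^ 2 = q at hq
      norm_num
      field_simp)
  refine h.congr_val rfl rfl ?_
  rw [norm_smul]
  have : ‖p - c‖ ≠ 0 := norm_ne_zero_iff.2 (sub_ne_zero.2 hp)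
  field_simp
  norm_num
  ring

/-- Comparison with the reflection, in an annulus. -/
theorem annulus_reflection {N : ℕ} (hN : 2 ≤ N) {w : EN N → ℝ} {c e : EN N} {ε R A L M : ℝ}
    (hε : 0 < ε) (hA : 0 ≤ A) (hL : 0 ≤ L) (he : ‖e‖ = 1)
    (hwc : ContinuousOn w {y | ε ≤ ‖y - c‖ ∧ ‖y - c‖ ≤ R})
    (hw : ∀ y, ε < ‖y - c‖ → ‖y - c‖ < R → ContDiffAt ℝ 2 w y ∧ |trHess w y| < M)
    (hin : ∀ y, ‖y - c‖ = ε → 0 ≤ ⟪e, y - c⟫_ℝ →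
      w y - w (c + hyperRefl e (y - c)) ≤ 2 * L * ⟪e, y - c⟫_ℝ)
    (hout : ∀ y, ‖y - c‖ = R → 0 ≤ ⟪e, y - c⟫_ℝ →
      w y - w (c + hyperRefl e (y - c)) ≤ A * ⟪e, y - c⟫_ℝ)
    {y : EN N} (hy1 : ε < ‖y - c‖) (hy2 : ‖y - c‖ < R) (hs : 0 < ⟪e, y - c⟫_ℝ) :
    w y - w (c + hyperRefl e (y - c)) ≤
      ⟪e, y - c⟫_ℝ * (A + 2 * L * ε ^ 2 * (‖y - c‖ ^ 2)⁻¹ + M * R) := by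
  have hM : 0 ≤ M := (abs_nonneg _).trans (hw y hy1 hy2).2.le
  have hσn : ∀ y, ‖c + hyperRefl e (y - c) - c‖ = ‖y - c‖ := fun y => by
    rw [add_sub_cancel_left, LinearIsometryEquiv.norm_map]
  have hcn : Continuous fun y : EN N => ‖y - c‖ := by fun_prop
  set B : EN N → ℝ := fun y => A * ⟪e, y - c⟫_ℝ +
    (2 * L * ε ^ 2) * (⟪e, y - c⟫_ℝ * (‖y - c‖ ^ 2)⁻¹) +
    M * (R * ⟪e, y - c⟫_ℝ - ⟪e, y - c⟫_ℝ * ⟪e, y - c⟫_ℝ) with hB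
  have key := reflection_comparison (S := {y | ε < ‖y - c‖ ∧ ‖y - c‖ < R})
    (T := {y | ε ≤ ‖y - c‖ ∧ ‖y - c‖ ≤ R})
    ((isOpen_lt continuous_const hcn).inter (isOpen_lt hcn continuous_const))
    (isBounded_ball (x := c) (r := R) |>.subset fun y hy => by
      rw [mem_ball, dist_eq_norm]; exact hy.2)
    ((isClosed_le continuous_const hcn).inter (isClosed_le hcn continuous_const))
    (fun y hy => ⟨hy.1.le, hy.2.le⟩) (V := w) (B := B) (c := c) he (M := M)
    (fun y hy => by simpa only [mem_ofPred_eq, hσn] using hy)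
    (fun y hy => by simpa only [mem_ofPred_eq, hσn] using hy) hwc (fun y hy => hw y hy.1 hy.2)
    ?_ ?_ ?_ ?_ y ⟨hy1, hy2⟩ hs
  · refine key.trans ?_
    simp only [hB]
    nlinarith [mul_nonneg hM (sq_nonneg ⟪e, y - c⟫_ℝ)]
  · intro z hz
    have hz0 : ‖z - c‖ ^ 2 ≠ 0 := by
      have := hε.trans_le hz.1; positivity
    apply ContinuousAt.continuousWithinAt
    simp only [hB]
    fun_prop (disch := assumption)
  · rintro z ⟨hz1, hz2⟩ hzs
    have hzc : z ≠ c := by rintro rfl; simp at hz1; linarith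
    have h2 := hasJet_inner e c z
    refine ⟨_, _, ((h2.const_mul A).add ((h2.mul (hasJet_inv_norm_sq hzc)).const_mul _)).add
      (((h2.const_mul R).sub (h2.mul h2)).const_mul M), ?_⟩
    have h3 : 0 ≤ ((‖z - c‖ ^ 2) ^ 2)⁻¹ := by positivity
    have hN' : (2 : ℝ) ≤ N := by exact_mod_cast hN
    rw [real_inner_self_eq_norm_sq, he, inner_smul_right, inner_smul_right]
    have h4 : 0 ≤ 2 * L * ε ^ 2 * (⟪e, z - c⟫_ℝ * ((‖z - c‖ ^ 2) ^ 2)⁻¹ * (2 * N - 4)) :=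
      mul_nonneg (by positivity) (mul_nonneg (mul_nonneg hzs.le h3) (by linarith))
    nlinarith
  · rintro z ⟨hz1, hz2⟩ hzS hzs
    have hsn := inner_le_norm_of_unit he (z - c)
    have hpos : 0 ≤ M * (⟪e, z - c⟫_ℝ * (R - ⟪e, z - c⟫_ℝ)) :=
      mul_nonneg hM (mul_nonneg hzs (by linarith))
    have hAs := mul_nonneg hA hzs
    have hLs : 0 ≤ 2 * L * ε ^ 2 * (⟪e, z - c⟫_ℝ * (‖z - c‖ ^ 2)⁻¹) := by positivity
    simp only [hB]
    rcases hz1.eq_or_lt with h | h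
    · have h1 := hin z h.symm hzs
      rw [← h]
      have : 2 * L * ε ^ 2 * (⟪e, z - c⟫_ℝ * (ε ^ 2)⁻¹) = 2 * L * ⟪e, z - c⟫_ℝ := by
        field_simp
      nlinarith
    · have h2 : ‖z - c‖ = R := by
        by_contra hne
        exact hzS ⟨h, lt_of_le_of_ne hz2 hne⟩
      have h1 := hout z h2 hzs
      nlinarith
  · rintro z hz hzs
    simp [hB, hzs]

/-- Oscillation on spheres inside an annulus. -/
theorem annulus_oscillation {N : ℕ} (hN : 2 ≤ N) {w : EN N → ℝ} {c : EN N} {ε R A L M : ℝ}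
    (hε : 0 < ε) (hεR : ε < R) (hA : 0 ≤ A) (hL : 0 ≤ L)
    (hwc : ContinuousOn w {y | ε ≤ ‖y - c‖ ∧ ‖y - c‖ ≤ R})
    (hw : ∀ y, ε < ‖y - c‖ → ‖y - c‖ < R → ContDiffAt ℝ 2 w y ∧ |trHess w y| < M)
    (hin : ∀ e : EN N, ‖e‖ = 1 → ∀ y, ‖y - c‖ = ε → 0 ≤ ⟪e, y - c⟫_ℝ →
      w y - w (c + hyperRefl e (y - c)) ≤ 2 * L * ⟪e, y - c⟫_ℝ)
    (hout : ∀ e : EN N, ‖e‖ = 1 → ∀ y, ‖y - c‖ = R → 0 ≤ ⟪e, y - c⟫_ℝ →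
      w y - w (c + hyperRefl e (y - c)) ≤ A * ⟪e, y - c⟫_ℝ)
    {y z : EN N} (hy1 : ε < ‖y - c‖) (hy2 : ‖y - c‖ < R) (hyz : ‖y - c‖ = ‖z - c‖) :
    w y - w z ≤ ‖y - c‖ * (A + 2 * L * ε ^ 2 * (‖y - c‖ ^ 2)⁻¹ + M * R) := by
  have hM : 0 ≤ M := (abs_nonneg _).trans (hw y hy1 hy2).2.le
  have hR : 0 < R := hε.trans hεR
  have hpos : 0 ≤ A + 2 * L * ε ^ 2 * (‖y - c‖ ^ 2)⁻¹ + M * R := by positivity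
  rcases eq_or_ne y z with rfl | hne
  · simpa using mul_nonneg (norm_nonneg _) hpos
  have hd : 0 < ‖y - z‖ := norm_pos_iff.2 (sub_ne_zero.2 hne)
  set e : EN N := ‖y - z‖⁻¹ • (y - z) with he
  have he1 : ‖e‖ = 1 := by rw [he, norm_smul]; simp [hd.ne']
  have hi : ⟪y - z, y - c⟫_ℝ = ‖y - z‖ ^ 2 / 2 := by
    have h1 : z - c = (y - c) - (y - z) := by abel
    have h2 := norm_sub_sq_real (y - c) (y - z)
    rw [← h1, ← hyz, real_inner_comm] at h2
    linarith
  have hs : ⟪e, y - c⟫_ℝ = ‖y - z‖ / 2 := by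
    rw [he, real_inner_smul_left, hi]; field_simp
  have hz : c + hyperRefl e (y - c) = z := by
    rw [hyperRefl_apply he1, hs, he, smul_smul]
    have : 2 * (‖y - z‖ / 2) * ‖y - z‖⁻¹ = 1 := by field_simp
    rw [this, one_smul]; abel
  have h := annulus_reflection hN hε hA hL he1 hwc hw (hin e he1) (hout e he1) hy1 hy2
    (by rw [hs]; positivity)
  rw [hz] at h
  exact h.trans (mul_le_mul_of_nonneg_right (inner_le_norm_of_unit he1 _) hpos)

/-- The radial profile of the fundamental solution of the Laplacian. -/
def prof (N : ℕ) (s : ℝ) : ℝ := if N = 2 then -Real.log s else (s ^ (N - 2))⁻¹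

/-- The normalizing constant in the derivative of `prof`. -/
def profConst (N : ℕ) : ℝ := if N = 2 then 1 else (N : ℝ) - 2

theorem profConst_pos {N : ℕ} (hN : 2 ≤ N) : 0 < profConst N := by
  unfold profConst
  split_ifs with h
  · norm_num
  · have : 2 < N := by omega
    have : (2 : ℝ) < N := by exact_mod_cast this
    linarith

theorem prof_strictAnti {N : ℕ} (hN : 2 ≤ N) {s t : ℝ} (hs : 0 < s) (hst : s < t) :
    prof N t < prof N s := by
  unfold prof
  split_ifs with h
  · exact neg_lt_neg (Real.log_lt_log hs hst)
  · have h1 : s ^ (N - 2) < t ^ (N - 2) := pow_lt_pow_left₀ hst hs.le (by omega)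
    exact inv_strictAnti₀ (by positivity) h1

theorem prof_gap {N : ℕ} (hN : 2 ≤ N) {ε r : ℝ} (hε : 0 < ε) (hr : ε ≤ r) :
    1 / 2 * (ε ^ (N - 2))⁻¹ ≤ prof N ε - prof N (2 * r) := by
  unfold prof
  split_ifs with h
  · subst h
    have h1 := Real.log_le_log (by positivity : 0 < 2 * ε) (by linarith : 2 * ε ≤ 2 * r)
    rw [Real.log_mul (by norm_num) hε.ne'] at h1
    have := Real.log_two_gt_d9
    norm_num
    linarith
  · have h0 : 2 * ε ^ (N - 2) ≤ (2 * r) ^ (N - 2) := by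
      rw [mul_pow]
      have h1 : ε ^ (N - 2) ≤ r ^ (N - 2) := pow_le_pow_left₀ hε.le hr _
      have h2 : (2 : ℝ) ≤ 2 ^ (N - 2) := by
        simpa using pow_le_pow_right₀ (by norm_num : (1 : ℝ) ≤ 2) (by omega : 1 ≤ N - 2)
      exact mul_le_mul h2 h1 (by positivity) (by positivity)
    have h1 : ((2 * r) ^ (N - 2))⁻¹ ≤ (2 * ε ^ (N - 2))⁻¹ := inv_anti₀ (by positivity) h0
    rw [mul_inv] at h1
    linarith

theorem tendsto_prof {N : ℕ} (hN : 2 ≤ N) : Tendsto (prof N) (𝓝[>] 0) atTop := by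
  unfold prof
  split_ifs with h
  · exact tendsto_neg_atBot_atTop.comp Real.tendsto_log_nhdsGT_zero
  · refine tendsto_inv_nhdsGT_zero.comp (tendsto_nhdsWithin_iff.2 ⟨?_, ?_⟩)
    · have : Tendsto (fun s : ℝ => s ^ (N - 2)) (𝓝 0) (𝓝 (0 ^ (N - 2))) :=
        (continuous_pow _).tendsto 0
      rw [zero_pow (by omega)] at this
      exact this.mono_left nhdsWithin_le_nhds
    · filter_upwards [self_mem_nhdsWithin] with s hs
      exact pow_pos (mem_Ioi.1 hs) _

theorem hasJet_prof {N : ℕ} (hN : 2 ≤ N) {c p : EN N} (hp : p ≠ c) :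
    HasJet (fun y => prof N ‖y - c‖) p ((-(profConst N / ‖p - c‖ ^ N)) • (p - c)) 0 := by
  have hn : 0 < ‖p - c‖ := norm_pos_iff.2 (sub_ne_zero.2 hp)
  have hq : 0 < ‖p - c‖ ^ 2 := by positivity
  by_cases h : N = 2
  · subst h
    have hj := (hasJet_norm_sq c p).comp (φ := fun t => -(1 / 2) * Real.log t)
      (φ' := fun t => -(1 / 2) * t⁻¹)
      (a := -(1 / 2) * (‖p - c‖ ^ 2)⁻¹) (b := 1 / 2 * ((‖p - c‖ ^ 2) ^ 2)⁻¹)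
      (contDiffAt_const.mul (Real.contDiffAt_log.2 hq.ne'))
      (by
        filter_upwards [eventually_ne_nhds hq.ne'] with t ht
        exact (Real.hasDerivAt_log ht).const_mul _) rfl
      (((hasDerivAt_inv hq.ne').const_mul (-(1 / 2) : ℝ)).congr_deriv (by ring))
    refine hj.congr_val ?_ ?_ ?_
    · ext y
      simp [prof, Real.log_pow]
    · rw [smul_smul]
      congr 1
      simp only [profConst, if_true]
      field_simp
    · rw [norm_smul]
      norm_num
      field_simp
      norm_num
  · set a : ℝ := (2 - (N : ℝ)) / 2 with ha
    have hj := (hasJet_norm_sq c p).comp (φ := fun t => t ^ a)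
      (φ' := fun t => a * t ^ (a - 1))
      (a := a * (‖p - c‖ ^ 2) ^ (a - 1)) (b := a * ((a - 1) * (‖p - c‖ ^ 2) ^ (a - 1 - 1)))
      (Real.contDiffAt_rpow_const (Or.inl hq.ne'))
      (by
        filter_upwards [eventually_ne_nhds hq.ne'] with t ht
        exact Real.hasDerivAt_rpow_const (Or.inl ht)) rfl
      ((Real.hasDerivAt_rpow_const (Or.inl hq.ne')).const_mul a)
    refine hj.congr_val ?_ ?_ ?_
    · ext y
      simp only [prof, if_neg h]
      rw [← Real.rpow_natCast_mul (norm_nonneg _), ← Real.rpow_natCast,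
        ← Real.rpow_neg (norm_nonneg _)]
      congr 1
      rw [ha]
      push_cast [Nat.cast_sub hN]
      ring
    · rw [smul_smul]
      congr 1
      simp only [profConst, if_neg h]
      rw [← Real.rpow_natCast_mul (norm_nonneg _)]
      have : ((2 : ℕ) : ℝ) * (a - 1) = -(N : ℝ) := by rw [ha]; push_cast; ring
      rw [this, Real.rpow_neg (norm_nonneg _), Real.rpow_natCast, ha]
      ring
    · rw [norm_smul]
      have : (‖p - c‖ ^ 2) ^ (a - 1 - 1) * ‖p - c‖ ^ 2 = (‖p - c‖ ^ 2) ^ (a - 1) := by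
        rw [← Real.rpow_add_one hq.ne']; ring_nf
      rw [mul_pow, ← this, ha]
      norm_num
      ring

/-- One-sided bound in an annulus by a radial barrier. -/
theorem annulus_barrier {N : ℕ} (hN : 2 ≤ N) {V : EN N → ℝ} {c : EN N} {a b α K M : ℝ}
    (ha : 0 < a) (hM : 0 ≤ M)
    (hVc : ContinuousOn V {y | a ≤ ‖y - c‖ ∧ ‖y - c‖ ≤ b})
    (hV : ∀ y, a < ‖y - c‖ → ‖y - c‖ < b → ContDiffAt ℝ 2 V y ∧ -M < trHess V y)
    (hin : ∀ y, ‖y - c‖ = a → V y ≤ α)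
    (hout : ∀ y, ‖y - c‖ = b →
      V y ≤ α + K * (prof N a - prof N b) - M / 2 * (b ^ 2 - a ^ 2))
    {y : EN N} (hy1 : a ≤ ‖y - c‖) (hy2 : ‖y - c‖ ≤ b) :
    V y ≤ α + K * (prof N a - prof N ‖y - c‖) := by
  have hcn : Continuous fun y : EN N => ‖y - c‖ := by fun_prop
  set B : EN N → ℝ := fun y => α + K * (prof N a - prof N ‖y - c‖) +
    M / 2 * (a ^ 2 - ‖y - c‖ ^ 2) with hB
  have hBj : ∀ z, a ≤ ‖z - c‖ → ∃ g, HasJet B z g (-(M * N)) := by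
    intro z hz
    have hzc : z ≠ c := by rintro rfl; simp at hz; linarith
    exact ⟨_, (((hasJet_const α z).add (((hasJet_const (prof N a) z).sub
      (hasJet_prof hN hzc)).const_mul K)).add (((hasJet_const (a ^ 2) z).sub
      (hasJet_norm_sq c z)).const_mul (M / 2))).congr_val rfl rfl (by ring)⟩
  have hinB : ∀ y, ‖y - c‖ = a → V y - B y ≤ 0 := by
    intro z hz
    have := hin z hz
    simp only [hB, hz]
    linarith
  have houtB : ∀ y, ‖y - c‖ = b → V y - B y ≤ 0 := by
    intro z hz
    have := hout z hz
    simp only [hB, hz]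
    linarith
  set D : Set (EN N) := {y | a < ‖y - c‖ ∧ ‖y - c‖ < b} with hD
  have hDo : IsOpen D := (isOpen_lt continuous_const hcn).inter (isOpen_lt hcn continuous_const)
  have hcl : closure D ⊆ {y | a ≤ ‖y - c‖ ∧ ‖y - c‖ ≤ b} :=
    closure_minimal (fun y hy => ⟨hy.1.le, hy.2.le⟩)
      ((isClosed_le continuous_const hcn).inter (isClosed_le hcn continuous_const))
  have key : ∀ z ∈ D, V z - B z ≤ 0 := by
    refine max_principle_s15 (Z := fun y => V y - B y) hDo
      (isBounded_ball (x := c) (r := b) |>.subset fun y hy => by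
        rw [mem_ball, dist_eq_norm]; exact hy.2) ?_ ?_ ?_
    · refine (hVc.sub fun z hz => ?_).mono hcl
      obtain ⟨g, hg⟩ := hBj z hz.1
      exact hg.1.continuousAt.continuousWithinAt
    · rintro z ⟨hz1, hz2⟩
      obtain ⟨g, hg⟩ := hBj z hz1.le
      have hj := (hV z hz1 hz2).1.hasJet.sub hg
      refine ⟨hj.1, ?_⟩
      rw [hj.2.2]
      have := (hV z hz1 hz2).2
      have hN' : (2 : ℝ) ≤ N := by exact_mod_cast hN
      nlinarith
    · intro z hz
      obtain ⟨h1, h2⟩ := hcl hz.1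
      have hzD : z ∉ D := by rw [← hDo.interior_eq]; exact hz.2
      rcases h1.eq_or_lt with h | h
      · exact hinB z h.symm
      · rcases h2.eq_or_lt with h' | h'
        · exact houtB z h'
        · exact absurd ⟨h, h'⟩ hzD
  have hfin : V y - B y ≤ 0 := by
    rcases hy1.eq_or_lt with h | h
    · exact hinB y h.symm
    · rcases hy2.eq_or_lt with h' | h'
      · exact houtB y h'
      · exact key y ⟨h, h'⟩
  have : 0 ≤ M / 2 * (‖y - c‖ ^ 2 - a ^ 2) :=
    mul_nonneg (by positivity) (by nlinarith)
  simp only [hB] at hfin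
  linarith

/-- Gradient bound, in a given direction, in the middle of an annulus. -/
theorem annulus_gradient {N : ℕ} (hN : 2 ≤ N) {v : EN N → ℝ} {c : EN N} {ε R A L M τ : ℝ}
    (hε : 0 < ε) (hA : 0 ≤ A) (hL : 0 ≤ L)
    (hvc : ContinuousOn v {y | ε ≤ ‖y - c‖ ∧ ‖y - c‖ ≤ R})
    (hv : ∀ y, ε < ‖y - c‖ → ‖y - c‖ < R → ContDiffAt ℝ 2 v y ∧ |trHess v y| < M)
    (hin : ∀ e : EN N, ‖e‖ = 1 → ∀ y, ‖y - c‖ = ε → 0 ≤ ⟪e, y - c⟫_ℝ →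
      v y - v (c + hyperRefl e (y - c)) ≤ 2 * L * ⟪e, y - c⟫_ℝ)
    (hout : ∀ e : EN N, ‖e‖ = 1 → ∀ y, ‖y - c‖ = R → 0 ≤ ⟪e, y - c⟫_ℝ →
      v y - v (c + hyperRefl e (y - c)) ≤ A * ⟪e, y - c⟫_ℝ)
    (hin' : ∀ y, ‖y - c‖ = ε → |v y| ≤ L * ε) (hout' : ∀ y, ‖y - c‖ = R → |v y| ≤ τ)
    {x e : EN N} (he : ‖e‖ = 1) {r : ℝ} (hr : ‖x - c‖ = r) (hεr : 2 * ε < r) (hrR : 2 * r < R) :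
    fderiv ℝ v x e ≤
      2 * N * (L * ε + 2 * r * (A + 2 * L * ε ^ 2 * ((2 * r) ^ 2)⁻¹ + M * R) + 2 * M * r ^ 2) / r
      + M * r / 4
      + profConst N * (L * ε / (prof N ε - prof N (2 * r)) +
          (τ + M * R ^ 2 / 2) / (prof N ε - prof N R)) / r ^ (N - 1) := by
  have hr0 : 0 < r := by linarith
  have hM : 0 ≤ M := (abs_nonneg _).trans (hv x (by linarith) (by linarith)).2.le
  have hx0 : x ≠ c := by rintro rfl; simp at hr; linarith
  have hF1 : 0 < prof N ε - prof N (2 * r) := sub_pos.2 (prof_strictAnti hN hε (by linarith))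
  have hF2 : 0 < prof N ε - prof N R := sub_pos.2 (prof_strictAnti hN hε (by linarith))
  set T : ℝ := 2 * r * (A + 2 * L * ε ^ 2 * ((2 * r) ^ 2)⁻¹ + M * R) with hT
  have hosc : ∀ y z, ‖y - c‖ = 2 * r → ‖z - c‖ = 2 * r → v y - v z ≤ T := by
    intro y z hy hz
    have := annulus_oscillation hN hε (by linarith : ε < R) hA hL hvc hv hin hout
      (y := y) (z := z) (by linarith) (by linarith) (by rw [hy, hz])
    rwa [hy] at this
  set y₀ : EN N := c + (2 : ℝ) • (x - c) with hy₀
  have hy₀n : ‖y₀ - c‖ = 2 * r := by simp [hy₀, norm_smul, hr]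
  have hQ : 0 ≤ M / 2 * ε ^ 2 := by positivity
  -- bound for the value at `y₀`
  set K : ℝ := (τ + M * R ^ 2 / 2) / (prof N ε - prof N R) with hK
  have hKF : K * (prof N ε - prof N R) = τ + M * R ^ 2 / 2 := by rw [hK]; field_simp
  have hLε : 0 ≤ L * ε := by positivity
  have hb1 : v y₀ ≤ L * ε + K * (prof N ε - prof N (2 * r)) := by
    have := annulus_barrier hN (V := v) (c := c) (α := L * ε) (K := K) (M := M) hε hM hvc
      (fun y h1 h2 => ⟨(hv y h1 h2).1, (abs_lt.1 (hv y h1 h2).2).1⟩)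
      (fun y hy => (abs_le.1 (hin' y hy)).2)
      (fun y hy => by rw [hKF]; linarith [(abs_le.1 (hout' y hy)).2])
      (y := y₀) (by linarith) (by linarith)
    rwa [hy₀n] at this
  have hb2 : - v y₀ ≤ L * ε + K * (prof N ε - prof N (2 * r)) := by
    have := annulus_barrier hN (V := fun y => - v y) (c := c) (α := L * ε) (K := K) (M := M)
      hε hM hvc.neg
      (fun y h1 h2 => by
        have hj := (hv y h1 h2).1.hasJet.neg
        exact ⟨hj.1, by rw [hj.2.2]; linarith [(abs_lt.1 (hv y h1 h2).2).2]⟩)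
      (fun y hy => by linarith [(abs_le.1 (hin' y hy)).1])
      (fun y hy => by rw [hKF]; linarith [(abs_le.1 (hout' y hy)).1])
      (y := y₀) (by linarith) (by linarith)
    rwa [hy₀n] at this
  set β : ℝ := v y₀ / (prof N ε - prof N (2 * r)) with hβ
  have hβF : β * (prof N ε - prof N (2 * r)) = v y₀ := by rw [hβ]; field_simp
  have hβle : |β| ≤ L * ε / (prof N ε - prof N (2 * r)) + K := by
    rw [hβ, abs_div, abs_of_pos hF1, div_le_iff₀ hF1, add_mul, div_mul_cancel₀ _ hF1.ne']
    exact abs_le.2 ⟨by linarith, hb1⟩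
  -- comparison with the radial harmonic function
  set h : EN N → ℝ := fun y => β * (prof N ε - prof N ‖y - c‖) with hh
  have hhj : ∀ z, ε ≤ ‖z - c‖ →
      HasJet h z (β • (0 - (-(profConst N / ‖z - c‖ ^ N)) • (z - c))) 0 := by
    intro z hz
    have hzc : z ≠ c := by rintro rfl; simp at hz; linarith
    exact (((hasJet_const (prof N ε) z).sub (hasJet_prof hN hzc)).const_mul β).congr_val
      rfl rfl (by ring)
  have hsub : {y : EN N | ε ≤ ‖y - c‖ ∧ ‖y - c‖ ≤ 2 * r} ⊆ {y | ε ≤ ‖y - c‖ ∧ ‖y - c‖ ≤ R} :=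
    fun y hy => ⟨hy.1, by linarith [hy.2]⟩
  have hVc : ContinuousOn (fun y => v y - h y) {y | ε ≤ ‖y - c‖ ∧ ‖y - c‖ ≤ 2 * r} :=
    (hvc.mono hsub).sub fun z hz => (hhj z hz.1).1.continuousAt.continuousWithinAt
  have hVj : ∀ y, ε < ‖y - c‖ → ‖y - c‖ < 2 * r →
      ContDiffAt ℝ 2 (fun y => v y - h y) y ∧ trHess (fun y => v y - h y) y = trHess v y := by
    intro y h1 h2
    have hj := (hv y h1 (by linarith)).1.hasJet.sub (hhj y h1.le)
    exact ⟨hj.1, by rw [hj.2.2]; ring⟩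
  set S₀ : ℝ := L * ε + T + 2 * M * r ^ 2 with hS₀
  have hT0 : 0 ≤ T := by simpa using hosc y₀ y₀ hy₀n hy₀n
  have hMr : 0 ≤ M * r ^ 2 := by positivity
  have hc1 : ∀ y, ε ≤ ‖y - c‖ → ‖y - c‖ ≤ 2 * r → |v y - h y| ≤ S₀ := by
    intro y h1 h2
    have e1 := annulus_barrier hN (V := fun y => v y - h y) (c := c) (α := S₀) (K := 0) (M := M)
      hε hM hVc
      (fun y h1 h2 => ⟨(hVj y h1 h2).1, by
        rw [(hVj y h1 h2).2]; exact (abs_lt.1 (hv y h1 (by linarith)).2).1⟩)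
      (fun y hy => by
        simp only [hh, hy]
        linarith [(abs_le.1 (hin' y hy)).2])
      (fun y hy => by
        simp only [hh, hy, hβF]
        linarith [hosc y y₀ hy hy₀n]) h1 h2
    have e2 := annulus_barrier hN (V := fun y => -(v y - h y)) (c := c) (α := S₀) (K := 0)
      (M := M) hε hM hVc.neg
      (fun y h1 h2 => by
        have hj := (hVj y h1 h2).1.hasJet.neg
        exact ⟨hj.1, by
          rw [hj.2.2, (hVj y h1 h2).2]
          linarith [(abs_lt.1 (hv y h1 (by linarith)).2).2]⟩)
      (fun y hy => by
        simp only [hh, hy]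
        linarith [(abs_le.1 (hin' y hy)).1])
      (fun y hy => by
        simp only [hh, hy, hβF]
        linarith [hosc y₀ y hy₀n hy]) h1 h2
    exact abs_le.2 ⟨by linarith, by linarith⟩
  have hball : ∀ y ∈ closedBall x (r / 2), ε < ‖y - c‖ ∧ ‖y - c‖ < 2 * r := by
    intro y hy
    rw [mem_closedBall, dist_eq_norm] at hy
    have h1 : y - c = (y - x) + (x - c) := by abel
    have h2 : x - c = (y - c) - (y - x) := by abel
    have h3 := norm_add_le (y - x) (x - c)
    have h4 := norm_sub_le (y - c) (y - x)
    rw [← h1] at h3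
    rw [← h2] at h4
    constructor <;> linarith
  have hgrad := gradient_estimate (V := fun y => v y - h y) (x := x) (e := e) (ρ := r / 2)
    (S₀ := S₀) (M := M) (by positivity) he
    (hVc.mono fun y hy => ⟨(hball y hy).1.le, (hball y hy).2.le⟩)
    (fun y hy => by
      obtain ⟨h1, h2⟩ := hball y (ball_subset_closedBall hy)
      exact ⟨(hVj y h1 h2).1, by rw [(hVj y h1 h2).2]; exact (hv y h1 (by linarith)).2⟩)
    (fun y hy => hc1 y (hball y hy).1.le (hball y hy).2.le)
  have hxd := ((hv x (by linarith) (by linarith)).1.differentiableAt (by norm_num)).hasFDerivAt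
  have hhx := (hhj x (by linarith)).2.1
  have hfd : fderiv ℝ (fun y => v y - h y) x = _ := (hxd.sub hhx).fderiv
  rw [hfd] at hgrad
  simp only [_root_.sub_apply, innerSL_apply_apply, hr] at hgrad
  rw [zero_sub, neg_smul, neg_neg, real_inner_smul_left, real_inner_smul_left] at hgrad
  have hκ := profConst_pos hN
  have hin1 : ⟪x - c, e⟫_ℝ ≤ r ∧ -r ≤ ⟪x - c, e⟫_ℝ := by
    have := abs_le.1 (abs_real_inner_le_norm (x - c) e)
    rw [hr, he, mul_one] at this
    exact ⟨this.2, this.1⟩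
  have hrad : β * (profConst N / r ^ N * ⟪x - c, e⟫_ℝ) ≤
      profConst N * (L * ε / (prof N ε - prof N (2 * r)) + K) / r ^ (N - 1) := by
    have hpow : r ^ N = r ^ (N - 1) * r := by
      rw [← pow_succ]; congr 1; omega
    calc β * (profConst N / r ^ N * ⟪x - c, e⟫_ℝ)
        ≤ |β * (profConst N / r ^ N * ⟪x - c, e⟫_ℝ)| := le_abs_self _
      _ = |β| * (profConst N / r ^ N * |⟪x - c, e⟫_ℝ|) := by
          rw [abs_mul, abs_mul, abs_of_pos (by positivity : 0 < profConst N / r ^ N)]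
      _ ≤ |β| * (profConst N / r ^ N * r) := by
          gcongr; exact abs_le.2 ⟨hin1.2, hin1.1⟩
      _ = profConst N * |β| / r ^ (N - 1) := by
          rw [hpow]; field_simp
      _ ≤ _ := by gcongr
  have e3 : (N : ℝ) * S₀ / (r / 2) + M * (r / 2) / 2 = 2 * N * S₀ / r + M * r / 4 := by
    field_simp; ring
  linarith

theorem lap_eq_trHess {N : ℕ} {Z : EN N → ℝ} {p : EN N} (h : ContDiffAt ℝ 2 Z p) :
    lap Z p = trHess Z p := by
  refine Finset.sum_congr rfl fun i _ => ?_
  have h1 := h.hasFDerivAt_fderiv.clm_apply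
    (hasFDerivAt_const (EuclideanSpace.single i (1 : ℝ)) p)
  have h2 : fderiv ℝ (fun y => pd Z i y) p = _ := h1.fderiv
  unfold pd2
  rw [h2]
  simp

theorem norm_le_sum_abs_apply_single {N : ℕ} (T : EN N →L[ℝ] ℝ) :
    ‖T‖ ≤ ∑ i, |T (EuclideanSpace.single i 1)| := by
  refine T.opNorm_le_bound (Finset.sum_nonneg fun i _ => abs_nonneg _) fun x => ?_
  have hx : x = ∑ i, x i • EuclideanSpace.single i (1 : ℝ) := by
    ext j
    simp [Finset.sum_apply, Pi.single_apply]
  calc ‖T x‖ = ‖∑ i, x i * T (EuclideanSpace.single i 1)‖ := by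
        conv_lhs => rw [hx]
        simp
    _ ≤ ∑ i, ‖x i * T (EuclideanSpace.single i 1)‖ := norm_sum_le _ _
    _ ≤ ∑ i, |T (EuclideanSpace.single i 1)| * ‖x‖ := by
        refine Finset.sum_le_sum fun i _ => ?_
        rw [norm_mul, mul_comm, Real.norm_eq_abs (T _)]
        exact mul_le_mul_of_nonneg_left (PiLp.norm_apply_le x i) (abs_nonneg _)
    _ = _ := by rw [Finset.sum_mul]

/-- A function that is `C¹`-small near a sphere is nearly symmetric on it under reflections. -/
theorem sub_hyperRefl_le {N : ℕ} {w : EN N → ℝ} {c : EN N} {R κ : ℝ} (hR : 0 < R) (hκ : 0 ≤ κ)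
    (hw : ∀ y, R / 2 ≤ ‖y - c‖ → ‖y - c‖ ≤ R →
      DifferentiableAt ℝ w y ∧ |w y| ≤ κ * R ∧ ‖fderiv ℝ w y‖ ≤ κ)
    {e y : EN N} (he : ‖e‖ = 1) (hy : ‖y - c‖ = R) (h0 : 0 ≤ ⟪e, y - c⟫_ℝ) :
    w y - w (c + hyperRefl e (y - c)) ≤ 4 * κ * ⟪e, y - c⟫_ℝ := by
  set s := ⟪e, y - c⟫_ℝ with hs
  set y' := c + hyperRefl e (y - c) with hy'
  have hy'n : ‖y' - c‖ = R := by
    rw [hy', add_sub_cancel_left, LinearIsometryEquiv.norm_map, hy]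
  rcases le_or_gt (R / 2) s with hsR | hsR
  · have h1 := (abs_le.1 (hw y (by linarith) hy.le).2.1).2
    have h2 := (abs_le.1 (hw y' (by linarith) hy'n.le).2.1).1
    nlinarith
  · have hy'e : y' = y - (2 * s) • e := by
      rw [hy', hyperRefl_apply he]; abel
    have hseg : ∀ z ∈ segment ℝ y' y, R / 2 ≤ ‖z - c‖ ∧ ‖z - c‖ ≤ R := by
      intro z hz
      obtain ⟨a, b, ha, hb, hab, rfl⟩ := hz
      have hz : a • y' + b • y - c = (y - c) - (a * (2 * s)) • e := by
        obtain rfl : b = 1 - a := by linarith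
        rw [hy'e]; module
      have hsq : ‖a • y' + b • y - c‖ ^ 2 = R ^ 2 - 4 * (a * b) * s ^ 2 := by
        rw [hz, norm_sub_sq_real, real_inner_smul_right, real_inner_comm, ← hs, norm_smul, he, hy,
          Real.norm_eq_abs, mul_one, sq_abs]
        obtain rfl : b = 1 - a := by linarith
        ring
      have h4 : 4 * (a * b) ≤ 1 := by
        obtain rfl : b = 1 - a := by linarith
        nlinarith [sq_nonneg (2 * a - 1)]
      have hs2 : s ^ 2 ≤ R ^ 2 / 4 := by nlinarith
      have hab0 := mul_nonneg ha hb
      constructor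
      · refine le_of_sq_le_sq ?_ (norm_nonneg _)
        rw [hsq]
        nlinarith [mul_le_mul_of_nonneg_right h4 (sq_nonneg s), sq_nonneg R]
      · refine le_of_sq_le_sq ?_ hR.le
        rw [hsq]
        nlinarith [mul_nonneg hab0 (sq_nonneg s)]
    have := (convex_segment y' y).norm_image_sub_le_of_norm_fderiv_le (𝕜 := ℝ) (f := w) (C := κ)
      (fun z hz => (hw z (hseg z hz).1 (hseg z hz).2).1)
      (fun z hz => (hw z (hseg z hz).1 (hseg z hz).2).2.2)
      (left_mem_segment ℝ y' y) (right_mem_segment ℝ y' y)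
    have h1 : y - y' = (2 * s) • e := by rw [hy'e]; abel
    rw [h1, norm_smul, he, mul_one, Real.norm_eq_abs, Real.norm_eq_abs,
      abs_of_nonneg (by positivity : 0 ≤ 2 * s)] at this
    nlinarith [(abs_le.1 this).2, mul_nonneg hκ h0]

theorem Setting.exists_bounds {N : ℕ} {Ω : Set (EN N)} {P : EN N} {f : ℝ → ℝ} {ε₀ C : ℝ}
    {u : ℝ → EN N → ℝ} {u₀ : EN N → ℝ} (hset : Setting Ω P f ε₀ C u u₀) :
    ∃ R₀ L M : ℝ, 0 < R₀ ∧ 0 ≤ L ∧ 0 ≤ M ∧ closedBall P R₀ ⊆ Ω ∧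
      (∀ y ∈ closedBall P R₀, ∀ z ∈ closedBall P R₀, |u₀ y - u₀ z| ≤ L * ‖y - z‖) ∧
      ∀ ε ∈ Ioo (0 : ℝ) ε₀, ∀ y ∈ closedBall P R₀, ε < ‖y - P‖ →
        |f (u₀ y) - f (u ε y)| < M := by
  obtain ⟨hΩ, -, hP, hf, -, -, hC, ⟨h0, -, -, -, -⟩, -⟩ := hset
  obtain ⟨R₀, hR₀, hsub⟩ := nhds_basis_closedBall.mem_iff.1 (hΩ.mem_nhds hP)
  have hcpt := isCompact_closedBall P R₀
  have hat : ∀ y ∈ closedBall P R₀, ContDiffAt ℝ 2 u₀ y := fun y hy =>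
    h0.contDiffAt (hΩ.mem_nhds (hsub hy))
  obtain ⟨L, hL⟩ := hcpt.exists_bound_of_continuousOn (f := fderiv ℝ u₀) fun y hy =>
    (((hat y hy).fderiv_right (m := 1) (by norm_num)).continuousAt).continuousWithinAt
  obtain ⟨C₀, hC₀⟩ := hcpt.exists_bound_of_continuousOn (f := u₀) fun y hy =>
    (hat y hy).continuousAt.continuousWithinAt
  obtain ⟨M, hM⟩ := (isCompact_Icc (a := -max C C₀) (b := max C C₀)).exists_bound_of_continuousOn
    (f := f) hf.continuous.continuousOn
  have hL0 : 0 ≤ L := (norm_nonneg _).trans (hL P (mem_closedBall_self hR₀.le))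
  refine ⟨R₀, L, 2 * |M| + 1, hR₀, hL0, by positivity, hsub, fun y hy z hz => ?_,
    fun ε hε y hy hεy => ?_⟩
  · exact (convex_closedBall P R₀).norm_image_sub_le_of_norm_fderiv_le (𝕜 := ℝ)
      (fun q hq => (hat q hq).differentiableAt (by norm_num)) hL hz hy
  · have h1 := hM (u₀ y) (abs_le.1 ((hC₀ y hy).trans (le_max_right _ _)))
    have h2 := hM (u ε y) (abs_le.1 ((hC ε hε y ⟨hsub hy, by
      rw [mem_closedBall, dist_eq_norm]; exact not_le.2 hεy⟩).trans (le_max_left _ _)))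
    rw [Real.norm_eq_abs] at h1 h2
    have h3 := abs_sub (f (u₀ y)) (f (u ε y))
    linarith [le_abs_self M]

/-- The difference between `u ε` and `u₀`, corrected by a multiple of the radial profile. -/
def correctedDiff {N : ℕ} (P : EN N) (u : ℝ → EN N → ℝ) (u₀ : EN N → ℝ) (ε : ℝ) (y : EN N) : ℝ :=
  u ε y - u₀ y + u₀ P / prof N ε * prof N ‖y - P‖

theorem Setting.contDiffAt {N : ℕ} {Ω : Set (EN N)} {P : EN N} {f : ℝ → ℝ} {ε₀ C : ℝ}
    {u : ℝ → EN N → ℝ} {u₀ : EN N → ℝ} (hset : Setting Ω P f ε₀ C u u₀) {ε : ℝ}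
    (hε : ε ∈ Ioo (0 : ℝ) ε₀) {y : EN N} (hy : y ∈ Ω \ closedBall P ε) :
    ContDiffAt ℝ 2 (u ε) y ∧ ContDiffAt ℝ 2 u₀ y :=
  ⟨(hset.2.2.2.2.2.1 ε hε).1.contDiffAt ((hset.1.sdiff isClosed_closedBall).mem_nhds hy),
    hset.2.2.2.2.2.2.2.1.1.contDiffAt (hset.1.mem_nhds hy.1)⟩

theorem Setting.hasJet_correctedDiff {N : ℕ} (hN : 2 ≤ N) {Ω : Set (EN N)} {P : EN N} {f : ℝ → ℝ}
    {ε₀ C : ℝ} {u : ℝ → EN N → ℝ} {u₀ : EN N → ℝ} (hset : Setting Ω P f ε₀ C u u₀) {ε : ℝ}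
    (hε : ε ∈ Ioo (0 : ℝ) ε₀) {y : EN N} (hy : y ∈ Ω \ closedBall P ε) :
    ContDiffAt ℝ 2 (correctedDiff P u u₀ ε) y ∧
    trHess (correctedDiff P u u₀ ε) y = f (u₀ y) - f (u ε y) ∧
    ∀ v, fderiv ℝ (correctedDiff P u u₀ ε) y v = fderiv ℝ (u ε) y v - fderiv ℝ u₀ y v
      - u₀ P / prof N ε * (profConst N / ‖y - P‖ ^ N * ⟪y - P, v⟫_ℝ) := by
  obtain ⟨h1, h2⟩ := hset.contDiffAt hε hy
  have hyP : y ≠ P := by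
    rintro rfl; exact hy.2 (mem_closedBall_self hε.1.le)
  have hj := (h1.hasJet.sub h2.hasJet).add ((hasJet_prof hN hyP).const_mul (u₀ P / prof N ε))
  refine ⟨hj.1, hj.2.2.trans ?_, fun v => ?_⟩
  · rw [← lap_eq_trHess h1, ← lap_eq_trHess h2, (hset.2.2.2.2.2.1 ε hε).2.1 y hy,
      hset.2.2.2.2.2.2.2.1.2.1 y hy.1]
    ring
  · have : fderiv ℝ (correctedDiff P u u₀ ε) y = _ := hj.2.1.fderiv
    rw [this]
    simp only [map_add, map_sub, _root_.add_apply, _root_.sub_apply, innerSL_apply_apply,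
      real_inner_smul_left, InnerProductSpace.toDual_symm_apply]
    ring

theorem Setting.fderiv_correctedDiff_le {N : ℕ} (hN : 2 ≤ N) {Ω : Set (EN N)} {P : EN N}
    {f : ℝ → ℝ} {ε₀ C : ℝ} {u : ℝ → EN N → ℝ} {u₀ : EN N → ℝ}
    (hset : Setting Ω P f ε₀ C u u₀) {R L M κ : ℝ} (hR : 0 < R) (hL : 0 ≤ L) (hκ : 0 ≤ κ)
    (hsub : closedBall P R ⊆ Ω)
    (hLip : ∀ y ∈ closedBall P R, ∀ z ∈ closedBall P R, |u₀ y - u₀ z| ≤ L * ‖y - z‖)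
    {ε : ℝ} (hε : ε ∈ Ioo (0 : ℝ) ε₀)
    (hM : ∀ y ∈ closedBall P R, ε < ‖y - P‖ → |f (u₀ y) - f (u ε y)| < M)
    (hshell : ∀ y, R / 2 ≤ ‖y - P‖ → ‖y - P‖ ≤ R →
      |u ε y - u₀ y| ≤ κ * R ∧ ‖fderiv ℝ (u ε) y - fderiv ℝ u₀ y‖ ≤ κ)
    (hF : 0 < prof N ε) (hFR : |u₀ P / prof N ε * prof N R| ≤ κ)
    {x e : EN N} (he : ‖e‖ = 1) {r : ℝ} (hr : ‖x - P‖ = r) (hεr : 2 * ε < r) (hrR : 2 * r < R) :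
    fderiv ℝ (correctedDiff P u u₀ ε) x e ≤
      2 * N * (L * ε + 2 * r * (4 * κ + 2 * L * ε ^ 2 * ((2 * r) ^ 2)⁻¹ + M * R)
        + 2 * M * r ^ 2) / r + M * r / 4
      + profConst N * (L * ε / (prof N ε - prof N (2 * r)) +
          (κ * R + κ + M * R ^ 2 / 2) / (prof N ε - prof N R)) / r ^ (N - 1) := by
  have hmem : ∀ y, ε < ‖y - P‖ → ‖y - P‖ ≤ R → y ∈ Ω \ closedBall P ε := fun y h1 h2 =>
    ⟨hsub (mem_closedBall_iff_norm.2 h2), fun h => absurd (mem_closedBall_iff_norm.1 h) h1.not_ge⟩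
  have hclos : ∀ y, ε ≤ ‖y - P‖ → ‖y - P‖ ≤ R → y ∈ closure (Ω \ closedBall P ε) := by
    intro y h1 h2
    have hy : y ∈ closure (closedBall P ε)ᶜ := by
      rw [closure_compl, interior_closedBall _ hε.1.ne']
      exact fun h => absurd (mem_ball_iff_norm.1 h) h1.not_gt
    exact hset.1.inter_closure ⟨hsub (mem_closedBall_iff_norm.2 h2), hy⟩
  have hzero : ∀ y, ‖y - P‖ = ε → u ε y = 0 := by
    intro y hy
    refine (hset.2.2.2.2.2.1 ε hε).2.2.2.2 y ?_
    rw [(hset.1.sdiff isClosed_closedBall).frontier_eq]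
    exact ⟨hclos y hy.ge (by linarith), fun h => h.2 (mem_closedBall_iff_norm.2 hy.le)⟩
  have hin : ∀ y, ‖y - P‖ = ε → correctedDiff P u u₀ ε y = u₀ P - u₀ y := by
    intro y hy
    unfold correctedDiff
    rw [hzero y hy, hy, div_mul_cancel₀ _ hF.ne']
    ring
  have hrefl : ∀ (e y : EN N), ‖P + hyperRefl e (y - P) - P‖ = ‖y - P‖ := fun e y => by
    rw [add_sub_cancel_left, LinearIsometryEquiv.norm_map]
  have hball : ∀ y, ‖y - P‖ = ε → y ∈ closedBall P R := fun y hy =>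
    mem_closedBall_iff_norm.2 (by linarith)
  refine annulus_gradient hN hε.1 (by positivity) hL ?_ ?_ ?_ ?_ ?_ ?_ he hr hεr hrR
  · have h1 : ContinuousOn (u ε) {y | ε ≤ ‖y - P‖ ∧ ‖y - P‖ ≤ R} :=
      (hset.2.2.2.2.2.1 ε hε).2.2.2.1.mono fun y hy => hclos y hy.1 hy.2
    have h2 : ContinuousOn u₀ {y | ε ≤ ‖y - P‖ ∧ ‖y - P‖ ≤ R} :=
      hset.2.2.2.2.2.2.2.1.1.continuousOn.mono fun y hy =>
        hsub (mem_closedBall_iff_norm.2 hy.2)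
    have h3 : ContinuousOn (fun y => prof N ‖y - P‖) {y | ε ≤ ‖y - P‖ ∧ ‖y - P‖ ≤ R} := by
      intro y hy
      have hyP : y ≠ P := by
        rintro rfl
        have := hy.1
        rw [sub_self, norm_zero] at this
        exact absurd hε.1 this.not_gt
      exact (hasJet_prof hN hyP).1.continuousAt.continuousWithinAt
    exact (h1.sub h2).add (continuousOn_const.mul h3)
  · intro y h1 h2
    obtain ⟨h3, h4, -⟩ := hset.hasJet_correctedDiff hN hε (hmem y h1 h2.le)
    exact ⟨h3, by rw [h4]; exact hM y (mem_closedBall_iff_norm.2 h2.le) h1⟩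
  · intro e he y hy h0
    rw [hin y hy, hin _ ((hrefl e y).trans hy)]
    have h1 := hLip _ (hball _ ((hrefl e y).trans hy)) y (hball y hy)
    have h2 : P + hyperRefl e (y - P) - y = -((2 * ⟪e, y - P⟫_ℝ) • e) := by
      rw [hyperRefl_apply he]; abel
    rw [h2, norm_neg, norm_smul, he, mul_one, Real.norm_eq_abs,
      abs_of_nonneg (by positivity : 0 ≤ 2 * ⟪e, y - P⟫_ℝ)] at h1
    linarith [(abs_le.1 h1).2]
  · intro e he y hy h0
    have h1 := sub_hyperRefl_le (w := fun y => u ε y - u₀ y) (c := P) hR hκ (fun z h1 h2 => by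
      obtain ⟨h3, h4⟩ := hset.contDiffAt hε (hmem z (by linarith) h2)
      have h5 := h3.differentiableAt (by norm_num)
      have h6 := h4.differentiableAt (by norm_num)
      have h7 : fderiv ℝ (fun y => u ε y - u₀ y) z = _ := (h5.hasFDerivAt.sub h6.hasFDerivAt).fderiv
      exact ⟨h5.sub h6, (hshell z h1 h2).1, by rw [h7]; exact (hshell z h1 h2).2⟩) he hy h0
    unfold correctedDiff
    rw [hrefl e y]
    linarith
  · intro y hy
    rw [hin y hy, abs_sub_comm, ← hy]
    exact hLip y (hball y hy) P (mem_closedBall_self hR.le)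
  · intro y hy
    unfold correctedDiff
    rw [hy]
    exact (abs_add_le _ _).trans (add_le_add (hshell y (by linarith) hy.le).1 hFR)

theorem Setting.eventually_shell {N : ℕ} (hN : 2 ≤ N) {Ω : Set (EN N)} {P : EN N}
    {f : ℝ → ℝ} {ε₀ C : ℝ} {u : ℝ → EN N → ℝ} {u₀ : EN N → ℝ}
    (hset : Setting Ω P f ε₀ C u u₀) {R κ : ℝ} (hR : 0 < R) (hκ : 0 < κ)
    (hsub : closedBall P R ⊆ Ω) :
    ∀ᶠ ε in 𝓝[>] (0 : ℝ), ∀ y, R / 2 ≤ ‖y - P‖ → ‖y - P‖ ≤ R →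
      |u ε y - u₀ y| ≤ κ * R ∧ ‖fderiv ℝ (u ε) y - fderiv ℝ u₀ y‖ ≤ κ := by
  set K : Set (EN N) := closedBall P R \ ball P (R / 2) with hK
  have hKmem : ∀ y, R / 2 ≤ ‖y - P‖ → ‖y - P‖ ≤ R → y ∈ K := fun y h1 h2 =>
    ⟨mem_closedBall_iff_norm.2 h2, fun h => absurd (mem_ball_iff_norm.1 h) h1.not_gt⟩
  have hKc : IsCompact K := (isCompact_closedBall P R).diff isOpen_ball
  have hKΩ : K ⊆ Ω \ {P} := fun y hy => ⟨hsub hy.1, fun h => by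
    rw [mem_singleton_iff.1 h] at hy
    exact hy.2 (mem_ball_self (by positivity))⟩
  obtain ⟨h0, h1, -⟩ := hset.2.2.2.2.2.2.2.2 K hKΩ hKc
  have hN0 : (0 : ℝ) < N := by exact_mod_cast (by omega : 0 < N)
  have e0 := tendstoUniformlyOn_iff.1 h0 (κ * R) (by positivity)
  have e1 := eventually_all.2 fun i => tendstoUniformlyOn_iff.1 (h1 i) (κ / N) (by positivity)
  filter_upwards [e0, e1] with ε h2 h3 y hy1 hy2
  have hy := hKmem y hy1 hy2
  have h4 := h2 y hy
  rw [dist_comm, Real.dist_eq] at h4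
  refine ⟨h4.le, (norm_le_sum_abs_apply_single _).trans ?_⟩
  calc ∑ i, |(fderiv ℝ (u ε) y - fderiv ℝ u₀ y) (EuclideanSpace.single i 1)|
      ≤ ∑ _i : Fin N, κ / N := by
        refine Finset.sum_le_sum fun i _ => ?_
        have h5 := h3 i y hy
        rw [dist_comm, Real.dist_eq] at h5
        exact h5.le
    _ = κ := by
        simp only [Finset.sum_const, Finset.card_univ, Fintype.card_fin, nsmul_eq_mul]
        field_simp

theorem annulus_bound_le {N : ℕ} (hN : 2 ≤ N) {L M s ε r : ℝ} (hL : 0 ≤ L) (hM : 0 ≤ M)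
    (hs : 0 < s) (hs1 : s ≤ 1) (hε : 0 < ε) (hr : 0 < r) (hrs : r ≤ s) (hεr : ε ≤ s * r)
    (hF : 0 < prof N ε) (hFs : prof N s ≤ prof N ε / 2) :
    2 * N * (L * ε + 2 * r * (4 * s + 2 * L * ε ^ 2 * ((2 * r) ^ 2)⁻¹ + M * s)
        + 2 * M * r ^ 2) / r + M * r / 4
      + profConst N * (L * ε / (prof N ε - prof N (2 * r)) +
          (s * s + s + M * s ^ 2 / 2) / (prof N ε - prof N s)) / r ^ (N - 1)
    ≤ s * (2 * N * (3 * L + 8 + 4 * M) + M + profConst N * (2 * L + 4 + M)) *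
        (1 + 1 / (prof N ε * r ^ (N - 1))) := by
  have hk := profConst_pos hN
  have hss : s * s ≤ s := by nlinarith
  have hεr' : ε ≤ r := hεr.trans (by nlinarith)
  have hX : 0 < prof N ε * r ^ (N - 1) := by positivity
  have t1 : 2 * N * (L * ε + 2 * r * (4 * s + 2 * L * ε ^ 2 * ((2 * r) ^ 2)⁻¹ + M * s)
        + 2 * M * r ^ 2) / r ≤ s * (2 * N * (3 * L + 8 + 4 * M)) := by
    have h1 : 2 * L * ε ^ 2 * ((2 * r) ^ 2)⁻¹ ≤ L * s := by
      rw [← div_eq_mul_inv, div_le_iff₀ (by positivity)]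
      have h2 : ε ^ 2 ≤ (s * r) ^ 2 := pow_le_pow_left₀ hε.le hεr 2
      have h3 : (s * r) ^ 2 ≤ s * r ^ 2 := by nlinarith [sq_nonneg r]
      have h4 : 0 ≤ L * (s * r ^ 2) := by positivity
      nlinarith [mul_le_mul_of_nonneg_left (h2.trans h3) hL]
    have h2 : L * ε ≤ L * (s * r) := mul_le_mul_of_nonneg_left hεr hL
    have h3 : M * r ^ 2 ≤ M * (r * s) := mul_le_mul_of_nonneg_left (by nlinarith) hM
    have h4 : 2 * r * (4 * s + 2 * L * ε ^ 2 * ((2 * r) ^ 2)⁻¹ + M * s) ≤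
        2 * r * (4 * s + L * s + M * s) := by gcongr
    rw [div_le_iff₀ hr]
    calc _ ≤ 2 * (N : ℝ) * (L * (s * r) + 2 * r * (4 * s + L * s + M * s) + 2 * (M * (r * s))) := by
          refine mul_le_mul_of_nonneg_left ?_ (by positivity)
          linarith
      _ = _ := by ring
  have t2 : M * r / 4 ≤ s * M := by nlinarith [mul_le_mul_of_nonneg_left hrs hM, mul_nonneg hM hs.le]
  have t3 : L * ε / (prof N ε - prof N (2 * r)) ≤ 2 * L * s * r ^ (N - 1) := by
    have hg := prof_gap hN hε hεr'
    have hpow : 0 < ε ^ (N - 2) := by positivity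
    have h1 : ε ^ (N - 1) ≤ s * r ^ (N - 1) := by
      calc ε ^ (N - 1) ≤ (s * r) ^ (N - 1) := pow_le_pow_left₀ hε.le hεr _
        _ = s ^ (N - 1) * r ^ (N - 1) := mul_pow _ _ _
        _ ≤ s * r ^ (N - 1) := by
          gcongr
          exact pow_le_of_le_one hs.le hs1 (by omega)
    have h2 : ε ^ (N - 1) = ε * ε ^ (N - 2) := by
      rw [← pow_succ']; congr 1; omega
    calc L * ε / (prof N ε - prof N (2 * r)) ≤ L * ε / (1 / 2 * (ε ^ (N - 2))⁻¹) := by gcongr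
      _ = 2 * L * ε ^ (N - 1) := by rw [h2]; field_simp
      _ ≤ 2 * L * (s * r ^ (N - 1)) := by gcongr
      _ = _ := by ring
  have t4 : (s * s + s + M * s ^ 2 / 2) / (prof N ε - prof N s) ≤ s * (4 + M) / prof N ε := by
    calc (s * s + s + M * s ^ 2 / 2) / (prof N ε - prof N s)
        ≤ (s * s + s + M * s ^ 2 / 2) / (prof N ε / 2) := by
          gcongr; linarith
      _ = (2 * (s * s) + 2 * s + M * (s * s)) / prof N ε := by field_simp
      _ ≤ _ := by
        gcongr
        nlinarith [mul_le_mul_of_nonneg_left hss hM]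
  have t5 : profConst N * (L * ε / (prof N ε - prof N (2 * r)) +
          (s * s + s + M * s ^ 2 / 2) / (prof N ε - prof N s)) / r ^ (N - 1) ≤
      s * (profConst N * (2 * L)) + s * (profConst N * (4 + M)) * (1 / (prof N ε * r ^ (N - 1))) := by
    calc _ ≤ profConst N * (2 * L * s * r ^ (N - 1) + s * (4 + M) / prof N ε) / r ^ (N - 1) := by
          gcongr
      _ = _ := by field_simp
  set X := 1 / (prof N ε * r ^ (N - 1)) with hXd
  have hX0 : 0 ≤ X := by positivity
  have a1 : 0 ≤ s * (2 * N * (3 * L + 8 + 4 * M) + M + profConst N * (2 * L)) * X := by positivity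
  have a2 : 0 ≤ s * (profConst N * (4 + M)) := by positivity
  have a3 : s * (2 * N * (3 * L + 8 + 4 * M) + M + profConst N * (2 * L + 4 + M)) * (1 + X) =
    s * (2 * N * (3 * L + 8 + 4 * M)) + s * M + s * (profConst N * (2 * L))
      + s * (profConst N * (4 + M)) * X + s * (profConst N * (4 + M))
      + s * (2 * N * (3 * L + 8 + 4 * M) + M + profConst N * (2 * L)) * X := by ring
  rw [a3]
  linarith

/-- Near `P` but far from `B(P,ε)` at the scale `ε`, the partial derivatives of `u ε - u₀` are
those of a multiple of the radial profile, up to a small error. -/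
theorem Setting.pd_correctedDiff_le {N : ℕ} (hN : 2 ≤ N) {Ω : Set (EN N)} {P : EN N}
    {f : ℝ → ℝ} {ε₀ C : ℝ} {u : ℝ → EN N → ℝ} {u₀ : EN N → ℝ}
    (hset : Setting Ω P f ε₀ C u u₀) {δ : ℝ} (hδ : 0 < δ) :
    ∃ η > (0 : ℝ), ∀ ε ∈ Ioo (0 : ℝ) η, ∀ x, 0 < ‖x - P‖ → ‖x - P‖ ≤ η →
      ε ≤ η * ‖x - P‖ → ∀ i : Fin N, 0 < prof N ε ∧
        |pd (u ε) i x - pd u₀ i x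
            - u₀ P / prof N ε * (profConst N / ‖x - P‖ ^ N * (x i - P i))|
          ≤ δ * (1 + 1 / (prof N ε * ‖x - P‖ ^ (N - 1))) := by
  obtain ⟨R₀, L, M, hR₀, hL, hM, hsub, hLip, hf⟩ := hset.exists_bounds
  have hk := profConst_pos hN
  set Q : ℝ := 2 * N * (3 * L + 8 + 4 * M) + M + profConst N * (2 * L + 4 + M) with hQ
  have hQ0 : 0 < Q := by positivity
  set s : ℝ := min (min R₀ 1) (δ / Q) with hs
  have hs0 : 0 < s := by positivity
  have hsR : s ≤ R₀ := (min_le_left _ _).trans (min_le_left _ _)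
  have hs1 : s ≤ 1 := (min_le_left _ _).trans (min_le_right _ _)
  have hsQ : s * Q ≤ δ := (le_div_iff₀ hQ0).1 (min_le_right _ _)
  have hss : closedBall P s ⊆ closedBall P R₀ := closedBall_subset_closedBall hsR
  have hev := hset.eventually_shell hN hs0 hs0 (hss.trans hsub)
  have hprof := (tendsto_prof hN).eventually_ge_atTop
    (max (max 1 (2 * prof N s)) (|u₀ P| * |prof N s| / s))
  obtain ⟨η₁, hη₁, hη⟩ := mem_nhdsGT_iff_exists_Ioo_subset.1 (hev.and hprof)
  have hη₁0 : 0 < η₁ := hη₁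
  have hε₀ : 0 < ε₀ := hset.2.2.2.2.1
  refine ⟨min (min η₁ ε₀) (s / 4), by positivity,
    fun ε hε x hx0 hxη hεx i => ?_⟩
  set r := ‖x - P‖ with hr
  have hrs : r ≤ s / 4 := hxη.trans (min_le_right _ _)
  have hεη : ε < η₁ := hε.2.trans_le ((min_le_left _ _).trans (min_le_left _ _))
  have hεε₀ : ε < ε₀ := hε.2.trans_le ((min_le_left _ _).trans (min_le_right _ _))
  have hεs : ε ≤ s / 4 * r := hεx.trans (by gcongr; exact min_le_right _ _)
  have h2ε : 2 * ε < r := by nlinarith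
  obtain ⟨hsh, hp⟩ := hη ⟨hε.1, hεη⟩
  have hp1 : 1 ≤ prof N ε := ((le_max_left _ _).trans (le_max_left _ _)).trans hp
  have hp2 : 2 * prof N s ≤ prof N ε := ((le_max_right _ _).trans (le_max_left _ _)).trans hp
  have hp3 : |u₀ P| * |prof N s| / s ≤ prof N ε := (le_max_right _ _).trans hp
  have hF : 0 < prof N ε := by linarith
  refine ⟨hF, ?_⟩
  have hFR : |u₀ P / prof N ε * prof N s| ≤ s := by
    rw [abs_mul, abs_div, abs_of_pos hF, div_mul_eq_mul_div, div_le_iff₀ hF]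
    rw [div_le_iff₀ hs0] at hp3
    linarith
  have hmain : ∀ e : EN N, ‖e‖ = 1 → fderiv ℝ (correctedDiff P u u₀ ε) x e ≤
      δ * (1 + 1 / (prof N ε * r ^ (N - 1))) := by
    intro e he
    refine (hset.fderiv_correctedDiff_le hN hs0 hL hs0.le (hss.trans hsub)
      (fun y hy z hz => hLip y (hss hy) z (hss hz)) ⟨hε.1, hεε₀⟩
      (fun y hy => hf ε ⟨hε.1, hεε₀⟩ y (hss hy)) hsh hF hFR he hr.symm h2ε
      (by linarith)).trans ?_
    refine (annulus_bound_le hN hL hM hs0 hs1 hε.1 hx0 (by linarith)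
      (hεs.trans (by gcongr; linarith)) hF (by linarith)).trans ?_
    exact mul_le_mul_of_nonneg_right hsQ (by positivity)
  have hxmem : x ∈ Ω \ closedBall P ε :=
    ⟨hsub (hss (mem_closedBall_iff_norm.2 (by linarith))), fun h => by
      have := mem_closedBall_iff_norm.1 h
      linarith [hε.1]⟩
  have hform := (hset.hasJet_correctedDiff hN ⟨hε.1, hεε₀⟩ hxmem).2.2 (EuclideanSpace.single i 1)
  have hinner : ⟪x - P, EuclideanSpace.single i (1 : ℝ)⟫_ℝ = x i - P i := by
    rw [EuclideanSpace.inner_single_right]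
    simp
  rw [hinner] at hform
  have hpos := hmain (EuclideanSpace.single i 1) (by simp)
  have hneg := hmain (-EuclideanSpace.single i 1) (by simp)
  rw [map_neg] at hneg
  rw [hform] at hpos hneg
  unfold pd
  exact abs_le.2 ⟨by linarith, hpos⟩

/-- Proposition 4.3 of the paper.  In the regime `|x-P| → 0`,
`|x-P|/ε → ∞`, for each `i`:
`∂u_ε/∂x_i = ∂u₀/∂x_i + (N-2)(u₀(P)+o(1))(x_i-P_i)ε^{N-2}/|x-P|^N + o(1)` if `N ≥ 3`, and
`∂u_ε/∂x_i = ∂u₀/∂x_i - (u₀(P)+o(1))(x_i-P_i)/(log ε·|x-P|²) + o(1)` if `N = 2`;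
the errors are encoded by the bound `δ·(1 + ε^{N-2}/|x-P|^{N-1})`
(resp. `δ·(1 + 1/(|log ε||x-P|))`). -/
theorem stmt15
    {N : ℕ} (hN : 2 ≤ N)
    (Ω : Set (EN N)) (P : EN N) (f : ℝ → ℝ) (ε₀ C : ℝ)
    (u : ℝ → EN N → ℝ) (u₀ : EN N → ℝ)
    (hset : Setting Ω P f ε₀ C u u₀) :
    ∀ δ > (0:ℝ), ∃ η > (0:ℝ), ∀ ε ∈ Ioo (0:ℝ) η, ∀ x ∈ Ω \ closedBall P ε,
      ‖x - P‖ ≤ η → ε ≤ η * ‖x - P‖ → ∀ i : Fin N,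
        (3 ≤ N →
          |pd (u ε) i x - pd u₀ i x
              - ((N:ℝ) - 2) * u₀ P * (x i - P i) * ε ^ (N - 2) / ‖x - P‖ ^ N|
            ≤ δ * (1 + ε ^ (N - 2) / ‖x - P‖ ^ (N - 1))) ∧
        (N = 2 →
          |pd (u ε) i x - pd u₀ i x + u₀ P * (x i - P i) / (Real.log ε * ‖x - P‖ ^ 2)|
            ≤ δ * (1 + 1 / (|Real.log ε| * ‖x - P‖))) := by
  intro δ hδ
  obtain ⟨η, hη0, hη⟩ := hset.pd_correctedDiff_le hN hδ
  refine ⟨η, hη0, fun ε hε x hx hxη hεx i => ?_⟩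
  have hxε : ε < ‖x - P‖ := by
    by_contra! h
    exact hx.2 (mem_closedBall_iff_norm.2 h)
  have hx0 : 0 < ‖x - P‖ := hε.1.trans hxε
  obtain ⟨hF, hmain⟩ := hη ε hε x hx0 hxη hεx i
  have hε0 : 0 < ε := hε.1
  constructor
  · intro h3
    have hN2 : N ≠ 2 := by omega
    simp only [prof, profConst, if_neg hN2] at hmain
    convert hmain using 2
    · congr 1
      field_simp
    · congr 1
      field_simp
  · intro h2
    subst h2
    simp only [prof, profConst, if_pos] at hmain hF
    have hlog : |Real.log ε| = -Real.log ε := abs_of_neg (by linarith)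
    have hlog0 : Real.log ε ≠ 0 := by intro h; rw [h] at hF; simp at hF
    rw [hlog]
    convert hmain using 2
    · rw [sub_eq_add_neg]
      congr 1
      field_simp
    · norm_num
end
end
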